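/- Let G be a finitely generated group and d ≥ 1, and suppose G is integrably measure equivalent to ℤ^d: there exist a nonzero σ-finite measure space (Ω,m), commuting m-preserving essentially free measurable actions of G and ℤ^d on Ω, finite-measure measurable fundamental domains Y for the G-action and X for the ℤ^d-action, and the associated cocycles α : G × X → ℤ^d and β : ℤ^d × Y → G (defined by g·x ∈ α(g,x)⁻¹·X and v·y ∈ β(v,y)⁻¹·Y) satisfy ∫_X |α(g,x)| dm(x) < ∞ for all g ∈ G and ∫_Y |β(v,y)|_G dm(y) < ∞ for all v ∈ ℤ^d, where |·| is a word length on ℤ^d and |·|_G a word length on G. Then G is virtually ℤ^d: G contains a finite-index subgroup isomorphic to ℤ^d. -/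

import Mathlib

open MeasureTheory

/-- Word length of `g` with respect to a generating set `S`:
the least `n` such that `g` is a product of `n` elements of `S`. -/
noncomputable def wlen {G : Type*} [Group G] (S : Set G) (g : G) : ℕ :=
  sInf {n : ℕ | ∃ l : List G, (∀ s ∈ l, s ∈ S) ∧ l.length = n ∧ l.prod = g}

section NormedRingEstimates

variable {A : Type*} [NormedRing A]

lemma norm_one_add_pow_sub_one_le (x : A) (N : ℕ) (hN : N * ‖x‖ ≤ 1 / 8) :
    ∀ q ≤ N, ‖(1 + x) ^ q - 1‖ ≤ 2 * q * ‖x‖ := by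
  intro q
  induction q with
  | zero => intro _; simp
  | succ q ih =>
    intro hq
    have h := ih (by omega)
    have e : (1 + x) ^ (q + 1) - 1 = ((1 + x) ^ q - 1) + ((1 + x) ^ q - 1) * x + x := by
      rw [pow_succ]; noncomm_ring
    have hq' : (q : ℝ) * ‖x‖ ≤ 1 / 8 := by
      refine le_trans ?_ hN
      gcongr; omega
    have h2 : ‖((1 + x) ^ q - 1) * x‖ ≤ 2 * q * ‖x‖ * ‖x‖ :=
      (norm_mul_le _ _).trans (by gcongr)
    rw [e]
    refine (norm_add₃_le).trans ?_
    push_cast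
    nlinarith [norm_nonneg x]

lemma norm_one_add_pow_sub_one_ge [NormedAlgebra ℝ A] (x : A) (N : ℕ) (hN : N * ‖x‖ ≤ 1 / 8)
    {q : ℕ} (h1 : 1 ≤ q) (hq : q ≤ N) : ‖x‖ / 2 ≤ ‖(1 + x) ^ q - 1‖ := by
  have key : ∀ q ≤ N, ‖(1 + x) ^ q - 1 - (q : ℝ) • x‖ ≤ q * (‖x‖ / 4) := by
    intro q
    induction q with
    | zero => intro _; simp
    | succ q ih =>
      intro hq
      have h := ih (by omega)
      have h3 := norm_one_add_pow_sub_one_le x N hN q (by omega)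
      have e : (1 + x) ^ (q + 1) - 1 - ((q + 1 : ℕ) : ℝ) • x
          = ((1 + x) ^ q - 1 - (q : ℝ) • x) + ((1 + x) ^ q - 1) * x := by
        rw [pow_succ]; push_cast; rw [add_smul, one_smul]; noncomm_ring
      have hq' : (q : ℝ) * ‖x‖ ≤ 1 / 8 := by
        refine le_trans ?_ hN
        gcongr; omega
      have h2 : ‖((1 + x) ^ q - 1) * x‖ ≤ 2 * q * ‖x‖ * ‖x‖ :=
        (norm_mul_le _ _).trans (by gcongr)
      rw [e]
      refine (norm_add_le _ _).trans ?_
      push_cast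
      nlinarith [norm_nonneg x]
  have h := key q hq
  have h4 : ‖(q : ℝ) • x‖ = q * ‖x‖ := by rw [norm_smul]; simp
  have h5 := norm_sub_norm_le ((q : ℝ) • x) ((q : ℝ) • x - ((1 + x) ^ q - 1))
  rw [h4, sub_sub_cancel, norm_sub_rev] at h5
  have h6 : (1 : ℝ) ≤ q := by exact_mod_cast h1
  nlinarith [norm_nonneg x]

variable [NormOneClass A]

lemma norm_le_two_of_mul_eq_one {P Q : A} (h : Q * P = 1) (hP : ‖P - 1‖ ≤ 1 / 2) : ‖Q‖ ≤ 2 := by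
  have e : Q = 1 - Q * (P - 1) := by rw [mul_sub, h]; simp
  have h1 : ‖Q‖ ≤ 1 + ‖Q‖ * (1 / 2) := by
    calc ‖Q‖ = ‖1 - Q * (P - 1)‖ := by rw [← e]
      _ ≤ ‖(1 : A)‖ + ‖Q * (P - 1)‖ := norm_sub_le _ _
      _ ≤ 1 + ‖Q‖ * (1 / 2) := by
        rw [norm_one]; gcongr
        exact (norm_mul_le _ _).trans (by gcongr)
  linarith

variable {G : Type*} [Group G]

open scoped commutatorElement in
lemma norm_map_commutator_sub_one_le (κ : G →* A) (g s : G)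
    (hg : ‖κ g - 1‖ ≤ 1 / 2) (hs : ‖κ s - 1‖ ≤ 1 / 2) :
    ‖κ ⁅g, s⁆ - 1‖ ≤ 8 * ‖κ s - 1‖ * ‖κ g - 1‖ := by
  have e : κ ⁅g, s⁆ - 1 = ((κ g - 1) * (κ s - 1) - (κ s - 1) * (κ g - 1)) * (κ g⁻¹ * κ s⁻¹) := by
    have h1 : κ s * κ g * (κ g⁻¹ * κ s⁻¹) = 1 := by
      rw [← map_mul, ← map_mul, ← map_mul]; simp
    have h2 : κ ⁅g, s⁆ = κ g * κ s * (κ g⁻¹ * κ s⁻¹) := by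
      rw [← map_mul, ← map_mul, ← map_mul, commutatorElement_def]; congr 1; group
    rw [h2]
    nth_rewrite 1 [← h1]
    noncomm_ring
  have h1 : ‖κ g⁻¹‖ ≤ 2 := norm_le_two_of_mul_eq_one (P := κ g) (by rw [← map_mul]; simp) hg
  have h2 : ‖κ s⁻¹‖ ≤ 2 := norm_le_two_of_mul_eq_one (P := κ s) (by rw [← map_mul]; simp) hs
  rw [e]
  calc _ ≤ ‖(κ g - 1) * (κ s - 1) - (κ s - 1) * (κ g - 1)‖ * ‖κ g⁻¹ * κ s⁻¹‖ := norm_mul_le _ _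
    _ ≤ (‖κ g - 1‖ * ‖κ s - 1‖ + ‖κ s - 1‖ * ‖κ g - 1‖) * (2 * 2) := by
      gcongr
      · refine (norm_sub_le _ _).trans ?_
        gcongr <;> exact norm_mul_le _ _
      · refine (norm_mul_le _ _).trans ?_
        gcongr
    _ = _ := by ring

/-- The words `g_j ^ p_j * g_{j+1} ^ p_{j+1} * ⋯` with exponents below `N` have pairwise distinct
images when the distances of the `κ (g_k)` to `1` shrink rapidly. -/
lemma exists_finset_of_shrinking [NormedAlgebra ℝ A] (κ : G →* A) (len : G → ℕ)
    (len_one : len 1 = 0)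
    (len_mul : ∀ g h, len (g * h) ≤ len g + len h) (N ℓ : ℕ) (g : ℕ → G)
    (hlen : ∀ k, len (g k) ≤ ℓ * 2 ^ k)
    (hsmall : ∀ k, N * ‖κ (g k) - 1‖ ≤ 1 / 8)
    (hN : 1 ≤ N)
    (hshrink : ∀ k, 1000 * N * ‖κ (g (k + 1)) - 1‖ ≤ ‖κ (g k) - 1‖)
    (hne : ∀ k, κ (g k) ≠ 1) (m : ℕ) :
    ∀ j, ∃ F : Finset G, F.card = N ^ m ∧ Set.InjOn κ F ∧
      (∀ h ∈ F, ‖κ h - 1‖ ≤ 4 * N * ‖κ (g j) - 1‖) ∧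
      ∀ h ∈ F, len h + N * ℓ * 2 ^ j ≤ N * ℓ * 2 ^ (j + m) := by
  classical
  have len_pow : ∀ (x : G) (p : ℕ), len (x ^ p) ≤ p * len x := by
    intro x p
    induction p with
    | zero => simp [len_one]
    | succ p ih =>
      rw [pow_succ]
      have := len_mul (x ^ p) x
      rw [Nat.succ_mul]; omega
  induction m with
  | zero =>
    intro j
    refine ⟨{1}, by simp, by simp, ?_, ?_⟩
    · intro h hh
      simp only [Finset.mem_singleton] at hh
      subst hh
      simp; positivity
    · intro h hh
      simp only [Finset.mem_singleton] at hh
      subst hh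
      simp [len_one]
  | succ m ih =>
    intro j
    obtain ⟨F, hcard, hinj, hnorm, hlenF⟩ := ih (j + 1)
    set x := κ (g j) - 1 with hx
    have hκ : κ (g j) = 1 + x := by rw [hx]; abel
    have hxpos : 0 < ‖x‖ := norm_pos_iff.2 (sub_ne_zero.2 (hne j))
    have hN1 : (1 : ℝ) ≤ N := by exact_mod_cast hN
    set r := ‖κ (g (j + 1)) - 1‖ with hr
    have hr' : 1000 * N * r ≤ ‖x‖ := hshrink j
    have hup : ∀ p < N, ‖κ (g j) ^ p - 1‖ ≤ 2 * N * ‖x‖ := fun p hp => by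
      rw [hκ]
      refine (norm_one_add_pow_sub_one_le x N (hsmall j) p hp.le).trans ?_
      gcongr
    have hup2 : ∀ p < N, ‖κ (g j) ^ p‖ ≤ 2 := fun p hp => by
      have h1 := hup p hp
      have h2 := norm_add_le (κ (g j) ^ p - 1) 1
      rw [sub_add_cancel, norm_one] at h2
      have := hsmall j
      linarith
    have hkey : ∀ p < N, ∀ h ∈ F, ∀ p' < N, ∀ h' ∈ F, p < p' →
        κ (g j ^ p * h) ≠ κ (g j ^ p' * h') := by
      intro p hp h hh p' hp' h' hh' hlt heq
      rw [map_mul, map_mul, map_pow, map_pow] at heq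
      have e : κ (g j) ^ p' - κ (g j) ^ p
          = κ (g j) ^ p * (κ h - 1) - κ (g j) ^ p' * (κ h' - 1) := by
        rw [mul_sub, mul_sub, heq]; simp
      have e2 : κ (g j) ^ (p' - p) - 1 = (κ (g j)⁻¹) ^ p * (κ (g j) ^ p' - κ (g j) ^ p) := by
        have : (κ (g j)⁻¹) ^ p * κ (g j) ^ p = 1 := by
          rw [← map_pow, ← map_pow, ← map_mul]; simp
        have h3 : κ (g j) ^ p' = κ (g j) ^ p * κ (g j) ^ (p' - p) := by
          rw [← pow_add]; congr 1; omega
        rw [mul_sub, h3, ← mul_assoc, this, one_mul]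
      have h1 : ‖κ (g j) ^ p' - κ (g j) ^ p‖ ≤ 16 * N * r := by
        rw [e]
        refine (norm_sub_le _ _).trans ?_
        have i1 : ‖κ (g j) ^ p * (κ h - 1)‖ ≤ 2 * (4 * N * r) :=
          (norm_mul_le _ _).trans (mul_le_mul (hup2 p hp) (hnorm h hh) (norm_nonneg _) (by simp))
        have i2 : ‖κ (g j) ^ p' * (κ h' - 1)‖ ≤ 2 * (4 * N * r) :=
          (norm_mul_le _ _).trans (mul_le_mul (hup2 p' hp') (hnorm h' hh')
            (norm_nonneg _) (by simp))
        linarith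
      have hinv : ‖(κ (g j)⁻¹) ^ p‖ ≤ 2 := by
        refine norm_le_two_of_mul_eq_one (P := κ (g j) ^ p) ?_ ?_
        · rw [← map_pow, ← map_pow, ← map_mul]; simp
        · have := hup p hp
          have := hsmall j
          linarith
      have h2 : ‖κ (g j) ^ (p' - p) - 1‖ ≤ 2 * (16 * N * r) := by
        rw [e2]
        exact (norm_mul_le _ _).trans (mul_le_mul hinv h1 (norm_nonneg _) (by simp))
      have h3 : ‖x‖ / 2 ≤ ‖κ (g j) ^ (p' - p) - 1‖ := by
        rw [hκ]
        exact norm_one_add_pow_sub_one_ge x N (hsmall j) (by omega) (by omega)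
      linarith
    have hinj2 : ∀ q ∈ (Finset.range N ×ˢ F), ∀ q' ∈ (Finset.range N ×ˢ F),
        κ (g j ^ q.1 * q.2) = κ (g j ^ q'.1 * q'.2) → q = q' := by
      rintro ⟨p, h⟩ hq ⟨p', h'⟩ hq' heq
      simp only [Finset.mem_product, Finset.mem_range] at hq hq' heq
      rcases lt_trichotomy p p' with hlt | rfl | hlt
      · exact absurd heq (hkey p hq.1 h hq.2 p' hq'.1 h' hq'.2 hlt)
      · have : κ h = κ h' := by
          have h3 := congrArg (fun z => (κ (g j ^ p)⁻¹) * z) heq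
          simp only [← map_mul] at h3
          simpa using h3
        rw [hinj hq.2 hq'.2 this]
      · exact absurd heq.symm (hkey p' hq'.1 h' hq'.2 p hq.1 h hq.2 hlt)
    refine ⟨(Finset.range N ×ˢ F).image (fun q => g j ^ q.1 * q.2), ?_, ?_, ?_, ?_⟩
    · rw [Finset.card_image_of_injOn, Finset.card_product, hcard, Finset.card_range, pow_succ,
        mul_comm]
      intro q hq q' hq' heq
      exact hinj2 q hq q' hq' (congrArg κ heq)
    · intro y hy y' hy' heq
      simp only [Finset.coe_image, Set.mem_image] at hy hy'
      obtain ⟨q, hq, rfl⟩ := hy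
      obtain ⟨q', hq', rfl⟩ := hy'
      rw [hinj2 q hq q' hq' heq]
    · intro y hy
      simp only [Finset.mem_image, Finset.mem_product, Finset.mem_range] at hy
      obtain ⟨⟨p, h⟩, ⟨hp, hh⟩, rfl⟩ := hy
      simp only at hp hh ⊢
      have e : κ (g j ^ p * h) - 1 = κ (g j) ^ p * (κ h - 1) + (κ (g j) ^ p - 1) := by
        rw [map_mul, map_pow]; noncomm_ring
      rw [e]
      refine (norm_add_le _ _).trans ?_
      have i1 : ‖κ (g j) ^ p * (κ h - 1)‖ ≤ 2 * (4 * N * r) :=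
        (norm_mul_le _ _).trans (mul_le_mul (hup2 p hp) (hnorm h hh) (norm_nonneg _) (by simp))
      have := hup p hp
      nlinarith
    · intro y hy
      simp only [Finset.mem_image, Finset.mem_product, Finset.mem_range] at hy
      obtain ⟨⟨p, h⟩, ⟨hp, hh⟩, rfl⟩ := hy
      simp only at hp hh ⊢
      have h1 := len_mul (g j ^ p) h
      have h2 := len_pow (g j) p
      have h3 := hlenF h hh
      have h4 : p * len (g j) ≤ N * (ℓ * 2 ^ j) := Nat.mul_le_mul hp.le (hlen j)
      have h5 : N * ℓ * 2 ^ (j + 1) = 2 * (N * (ℓ * 2 ^ j)) := by ring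
      have h6 : N * ℓ * 2 ^ j = N * (ℓ * 2 ^ j) := by ring
      have h7 : j + 1 + m = j + (m + 1) := by ring
      rw [h7] at h3
      omega

end NormedRingEstimates

section Contraction

open scoped commutatorElement

variable {A : Type*} [NormedRing A] [NormOneClass A] {G : Type*} [Group G]

lemma false_of_shrinking [NormedAlgebra ℝ A] (κ : G →* A) (len : G → ℕ)
    (len_one : len 1 = 0) (len_mul : ∀ g h, len (g * h) ≤ len g + len h) (d : ℕ) (C : ℝ)
    (growth : ∀ (n : ℕ) (F : Finset G), (∀ g ∈ F, len g ≤ n) → (F.card : ℝ) ≤ C * (n + 1) ^ d)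
    (ℓ : ℕ) (g : ℕ → G)
    (hlen : ∀ k, len (g k) ≤ ℓ * 2 ^ k)
    (hsmall : ∀ k, 2 ^ (d + 1) * ‖κ (g k) - 1‖ ≤ 1 / 8)
    (hshrink : ∀ k, 1000 * 2 ^ (d + 1) * ‖κ (g (k + 1)) - 1‖ ≤ ‖κ (g k) - 1‖)
    (hne : ∀ k, κ (g k) ≠ 1) : False := by
  set N : ℕ := 2 ^ (d + 1) with hN
  have hNr : (N : ℝ) = 2 ^ (d + 1) := by rw [hN]; push_cast; rfl
  have hC : 0 ≤ C := by
    have := growth 0 ∅ (by simp)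
    simpa using this
  have key : ∀ m : ℕ, (2 : ℝ) ^ m ≤ C * (N * ℓ + 1) ^ d := by
    intro m
    obtain ⟨F, hcard, -, -, hF⟩ := exists_finset_of_shrinking κ len len_one len_mul N ℓ g hlen
      (by rw [hNr]; exact hsmall) Nat.one_le_two_pow (by rw [hNr]; exact hshrink) hne m 0
    have h1 := growth (N * ℓ * 2 ^ m) F (fun h hh => by
      have := hF h hh
      rw [zero_add] at this
      omega)
    rw [hcard] at h1
    push_cast at h1
    rw [hNr] at h1
    have h2 : ((2 : ℝ) ^ (d + 1) * ℓ * 2 ^ m + 1) ^ d ≤ ((N * ℓ + 1) * 2 ^ m) ^ d := by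
      rw [hNr]
      have : (1 : ℝ) ≤ 2 ^ m := one_le_pow₀ (by norm_num)
      gcongr
      nlinarith
    have h3 : ((2 : ℝ) ^ (d + 1)) ^ m = 2 ^ m * (2 ^ m) ^ d := by ring
    rw [h3] at h1
    have h4 : (2 : ℝ) ^ m * (2 ^ m) ^ d ≤ C * (N * ℓ + 1) ^ d * (2 ^ m) ^ d := by
      calc _ ≤ C * (2 ^ (d + 1) * ℓ * 2 ^ m + 1) ^ d := h1
        _ ≤ C * ((N * ℓ + 1) * 2 ^ m) ^ d := by gcongr
        _ = _ := by rw [mul_pow]; ring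
    exact le_of_mul_le_mul_right h4 (by positivity)
  obtain ⟨m, hm⟩ := pow_unbounded_of_one_lt (C * (N * ℓ + 1) ^ d) (one_lt_two (α := ℝ))
  exact absurd (key m) (not_le.2 hm)

lemma commute_of_near_one [NormedAlgebra ℝ A] (κ : G →* A) (len : G → ℕ)
    (len_one : len 1 = 0) (len_mul : ∀ g h, len (g * h) ≤ len g + len h)
    (len_inv : ∀ g, len g⁻¹ = len g) (d : ℕ) (C : ℝ)
    (growth : ∀ (n : ℕ) (F : Finset G), (∀ g ∈ F, len g ≤ n) → (F.card : ℝ) ≤ C * (n + 1) ^ d)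
    (S' : Set G) (ℓ : ℕ) (hℓ : ∀ s ∈ S', len s ≤ ℓ)
    (hS' : ∀ s ∈ S', 8000 * 2 ^ (d + 1) * ‖κ s - 1‖ ≤ 1)
    (hfrob : ∀ g, ∀ s ∈ S', Commute (κ ⁅g, s⁆) (κ g) → Commute (κ ⁅g, s⁆) (κ s) → κ ⁅g, s⁆ = 1) :
    ∀ g ∈ Subgroup.closure S', ∀ h ∈ Subgroup.closure S', Commute (κ g) (κ h) := by
  have comm_iff : ∀ g h : G, κ ⁅g, h⁆ = 1 ↔ Commute (κ g) (κ h) := by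
    intro g h
    constructor
    · intro h1
      have : g * h = ⁅g, h⁆ * (h * g) := by rw [commutatorElement_def]; group
      show κ g * κ h = κ h * κ g
      rw [← map_mul, this, map_mul, h1, one_mul, map_mul]
    · intro h1
      have h2 : κ g * κ h = κ h * κ g := h1
      rw [commutatorElement_def, map_mul, map_mul, map_mul, h2, mul_assoc (κ h),
        ← map_mul κ g, mul_inv_cancel, map_one, mul_one, ← map_mul, mul_inv_cancel, map_one]
  have comm_closure : ∀ a : G, (∀ s ∈ S', Commute (κ a) (κ s)) →
      ∀ h ∈ Subgroup.closure S', Commute (κ a) (κ h) := by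
    intro a ha h hh
    induction hh using Subgroup.closure_induction with
    | mem x hx => exact ha x hx
    | one => rw [map_one]; exact Commute.one_right _
    | mul x y _ _ hx hy => rw [map_mul]; exact hx.mul_right hy
    | inv x _ hx =>
      have h1 : κ x * κ x⁻¹ = 1 := by rw [← map_mul]; simp
      have h2 : κ x⁻¹ * κ x = 1 := by rw [← map_mul]; simp
      show κ a * κ x⁻¹ = κ x⁻¹ * κ a
      have h3 : κ a * κ x = κ x * κ a := hx
      calc κ a * κ x⁻¹ = κ x⁻¹ * (κ x * κ a) * κ x⁻¹ := by rw [← mul_assoc, h2, one_mul]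
        _ = κ x⁻¹ * κ a := by rw [← h3, mul_assoc, mul_assoc, h1, mul_one]
  by_contra hcon
  push Not at hcon
  have hstart : ∃ g ∈ S', ∃ s ∈ S', κ ⁅g, s⁆ ≠ 1 := by
    by_contra h
    push Not at h
    obtain ⟨g, hg, h', hh', hne⟩ := hcon
    refine hne (comm_closure g (fun s hs => ?_) h' hh')
    exact (comm_closure s (fun t ht => (comm_iff s t).1 (h s hs t ht)) g hg).symm
  obtain ⟨g0, hg0, hg0'⟩ := hstart
  let P := {g : G // g ∈ Subgroup.closure S' ∧ ∃ s ∈ S', κ ⁅g, s⁆ ≠ 1}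
  have hstep : ∀ g : P, ∃ g' : P, ∃ s ∈ S', (g' : G) = ⁅(g : G), s⁆ := by
    rintro ⟨g, hg, s, hs, hne⟩
    have hs' := Subgroup.subset_closure hs
    have hmem : ⁅g, s⁆ ∈ Subgroup.closure S' := by
      rw [commutatorElement_def]
      exact mul_mem (mul_mem (mul_mem hg hs') (inv_mem hg)) (inv_mem hs')
    refine ⟨⟨⁅g, s⁆, hmem, ?_⟩, s, hs, rfl⟩
    by_contra h
    push Not at h
    have h1 := comm_closure ⁅g, s⁆ (fun t ht => (comm_iff _ _).1 (h t ht))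
    exact hne (hfrob g s hs (h1 g hg) (h1 s hs'))
  choose nxt hnxt using hstep
  choose t ht htn using hnxt
  let seq : ℕ → P := fun n => Nat.rec ⟨g0, Subgroup.subset_closure hg0, hg0'⟩ (fun _ x => nxt x) n
  have hseq : ∀ n, (seq (n + 1)).1 = ⁅(seq n).1, t (seq n)⁆ := fun n => htn (seq n)
  have hpow : (1 : ℝ) ≤ 2 ^ (d + 1) := one_le_pow₀ (by norm_num)
  have hsm : ∀ k, 8000 * 2 ^ (d + 1) * ‖κ (seq k).1 - 1‖ ≤ 1 ∧
      1000 * 2 ^ (d + 1) * ‖κ (seq (k + 1)).1 - 1‖ ≤ ‖κ (seq k).1 - 1‖ := by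
    have haux : ∀ x : A, 8000 * 2 ^ (d + 1) * ‖x‖ ≤ 1 → ‖x‖ ≤ 1 / 2 := fun x hx => by
      nlinarith [norm_nonneg x]
    have hb : ∀ k, 8000 * 2 ^ (d + 1) * ‖κ (seq k).1 - 1‖ ≤ 1 →
      1000 * 2 ^ (d + 1) * ‖κ (seq (k + 1)).1 - 1‖ ≤ ‖κ (seq k).1 - 1‖ := by
      intro k hk
      have h1 := hS' _ (ht (seq k))
      have h2 := norm_map_commutator_sub_one_le κ (seq k).1 (t (seq k)) (haux _ hk) (haux _ h1)
      rw [hseq]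
      calc _ ≤ 1000 * 2 ^ (d + 1) * (8 * ‖κ (t (seq k)) - 1‖ * ‖κ (seq k).1 - 1‖) := by gcongr
        _ = (8000 * 2 ^ (d + 1) * ‖κ (t (seq k)) - 1‖) * ‖κ (seq k).1 - 1‖ := by ring
        _ ≤ 1 * ‖κ (seq k).1 - 1‖ := by gcongr
        _ = _ := one_mul _
    intro k
    induction k with
    | zero => exact ⟨hS' g0 hg0, hb 0 (hS' g0 hg0)⟩
    | succ k ih =>
      have h1 : 8000 * 2 ^ (d + 1) * ‖κ (seq (k + 1)).1 - 1‖ ≤ 1 := by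
        have : ‖κ (seq k).1 - 1‖ ≤ 1 / 8 := by
          nlinarith [ih.1, norm_nonneg (κ (seq k).1 - 1)]
        linarith [ih.2]
      exact ⟨h1, hb (k + 1) h1⟩
  have hl : ∀ k, len (seq k).1 + 2 * ℓ ≤ 3 * ℓ * 2 ^ k := by
    intro k
    induction k with
    | zero =>
      have := hℓ g0 hg0
      simp only [pow_zero, mul_one]
      show len g0 + 2 * ℓ ≤ 3 * ℓ
      omega
    | succ k ih =>
      rw [hseq, commutatorElement_def]
      have h1 := len_mul ((seq k).1 * t (seq k) * (seq k).1⁻¹) (t (seq k))⁻¹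
      have h2 := len_mul ((seq k).1 * t (seq k)) (seq k).1⁻¹
      have h3 := len_mul (seq k).1 (t (seq k))
      have h4 := hℓ _ (ht (seq k))
      rw [len_inv] at h1 h2
      rw [pow_succ, ← mul_assoc]
      omega
  refine false_of_shrinking κ len len_one len_mul d C growth (3 * ℓ) (fun k => (seq k).1)
    (fun k => by have := hl k; omega) (fun k => ?_) (fun k => (hsm k).2) (fun k hk => ?_)
  · have := (hsm k).1
    nlinarith [norm_nonneg (κ (seq k).1 - 1)]
  · obtain ⟨s, hs, hne⟩ := (seq k).2.2
    refine hne ((comm_iff _ _).2 ?_)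
    rw [hk]
    exact Commute.one_left _

end Contraction

section NoSmallSubgroups

lemma eq_one_of_norm_pow_sub_one_le {A : Type*} [NormedRing A] [NormedAlgebra ℝ A]
    (z : A) (h : ∀ n : ℕ, ‖z ^ n - 1‖ ≤ 1 / 2) : z = 1 := by
  have key : ∀ k : ℕ, (3 / 2 : ℝ) ^ k * ‖z - 1‖ ≤ ‖z ^ (2 ^ k) - 1‖ := by
    intro k
    induction k with
    | zero => simp
    | succ k ih =>
      set y := z ^ (2 ^ k) - 1 with hy
      have e : z ^ (2 ^ (k + 1)) - 1 = (2 : ℝ) • y + y * y := by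
        rw [hy, pow_succ, pow_mul, pow_two, two_smul]; noncomm_ring
      have h1 : ‖y * y‖ ≤ ‖y‖ * (1 / 2) := (norm_mul_le _ _).trans (by gcongr; exact h _)
      have h2 := norm_sub_norm_le ((2 : ℝ) • y) (-(y * y))
      rw [sub_neg_eq_add, norm_neg, norm_smul, ← e] at h2
      norm_num at h2
      rw [pow_succ]
      linarith
  by_contra hne
  have hpos : 0 < ‖z - 1‖ := norm_pos_iff.2 (sub_ne_zero.2 hne)
  obtain ⟨k, hk⟩ := pow_unbounded_of_one_lt (1 / ‖z - 1‖) (show (1 : ℝ) < 3 / 2 by norm_num)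
  rw [div_lt_iff₀ hpos] at hk
  have := (key k).trans (h _)
  linarith

end NoSmallSubgroups

section Affine

open scoped commutatorElement

variable {G : Type*} [Group G] {V : Type*} [NormedAddCommGroup V] [NormedSpace ℝ V]

/-- The linear representation on `V × ℝ` of the affine action with linear part `ρ` and
translation part `δ • c`. -/
noncomputable def affineRep (ρ : G →* (V →L[ℝ] V)) (c : G → V)
    (hc : ∀ g h, c (g * h) = c g + ρ g (c h)) (δ : ℝ) : G →* ((V × ℝ) →L[ℝ] (V × ℝ)) where
  toFun g := ((ρ g).comp (ContinuousLinearMap.fst ℝ V ℝ) +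
    (ContinuousLinearMap.snd ℝ V ℝ).smulRight (δ • c g)).prod (ContinuousLinearMap.snd ℝ V ℝ)
  map_one' := by
    have h : c 1 = 0 := by simpa using hc 1 1
    ext x <;> simp [h]
  map_mul' g h := by
    ext x <;> simp [hc, add_comm]

lemma affineRep_apply (ρ : G →* (V →L[ℝ] V)) (c : G → V)
    (hc : ∀ g h, c (g * h) = c g + ρ g (c h)) (δ : ℝ) (g : G) (x : V × ℝ) :
    affineRep ρ c hc δ g x = (ρ g x.1 + x.2 • δ • c g, x.2) := rfl

lemma affineRep_eq_iff (ρ : G →* (V →L[ℝ] V)) (c : G → V)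
    (hc : ∀ g h, c (g * h) = c g + ρ g (c h)) {δ : ℝ} (hδ : δ ≠ 0) (g h : G) :
    affineRep ρ c hc δ g = affineRep ρ c hc δ h ↔ ρ g = ρ h ∧ c g = c h := by
  constructor
  · intro e
    refine ⟨?_, ?_⟩
    · ext v
      simpa [affineRep_apply] using congrArg (fun f => (f (v, 0)).1) e
    · have := congrArg (fun f => (f (0, 1)).1) e
      simpa [affineRep_apply, hδ] using this
  · rintro ⟨h1, h2⟩
    ext x <;> simp [affineRep_apply, h1, h2]

lemma norm_affineRep_sub_one_le (ρ : G →* (V →L[ℝ] V)) (c : G → V)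
    (hc : ∀ g h, c (g * h) = c g + ρ g (c h)) {δ : ℝ} (hδ : 0 ≤ δ) (g : G) :
    ‖affineRep ρ c hc δ g - 1‖ ≤ ‖ρ g - 1‖ + δ * ‖c g‖ := by
  refine ContinuousLinearMap.opNorm_le_bound _ (by positivity) (fun x => ?_)
  have e : (affineRep ρ c hc δ g - 1) x = ((ρ g - 1) x.1 + x.2 • δ • c g, 0) := by
    rw [sub_apply, affineRep_apply]
    ext <;> simp
    abel
  rw [e, Prod.norm_def]
  simp only [norm_zero]
  rw [max_eq_left (norm_nonneg _)]
  refine (norm_add_le _ _).trans ?_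
  have h1 : ‖(ρ g - 1) x.1‖ ≤ ‖ρ g - 1‖ * ‖x‖ :=
    ((ρ g - 1).le_opNorm _).trans (by gcongr; exact norm_fst_le x)
  have h2 : ‖x.2 • δ • c g‖ ≤ δ * ‖c g‖ * ‖x‖ := by
    rw [norm_smul, norm_smul, Real.norm_of_nonneg hδ, mul_comm]
    gcongr
    exact norm_snd_le x
  linarith

lemma pow_mul_eq_of_mul_eq {M : Type*} [Monoid M] {P Q Z : M} (h : P * Q = Z * (Q * P))
    (hP : Commute Z P) (n : ℕ) : P ^ n * Q = Z ^ n * (Q * P ^ n) := by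
  induction n with
  | zero => simp
  | succ n ih =>
    calc P ^ (n + 1) * Q = P ^ n * (P * Q) := by rw [pow_succ, mul_assoc]
      _ = P ^ n * Z * Q * P := by rw [h]; simp only [mul_assoc]
      _ = Z * (P ^ n * Q) * P := by rw [← (hP.pow_right n).eq]; simp only [mul_assoc]
      _ = Z ^ (n + 1) * (Q * P ^ (n + 1)) := by
        rw [ih, pow_succ' Z, pow_succ P]; simp only [mul_assoc]

lemma mul_pow_eq_of_mul_eq {M : Type*} [Monoid M] {P Q Z : M} (h : P * Q = Z * (Q * P))
    (hQ : Commute Z Q) (n : ℕ) : P * Q ^ n = Z ^ n * (Q ^ n * P) := by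
  induction n with
  | zero => simp
  | succ n ih =>
    calc P * Q ^ (n + 1) = P * Q ^ n * Q := by rw [pow_succ, mul_assoc]
      _ = Z ^ n * (Q ^ n * (P * Q)) := by rw [ih]; simp only [mul_assoc]
      _ = Z ^ n * (Q ^ n * Z) * (Q * P) := by rw [h]; simp only [mul_assoc]
      _ = Z ^ (n + 1) * (Q ^ (n + 1) * P) := by
        rw [← (hQ.pow_right n).eq, pow_succ Z, pow_succ Q]; simp only [mul_assoc]

lemma affineRep_commutator_eq_one (ρ : G →* (V →L[ℝ] V)) (c : G → V)
    (hc : ∀ g h, c (g * h) = c g + ρ g (c h)) {δ : ℝ} (hδ : δ ≠ 0) (R : ℝ) (hR : ∀ g, ‖ρ g‖ ≤ R)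
    (g s : G) (hs : (R * R + 1) * R * ‖ρ s - 1‖ ≤ 1 / 2)
    (h1 : Commute (affineRep ρ c hc δ ⁅g, s⁆) (affineRep ρ c hc δ g))
    (h2 : Commute (affineRep ρ c hc δ ⁅g, s⁆) (affineRep ρ c hc δ s)) :
    affineRep ρ c hc δ ⁅g, s⁆ = 1 := by
  have hR0 : 0 ≤ R := (norm_nonneg _).trans (hR 1)
  have hc1 : c 1 = 0 := by simpa using hc 1 1
  have hinv : ∀ x : G, ρ x * ρ x⁻¹ = 1 := fun x => by rw [← map_mul]; simp
  set κ := affineRep ρ c hc δ with hκ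
  have e0 : κ g * κ s = κ ⁅g, s⁆ * (κ s * κ g) := by
    rw [← map_mul, ← map_mul, ← map_mul, commutatorElement_def]; congr 1; group
  have e1 : ∀ n : ℕ, κ (g ^ n * s) = κ (⁅g, s⁆ ^ n * (s * g ^ n)) := fun n => by
    simpa using pow_mul_eq_of_mul_eq e0 h1 n
  have e2 : ∀ n : ℕ, κ (g ^ n * s ^ n) = κ ((⁅g, s⁆ ^ n) ^ n * (s ^ n * g ^ n)) := fun n => by
    have := mul_pow_eq_of_mul_eq (pow_mul_eq_of_mul_eq e0 h1 n) (h2.pow_left n) n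
    simpa using this
  have hρ : ρ ⁅g, s⁆ = 1 := by
    refine eq_one_of_norm_pow_sub_one_le _ (fun n => ?_)
    have h3 := ((affineRep_eq_iff ρ c hc hδ _ _).1 (e1 n)).1
    have e : ρ ⁅g, s⁆ ^ n - 1
        = (ρ (g ^ n) * (ρ s - 1) * ρ (g ^ n)⁻¹ - (ρ s - 1)) * ρ s⁻¹ := by
      have i1 : ρ (g ^ n) * ρ s * ρ (g ^ n)⁻¹ = ρ ⁅g, s⁆ ^ n * ρ s := by
        rw [← map_mul, h3, map_mul, map_mul, map_pow, ← mul_assoc, mul_assoc, hinv, mul_one]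
      have i2 : ρ (g ^ n) * (ρ s - 1) * ρ (g ^ n)⁻¹ = ρ ⁅g, s⁆ ^ n * ρ s - 1 := by
        rw [mul_sub, sub_mul, i1, mul_one, hinv]
      rw [i2, sub_sub_sub_cancel_right, sub_mul, mul_assoc, hinv, mul_one]
    rw [e]
    calc _ ≤ ‖ρ (g ^ n) * (ρ s - 1) * ρ (g ^ n)⁻¹ - (ρ s - 1)‖ * ‖ρ s⁻¹‖ := norm_mul_le _ _
      _ ≤ (R * ‖ρ s - 1‖ * R + ‖ρ s - 1‖) * R := by
        gcongr
        · refine (norm_sub_le _ _).trans ?_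
          gcongr
          refine (norm_mul_le _ _).trans ?_
          gcongr
          · refine (norm_mul_le _ _).trans ?_
            gcongr
            exact hR _
          · exact hR _
        · exact hR _
      _ = (R * R + 1) * R * ‖ρ s - 1‖ := by ring
      _ ≤ 1 / 2 := hs
  have hcpow : ∀ (x : G) (n : ℕ), ‖c (x ^ n)‖ ≤ n * (R * ‖c x‖) := by
    intro x n
    induction n with
    | zero => simp [hc1]
    | succ n ih =>
      rw [pow_succ, hc]
      refine (norm_add_le _ _).trans ?_
      have : ‖ρ (x ^ n) (c x)‖ ≤ R * ‖c x‖ := (ρ (x ^ n)).le_of_opNorm_le (hR _) _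
      push_cast
      linarith
  have hcC : ∀ n : ℕ, c (⁅g, s⁆ ^ n) = (n : ℝ) • c ⁅g, s⁆ := by
    intro n
    induction n with
    | zero => simp [hc1]
    | succ n ih =>
      rw [pow_succ, hc, ih, map_pow, hρ]
      simp [add_smul]
  have hu : c ⁅g, s⁆ = 0 := by
    have h3 : ∀ n : ℕ, 1 ≤ n → n * ‖c ⁅g, s⁆‖ ≤ (1 + R) * (R * ‖c g‖ + R * ‖c s‖) := by
      intro n hn
      have h4 := ((affineRep_eq_iff ρ c hc hδ _ _).1 (e2 n)).2
      have hρn : ρ (⁅g, s⁆ ^ (n * n)) = 1 := by rw [map_pow, hρ, one_pow]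
      rw [← pow_mul, hc, hc, hcC, hρn, one_apply_eq_self, hc] at h4
      have h5 : ((n * n : ℕ) : ℝ) • c ⁅g, s⁆ = c (g ^ n) + ρ (g ^ n) (c (s ^ n))
          - (c (s ^ n) + ρ (s ^ n) (c (g ^ n))) := by rw [h4]; abel
      have h6 : ‖((n * n : ℕ) : ℝ) • c ⁅g, s⁆‖ ≤
          n * ((1 + R) * (R * ‖c g‖ + R * ‖c s‖)) := by
        rw [h5]
        have j1 := hcpow g n
        have j2 := hcpow s n
        have j3 : ‖ρ (g ^ n) (c (s ^ n))‖ ≤ R * ‖c (s ^ n)‖ := (ρ _).le_of_opNorm_le (hR _) _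
        have j4 : ‖ρ (s ^ n) (c (g ^ n))‖ ≤ R * ‖c (g ^ n)‖ := (ρ _).le_of_opNorm_le (hR _) _
        refine (norm_sub_le _ _).trans ?_
        have j5 := norm_add_le (c (g ^ n)) (ρ (g ^ n) (c (s ^ n)))
        have j6 := norm_add_le (c (s ^ n)) (ρ (s ^ n) (c (g ^ n)))
        have j7 := mul_le_mul_of_nonneg_left j1 hR0
        have j8 := mul_le_mul_of_nonneg_left j2 hR0
        nlinarith
      rw [norm_smul, Real.norm_of_nonneg (by positivity)] at h6
      push_cast at h6
      rw [mul_assoc] at h6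
      exact le_of_mul_le_mul_left h6 (by exact_mod_cast hn)
    by_contra hne
    have hpos := norm_pos_iff.2 hne
    obtain ⟨n, hn⟩ := exists_nat_gt ((1 + R) * (R * ‖c g‖ + R * ‖c s‖) / ‖c ⁅g, s⁆‖)
    rw [div_lt_iff₀ hpos] at hn
    have h4 := h3 (n + 1) (by omega)
    push_cast at h4
    linarith
  have h3 : κ ⁅g, s⁆ = κ 1 :=
    (affineRep_eq_iff ρ c hc hδ _ _).2 ⟨by rw [hρ, map_one], by rw [hu, hc1]⟩
  rw [h3, map_one]

end Affine

section VirtuallyAbelian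

open Filter Topology
open scoped commutatorElement

variable {G : Type*} [Group G] {V : Type*} [NormedAddCommGroup V] [NormedSpace ℝ V]

lemma exists_finset_norm_inv_mul_sub_one_le [FiniteDimensional ℝ V] (ρ : G →* (V →L[ℝ] V))
    (R : ℝ) (hR : ∀ g, ‖ρ g‖ ≤ R) {ε : ℝ} (hε : 0 < ε) :
    ∃ I : Finset G, ∀ g, ∃ i ∈ I, ‖ρ (i⁻¹ * g) - 1‖ ≤ ε := by
  classical
  have hR0 : 0 ≤ R := (norm_nonneg _).trans (hR 1)
  have htb : TotallyBounded (Set.range ρ) := by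
    refine TotallyBounded.subset ?_ (isCompact_closedBall (0 : V →L[ℝ] V) R).totallyBounded
    rintro _ ⟨g, rfl⟩
    simpa using hR g
  obtain ⟨t, ht, htfin, hcov⟩ :=
    Metric.finite_approx_of_totallyBounded htb (ε / (R + 1)) (by positivity)
  have ht' : ∀ y, ∃ g, y ∈ t → ρ g = y := fun y => by
    by_cases hy : y ∈ t
    · obtain ⟨g, hg⟩ := ht hy
      exact ⟨g, fun _ => hg⟩
    · exact ⟨1, fun h => absurd h hy⟩
  choose lift hlift using ht'
  refine ⟨htfin.toFinset.image lift, fun g => ?_⟩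
  have h1 := hcov ⟨g, rfl⟩
  simp only [Set.mem_iUnion] at h1
  obtain ⟨y, hy, hgy⟩ := h1
  refine ⟨lift y, Finset.mem_image_of_mem _ (htfin.mem_toFinset.2 hy), ?_⟩
  have e : ρ ((lift y)⁻¹ * g) - 1 = ρ (lift y)⁻¹ * (ρ g - y) := by
    have h3 : ρ (lift y)⁻¹ * ρ (lift y) = 1 := by rw [← map_mul]; simp
    rw [hlift y hy] at h3
    rw [mul_sub, h3, map_mul]
  rw [e]
  have h2 : ‖ρ g - y‖ ≤ ε / (R + 1) := by
    rw [← dist_eq_norm]; exact (Metric.mem_ball.1 hgy).le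
  calc _ ≤ ‖ρ (lift y)⁻¹‖ * ‖ρ g - y‖ := norm_mul_le _ _
    _ ≤ (R + 1) * (ε / (R + 1)) := by
      gcongr
      exact (hR _).trans (by linarith)
    _ = ε := by field_simp

/-- A Schreier-type argument: elements `j⁻¹ * t * i` close to the identity generate a subgroup
whose translates by the finite set `I` cover the group. -/
lemma exists_mul_mem_closure {S : Set G} (hSsymm : ∀ s ∈ S, s⁻¹ ∈ S)
    (hSgen : Subgroup.closure S = ⊤) (I : Finset G) (near : G → Prop)
    (hI : ∀ g, ∃ i ∈ I, near (i⁻¹ * g)) (T : Set G)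
    (hT : ∀ g, near g → ((∃ i ∈ I, g = i⁻¹) ∨ ∃ t ∈ S, ∃ i ∈ I, ∃ j ∈ I, g = j⁻¹ * t * i) →
      g ∈ T) (g : G) :
    ∃ i ∈ I, i⁻¹ * g ∈ Subgroup.closure T := by
  have hg : g ∈ Subgroup.closure S := by rw [hSgen]; trivial
  have step : ∀ t ∈ S, ∀ g, (∃ i ∈ I, i⁻¹ * g ∈ Subgroup.closure T) →
      ∃ i ∈ I, i⁻¹ * (t * g) ∈ Subgroup.closure T := by
    rintro t ht g ⟨i, hi, hig⟩
    obtain ⟨j, hj, hnear⟩ := hI (t * i)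
    refine ⟨j, hj, ?_⟩
    have : j⁻¹ * (t * g) = (j⁻¹ * (t * i)) * (i⁻¹ * g) := by group
    rw [this]
    refine mul_mem (Subgroup.subset_closure (hT _ hnear (Or.inr ⟨t, ht, i, hi, j, hj, ?_⟩))) hig
    group
  induction hg using Subgroup.closure_induction_left with
  | one =>
    obtain ⟨i, hi, hnear⟩ := hI 1
    refine ⟨i, hi, Subgroup.subset_closure (hT _ hnear (Or.inl ?_))⟩
    exact ⟨i, hi, mul_one _⟩
  | mul_left t ht g _ ih => exact step t ht g ih
  | inv_mul_cancel t ht g _ ih => exact step t⁻¹ (hSsymm t ht) g ih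

lemma card_le_of_injective_mul (len : G → ℕ) (len_mul : ∀ g h, len (g * h) ≤ len g + len h)
    (d : ℕ) (C : ℝ)
    (growth : ∀ (n : ℕ) (F : Finset G), (∀ g ∈ F, len g ≤ n) → (F.card : ℝ) ≤ C * (n + 1) ^ d)
    (P : (Fin d → ℕ) → G) (L : ℕ) (hP : ∀ e n, (∀ i, e i ≤ n) → len (P e) ≤ L * n) (F : Finset G)
    (hF : ∀ e e', ∀ f ∈ F, ∀ f' ∈ F, P e * f = P e' * f' → e = e' ∧ f = f') :
    (F.card : ℝ) ≤ C * (L + 1) ^ d := by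
  classical
  set n := F.sup len + 1 with hn
  let Q := (Fintype.piFinset fun _ : Fin d => Finset.range n) ×ˢ F
  have h1 := growth (L * n + F.sup len) (Q.image fun q => P q.1 * q.2) (by
    intro g hg
    simp only [Q, Finset.mem_image, Finset.mem_product, Fintype.mem_piFinset,
      Finset.mem_range] at hg
    obtain ⟨q, ⟨hq1, hq2⟩, rfl⟩ := hg
    exact (len_mul _ _).trans (add_le_add (hP _ _ fun i => (hq1 i).le) (Finset.le_sup hq2)))
  rw [Finset.card_image_of_injOn] at h1
  · simp only [Q, Finset.card_product, Fintype.card_piFinset_const, Finset.card_range] at h1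
    have e : ((L * n + F.sup len : ℕ) : ℝ) + 1 = (L + 1) * n := by
      rw [hn]; push_cast; ring
    rw [e, mul_pow] at h1
    push_cast at h1
    have hpos : (0 : ℝ) < (n : ℝ) ^ d := by positivity
    refine le_of_mul_le_mul_left ?_ hpos
    linarith
  · rintro ⟨e, f⟩ hq ⟨e', f'⟩ hq' heq
    simp only [Q, Finset.coe_product, Set.mem_prod, Finset.mem_coe] at hq hq'
    obtain ⟨h1, h2⟩ := hF e e' f hq.2 f' hq'.2 heq
    rw [h1, h2]

lemma len_list_prod_le (len : G → ℕ) (len_one : len 1 = 0)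
    (len_mul : ∀ g h, len (g * h) ≤ len g + len h) (l : List G) :
    len l.prod ≤ (l.map len).sum := by
  induction l with
  | nil => simp [len_one]
  | cons a l ih =>
    simp only [List.prod_cons, List.map_cons, List.sum_cons]
    exact (len_mul _ _).trans (by omega)

lemma len_pow_le (len : G → ℕ) (len_one : len 1 = 0)
    (len_mul : ∀ g h, len (g * h) ≤ len g + len h) (g : G) (n : ℕ) : len (g ^ n) ≤ n * len g := by
  have := len_list_prod_le len len_one len_mul (List.replicate n g)
  simpa using this

lemma map_noncommPiCoprod {ι M P : Type*} [Fintype ι] [Monoid M] [CommMonoid P] {N : ι → Type*}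
    [∀ i, Monoid (N i)] (ϕ : ∀ i, N i →* M)
    (hcomm : Pairwise fun i j => ∀ x y, Commute (ϕ i x) (ϕ j y)) (f : M →* P) (x : ∀ i, N i) :
    f (MonoidHom.noncommPiCoprod ϕ hcomm x) = ∏ i, f (ϕ i (x i)) := by
  rw [MonoidHom.noncommPiCoprod_apply, Finset.map_noncommProd, Finset.noncommProd_eq_prod]

/-- A group of growth at most `n ^ d` carrying, on a finite-index subgroup `Γ`, a homomorphism
to `V` whose image contains a basis of the `d`-dimensional space `V` is virtually `ℤ^d`. -/
theorem exists_finiteIndex_of_hom (len : G → ℕ) (len_one : len 1 = 0)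
    (len_mul : ∀ g h, len (g * h) ≤ len g + len h)
    (d : ℕ) (C : ℝ)
    (growth : ∀ (n : ℕ) (F : Finset G), (∀ g ∈ F, len g ≤ n) → (F.card : ℝ) ≤ C * (n + 1) ^ d)
    (Γ : Subgroup G) (c : Γ →* Multiplicative V) (h : Fin d → Γ)
    (hli : LinearIndependent ℝ fun i => (c (h i)).toAdd) :
    ∃ K : Subgroup G, K.FiniteIndex ∧ Nonempty (K ≃* Multiplicative (Fin d → ℤ)) := by
  classical
  have hliN : ∀ e e' : Fin d → ℤ,
      ∑ i, (e i : ℝ) • (c (h i)).toAdd = ∑ i, (e' i : ℝ) • (c (h i)).toAdd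
      → e = e' := by
    intro e e' he
    have h1 : ∑ i, ((e i : ℝ) - e' i) • (c (h i)).toAdd = 0 := by
      simp only [sub_smul, Finset.sum_sub_distrib, he, sub_self]
    funext i
    have := Fintype.linearIndependent_iff.1 hli _ h1 i
    exact_mod_cast sub_eq_zero.1 this
  have hker : Finite c.ker := by
    let P : (Fin d → ℕ) → Γ := fun e => (List.ofFn fun i => h i ^ e i).prod
    have hcP : ∀ e, (c (P e)).toAdd = ∑ i, ((e i : ℤ) : ℝ) • (c (h i)).toAdd := by
      intro e
      simp only [P, map_list_prod, List.map_ofFn, List.prod_ofFn, Function.comp_apply, map_pow,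
        toAdd_prod, toAdd_pow]
      simp [Nat.cast_smul_eq_nsmul]
    have hbound := fun F hF => card_le_of_injective_mul (G := Γ) (fun g => len g)
      (fun g g' => len_mul g g') d C (fun n F hF => by
        have := growth n (F.map (Function.Embedding.subtype _)) (by
          intro g hg
          simp only [Finset.mem_map] at hg
          obtain ⟨x, hx, rfl⟩ := hg
          exact hF x hx)
        simpa using this) P (∑ i, len (h i)) (by
        intro e n he
        refine (len_list_prod_le (fun g : Γ => len g) len_one (fun g g' => len_mul g g') _).trans ?_
        rw [List.map_ofFn, List.sum_ofFn, Finset.sum_mul]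
        refine Finset.sum_le_sum fun i _ => ?_
        refine (len_pow_le (fun g : Γ => len g) len_one (fun g g' => len_mul g g') _ _).trans ?_
        rw [mul_comm]
        exact Nat.mul_le_mul_left _ (he i)) F hF
    by_contra hinf
    have hinf : Infinite c.ker := not_finite_iff_infinite.1 hinf
    obtain ⟨N, hN⟩ := exists_nat_gt (C * (↑(∑ i, len (h i)) + 1) ^ d)
    obtain ⟨F, hF⟩ := Infinite.exists_subset_card_eq c.ker N
    have := hbound (F.map (Function.Embedding.subtype _)) (by
      intro e e' f hf f' hf' heq
      simp only [Finset.mem_map, Function.Embedding.subtype_apply] at hf hf'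
      obtain ⟨x, -, rfl⟩ := hf
      obtain ⟨x', -, rfl⟩ := hf'
      have h1 := congrArg c heq
      rw [map_mul, map_mul, x.2, x'.2, mul_one, mul_one] at h1
      have h2 := congrArg Multiplicative.toAdd h1
      rw [hcP, hcP] at h2
      have h3 := hliN _ _ h2
      have h4 : e = e' := by funext i; exact_mod_cast congrFun h3 i
      subst h4
      exact ⟨rfl, mul_left_cancel heq⟩)
    rw [Finset.card_map, hF] at this
    linarith
  have hcomm : ∀ x y : Γ, ∃ n : ℕ, 0 < n ∧ Commute (x ^ n) y := by
    intro x y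
    let f : ℕ → c.ker := fun a => ⟨x ^ a * y * (x ^ a)⁻¹ * y⁻¹, by
      rw [MonoidHom.mem_ker]
      simp only [map_mul, map_inv]
      rw [mul_comm (c (x ^ a)) (c y)]
      simp⟩
    obtain ⟨a, b, hab, heq⟩ := Finite.exists_ne_map_eq_of_infinite f
    have key : ∀ a b : ℕ, a < b → f a = f b → ∃ n : ℕ, 0 < n ∧ Commute (x ^ n) y := by
      intro a b hab heq
      refine ⟨b - a, by omega, ?_⟩
      have h1 : x ^ a * y * (x ^ a)⁻¹ = x ^ b * y * (x ^ b)⁻¹ :=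
        mul_right_cancel (congrArg Subtype.val heq)
      have h2 : x ^ b = x ^ a * x ^ (b - a) := by rw [← pow_add]; congr 1; omega
      have h3 : y = x ^ (b - a) * y * (x ^ (b - a))⁻¹ := by
        rw [h2] at h1
        have h4 := congrArg (fun z => (x ^ a)⁻¹ * z * x ^ a) h1
        simp only [mul_inv_rev] at h4
        group at h4 ⊢
        exact h4
      show x ^ (b - a) * y = y * x ^ (b - a)
      nth_rewrite 2 [h3]
      simp
    rcases lt_or_gt_of_ne hab with h | h
    · exact key a b h heq
    · exact key b a h heq.symm
  choose n hnpos hn using hcomm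
  let M : ℕ := ∏ i, ∏ j, n (h i) (h j)
  have hMpos : 0 < M := Finset.prod_pos fun i _ => Finset.prod_pos fun j _ => hnpos _ _
  have hMcomm : ∀ i j, Commute (h i ^ M) (h j) := by
    intro i j
    have hdvd : n (h i) (h j) ∣ M :=
      (Finset.dvd_prod_of_mem (fun j => n (h i) (h j)) (Finset.mem_univ j)).trans
        (Finset.dvd_prod_of_mem (fun i => ∏ j, n (h i) (h j)) (Finset.mem_univ i))
    obtain ⟨k, hk⟩ := hdvd
    rw [hk, pow_mul]
    exact (hn (h i) (h j)).pow_left k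
  have hMcomm' : Pairwise fun i j => ∀ x y : Multiplicative ℤ,
      Commute (zpowersHom Γ (h i ^ M) x) (zpowersHom Γ (h j ^ M) y) := by
    intro i j _ x y
    rw [zpowersHom_apply, zpowersHom_apply]
    exact ((hMcomm i j).pow_right M).zpow_zpow _ _
  let φ : Multiplicative (Fin d → ℤ) →* Γ :=
    (MonoidHom.noncommPiCoprod (fun i => zpowersHom Γ (h i ^ M)) hMcomm').comp
      (MulEquiv.piMultiplicative (fun _ : Fin d => ℤ)).toMonoidHom
  have hφ : ∀ e : Fin d → ℤ, (c (φ (Multiplicative.ofAdd e))).toAdd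
      = (M : ℝ) • ∑ i, (e i : ℝ) • (c (h i)).toAdd := by
    intro e
    have h1 := map_noncommPiCoprod (fun i => zpowersHom Γ (h i ^ M)) hMcomm' c
      (fun i => Multiplicative.ofAdd (e i))
    refine (congrArg Multiplicative.toAdd h1).trans ?_
    simp only [toAdd_prod, zpowersHom_apply, map_zpow, map_pow, toAdd_zpow, toAdd_pow]
    rw [Finset.smul_sum]
    refine Finset.sum_congr rfl fun i _ => ?_
    rw [smul_comm, Nat.cast_smul_eq_nsmul, ← Int.cast_smul_eq_zsmul ℝ]
    rfl
  have hφinj : Function.Injective φ := by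
    intro x y hxy
    have h1 := congrArg (fun z => (c z).toAdd) hxy
    have h2 := hφ x.toAdd
    have h3 := hφ y.toAdd
    simp only [ofAdd_toAdd] at h2 h3
    simp only [h2, h3] at h1
    have h4 : (M : ℝ) ≠ 0 := by exact_mod_cast hMpos.ne'
    exact hliN _ _ (smul_right_injective _ h4 h1)
  let ψ : Multiplicative (Fin d → ℤ) →* G := Γ.subtype.comp φ
  have hψinj : Function.Injective ψ := Subtype.val_injective.comp hφinj
  refine ⟨ψ.range, ?_, ⟨(MonoidHom.ofInjective hψinj).symm⟩⟩
  have len_zpow : ∀ (g : G) (k : ℕ), len (g ^ k) ≤ k * len g := len_pow_le len len_one len_mul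
  have hlenψ : ∀ (e : Fin d → ℕ) (N : ℕ), (∀ i, e i ≤ N) →
      len (ψ (Multiplicative.ofAdd fun i => (e i : ℤ))) ≤
        (∑ i, len (ψ (Multiplicative.ofAdd (Pi.single i 1)))) * N := by
    intro e N he
    have h1 : Multiplicative.ofAdd (fun i => (e i : ℤ))
        = (List.ofFn fun i => Multiplicative.ofAdd (Pi.single i (1 : ℤ)) ^ e i).prod := by
      rw [List.prod_ofFn]
      apply Multiplicative.toAdd.injective
      simp only [toAdd_ofAdd, toAdd_prod, toAdd_pow]
      funext j
      simp [Finset.sum_apply, Pi.single_apply]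
    rw [h1, map_list_prod]
    refine (len_list_prod_le len len_one len_mul _).trans ?_
    rw [List.map_ofFn, List.map_ofFn, List.sum_ofFn, Finset.sum_mul]
    refine Finset.sum_le_sum fun i _ => ?_
    simp only [Function.comp_apply, map_pow]
    refine (len_zpow _ _).trans ?_
    rw [mul_comm]
    exact Nat.mul_le_mul_left _ (he i)
  have hbound := fun F => card_le_of_injective_mul len len_mul d C growth
    (fun e => ψ (Multiplicative.ofAdd fun i => (e i : ℤ))) _ hlenψ F
  have hfin : Finite (G ⧸ ψ.range) := by
    by_contra hinf
    have hinf : Infinite (G ⧸ ψ.range) := not_finite_iff_infinite.1 hinf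
    obtain ⟨N, hN⟩ := exists_nat_gt
      (C * (↑(∑ i, len (ψ (Multiplicative.ofAdd (Pi.single i 1)))) + 1) ^ d)
    obtain ⟨F, hF⟩ := Infinite.exists_subset_card_eq (G ⧸ ψ.range) N
    have hinj : Function.Injective fun q : G ⧸ ψ.range => (Quotient.out q)⁻¹ :=
      inv_injective.comp Quotient.out_injective
    have := hbound (F.map ⟨_, hinj⟩) (by
      intro e e' f hf f' hf' heq
      simp only [Finset.mem_map, Function.Embedding.coeFn_mk] at hf hf'
      obtain ⟨q, -, rfl⟩ := hf
      obtain ⟨q', -, rfl⟩ := hf'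
      have h1 : q'.out⁻¹ * q.out ∈ ψ.range := by
        refine ⟨(Multiplicative.ofAdd fun i => (e' i : ℤ))⁻¹ * 
          (Multiplicative.ofAdd fun i => (e i : ℤ)), ?_⟩
        rw [map_mul, map_inv, eq_comm, eq_inv_mul_iff_mul_eq, ← mul_assoc, ← heq]
        group
      have h2 : q' = q := by
        rw [← q.out_eq, ← q'.out_eq]
        exact QuotientGroup.eq.2 h1
      subst h2
      refine ⟨?_, rfl⟩
      have h3 := hψinj (mul_right_cancel heq)
      funext i
      exact_mod_cast congrFun (Multiplicative.ofAdd.injective h3) i)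
    rw [Finset.card_map, hF] at this
    linarith
  exact Subgroup.finiteIndex_of_finite_quotient

end VirtuallyAbelian

section VirtuallyAbelianCocycle

open Filter Topology
open scoped commutatorElement Pointwise

variable {G : Type*} [Group G] {V : Type*} [NormedAddCommGroup V] [NormedSpace ℝ V]

/-- A group of growth at most `n ^ d` with a bounded representation on a `d`-dimensional space and
a cocycle whose asymptotic directions span is virtually `ℤ^d`. -/
theorem exists_finiteIndex_of_cocycle {S : Set G} (hSfin : S.Finite) (hSsymm : ∀ s ∈ S, s⁻¹ ∈ S)
    (hSgen : Subgroup.closure S = ⊤) (len : G → ℕ) (len_one : len 1 = 0)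
    (len_mul : ∀ g h, len (g * h) ≤ len g + len h) (len_inv : ∀ g, len g⁻¹ = len g)
    (d : ℕ) (C : ℝ)
    (growth : ∀ (n : ℕ) (F : Finset G), (∀ g ∈ F, len g ≤ n) → (F.card : ℝ) ≤ C * (n + 1) ^ d)
    (ρ : G →* (V →L[ℝ] V)) (R : ℝ) (hR : ∀ g, ‖ρ g‖ ≤ R) (c : G → V)
    (hc : ∀ g h, c (g * h) = c g + ρ g (c h)) (u : Module.Basis (Fin d) ℝ V)
    (hu : ∀ i, ∃ (h : ℕ → G) (t : ℕ → ℝ), Tendsto t atTop atTop ∧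
      Tendsto (fun n => (t n)⁻¹ • c (h n)) atTop (𝓝 (u i))) :
    ∃ K : Subgroup G, K.FiniteIndex ∧ Nonempty (K ≃* Multiplicative (Fin d → ℤ)) := by
  classical
  have : FiniteDimensional ℝ V := u.finiteDimensional_of_finite
  have hR0 : 0 ≤ R := (norm_nonneg _).trans (hR 1)
  obtain ⟨ε, hε, hε1, hε2⟩ : ∃ ε : ℝ, 0 < ε ∧ 8000 * 2 ^ (d + 1) * (2 * ε) ≤ 1 ∧
      (R * R + 1) * R * ε ≤ 1 / 2 := by
    refine ⟨min (1 / (16000 * 2 ^ (d + 1))) (1 / (2 * ((R * R + 1) * R + 1))), by positivity,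
    ?_, ?_⟩
    · calc _ ≤ 8000 * 2 ^ (d + 1) * (2 * (1 / (16000 * 2 ^ (d + 1) : ℝ))) := by
            gcongr; exact min_le_left _ _
        _ = 1 := by field_simp; norm_num
    · calc _ ≤ (R * R + 1) * R * (1 / (2 * ((R * R + 1) * R + 1))) := by
            gcongr; exact min_le_right _ _
        _ ≤ 1 / 2 := by
            have : 0 ≤ (R * R + 1) * R := by positivity
            rw [mul_one_div, div_le_div_iff₀ (by positivity) (by norm_num)]
            linarith
  obtain ⟨I, hI⟩ := exists_finset_norm_inv_mul_sub_one_le ρ R hR hε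
  have hTfin : ({g | (∃ i ∈ I, g = i⁻¹) ∨
      ∃ t ∈ S, ∃ i ∈ I, ∃ j ∈ I, g = j⁻¹ * t * i} : Set G).Finite := by
    refine Set.Finite.subset (s := (I : Set G)⁻¹ ∪ (I : Set G)⁻¹ * S * I) ?_ ?_
    · exact (I.finite_toSet.inv).union ((I.finite_toSet.inv.mul hSfin).mul I.finite_toSet)
    · rintro g (⟨i, hi, rfl⟩ | ⟨t, ht, i, hi, j, hj, rfl⟩)
      · exact Or.inl (Set.inv_mem_inv.2 hi)
      · exact Or.inr (Set.mul_mem_mul (Set.mul_mem_mul (Set.inv_mem_inv.2 hj) ht) hi)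
  let T : Set G := {g | ‖ρ g - 1‖ ≤ ε} ∩
    {g | (∃ i ∈ I, g = i⁻¹) ∨ ∃ t ∈ S, ∃ i ∈ I, ∃ j ∈ I, g = j⁻¹ * t * i}
  have hT : T.Finite := hTfin.subset Set.inter_subset_right
  set Γ := Subgroup.closure T with hΓ
  have hcov : ∀ g, ∃ i ∈ I, i⁻¹ * g ∈ Γ := exists_mul_mem_closure hSsymm hSgen I
    (fun g => ‖ρ g - 1‖ ≤ ε) hI T (fun g h1 h2 => ⟨h1, h2⟩)
  obtain ⟨D, hD⟩ : ∃ D : ℝ, ∀ g ∈ T, ‖c g‖ ≤ D := by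
    obtain ⟨D, hD⟩ := (hT.image fun g => ‖c g‖).bddAbove
    exact ⟨D, fun g hg => hD ⟨g, hg, rfl⟩⟩
  obtain ⟨δ, hδ, hδD⟩ : ∃ δ : ℝ, 0 < δ ∧ ∀ g ∈ T, δ * ‖c g‖ ≤ ε := by
    refine ⟨ε / (|D| + 1), by positivity, fun g hg => ?_⟩
    calc _ ≤ ε / (|D| + 1) * (|D| + 1) := by
          gcongr
          exact (hD g hg).trans ((le_abs_self D).trans (by linarith))
      _ = ε := by field_simp
  obtain ⟨ℓ, hℓ⟩ : ∃ ℓ : ℕ, ∀ s ∈ T, len s ≤ ℓ := by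
    obtain ⟨D, hD⟩ := (hT.image len).bddAbove
    exact ⟨D, fun g hg => hD ⟨g, hg, rfl⟩⟩
  have hcommκ := commute_of_near_one (affineRep ρ c hc δ) len len_one len_mul len_inv d C growth
    T ℓ hℓ (fun s hs => by
      refine le_trans ?_ hε1
      gcongr
      refine (norm_affineRep_sub_one_le ρ c hc hδ.le s).trans ?_
      linarith [hs.1.out, hδD s hs])
    (fun g s hs => affineRep_commutator_eq_one ρ c hc hδ.ne' R hR g s (by
      refine le_trans ?_ hε2
      gcongr
      exact hs.1))
  have hcomm : ∀ g ∈ Γ, ∀ h ∈ Γ, c g + ρ g (c h) = c h + ρ h (c g) := by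
    intro g hg h hh
    have h1 : affineRep ρ c hc δ (g * h) = affineRep ρ c hc δ (h * g) := by
      rw [map_mul, map_mul]
      exact hcommκ g hg h hh
    have h2 := ((affineRep_eq_iff ρ c hc hδ.ne' _ _).1 h1).2
    rwa [hc, hc] at h2
  have hdir : ∀ i, ∃ (k : ℕ → Γ) (t : ℕ → ℝ), Tendsto t atTop atTop ∧
      Tendsto (fun n => (t n)⁻¹ • c (k n)) atTop (𝓝 (u i)) := by
    intro i
    obtain ⟨h, t, ht, hlim⟩ := hu i
    choose j hjI hj using fun n => hcov (h n)⁻¹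
    refine ⟨fun n => ⟨_, inv_mem (hj n)⟩, t, ht, ?_⟩
    obtain ⟨D', hD'⟩ := ((I.finite_toSet).image fun g => ‖c g⁻¹‖).bddAbove
    have hb : ∀ n, ‖c (h n) - c ((j n)⁻¹ * (h n)⁻¹)⁻¹‖ ≤ R * D' := by
      intro n
      have e : h n = ((j n)⁻¹ * (h n)⁻¹)⁻¹ * (j n)⁻¹ := by group
      have : c (h n) - c ((j n)⁻¹ * (h n)⁻¹)⁻¹ = ρ ((j n)⁻¹ * (h n)⁻¹)⁻¹ (c (j n)⁻¹) := by
        rw [sub_eq_iff_eq_add', ← hc, ← e]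
      rw [this]
      refine ((ρ _).le_of_opNorm_le (hR _) _).trans ?_
      gcongr
      exact hD' ⟨j n, hjI n, rfl⟩
    have h0 : Tendsto (fun n => (t n)⁻¹ • (c (h n) - c ((j n)⁻¹ * (h n)⁻¹)⁻¹)) atTop (𝓝 0) := by
      refine squeeze_zero_norm (a := fun n => |(t n)⁻¹| * (R * D')) (fun n => ?_) ?_
      · rw [norm_smul, Real.norm_eq_abs]
        gcongr
        exact hb n
      · have := (tendsto_inv_atTop_zero.comp ht).abs.mul_const (R * D')
        simpa using this
    have := hlim.sub h0
    rw [sub_zero] at this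
    refine this.congr fun n => ?_
    rw [smul_sub, sub_sub_cancel]
  choose k t ht hlim using hdir
  have hρ1 : ∀ g ∈ Γ, ρ g = 1 := by
    intro g hg
    have hui : ∀ i, (ρ g - 1) (u i) = 0 := by
      intro i
      have h1 : Tendsto (fun n => (ρ g - 1) ((t i n)⁻¹ • c (k i n))) atTop (𝓝 ((ρ g - 1) (u i))) :=
        ((ρ g - 1).continuous.tendsto _).comp (hlim i)
      refine tendsto_nhds_unique h1 ?_
      refine squeeze_zero_norm (a := fun n => |(t i n)⁻¹| * ((R + 1) * ‖c g‖)) (fun n => ?_) ?_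
      · rw [map_smul, norm_smul, Real.norm_eq_abs]
        gcongr
        have e : (ρ g - 1) (c (k i n)) = ρ (k i n) (c g) - c g := by
          have := hcomm g hg (k i n) (k i n).2
          rw [sub_apply, one_apply_eq_self, sub_eq_sub_iff_add_eq_add, add_comm, this, add_comm]
        rw [e]
        refine (norm_sub_le _ _).trans ?_
        have := (ρ (k i n)).le_of_opNorm_le (hR _) (c g)
        linarith
      · have := (tendsto_inv_atTop_zero.comp (ht i)).abs.mul_const ((R + 1) * ‖c g‖)
        simpa using this
    have h2 : (ρ g - 1 : V →L[ℝ] V).toLinearMap = 0 := u.ext fun i => by simpa using hui i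
    ext v
    have := LinearMap.congr_fun h2 v
    simpa [sub_eq_zero] using this
  let c' : Γ →* Multiplicative V :=
    { toFun := fun g => Multiplicative.ofAdd (c g)
      map_one' := by
        have : c 1 = 0 := by simpa using hc 1 1
        simp [this]
      map_mul' := fun g h => by
        rw [Subgroup.coe_mul, hc, hρ1 g g.2]
        rfl }
  have hopen := (isOpen_setOfPred_linearIndependent (𝕜 := ℝ) (E := V) (ι := Fin d)).mem_nhds
    u.linearIndependent
  have h1 : Tendsto (fun n => fun i => (t i n)⁻¹ • c (k i n)) atTop (𝓝 (u : Fin d → V)) :=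
    tendsto_pi_nhds.2 hlim
  have h2 : ∀ᶠ n in atTop, ∀ i, t i n ≠ 0 :=
    eventually_all.2 fun i => ((ht i).eventually_gt_atTop 0).mono fun n hn => hn.ne'
  obtain ⟨n, hn1, hn2⟩ := ((h1.eventually hopen).and h2).exists
  refine exists_finiteIndex_of_hom len len_one len_mul d C growth Γ c' (fun i => k i n) ?_
  have h3 := hn1.units_smul (fun i => Units.mk0 (t i n) (hn2 i))
  have e : (fun i => (c' (k i n)).toAdd)
      = (fun i => Units.mk0 (t i n) (hn2 i)) • fun i => (t i n)⁻¹ • c (k i n) := by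
    funext i
    show c (k i n) = _
    simp [Units.smul_def, smul_smul, hn2 i]
  rw [e]
  exact h3

end VirtuallyAbelianCocycle

section WordLength

variable {G : Type*} [Group G] {S : Set G}

lemma wlen_le_length {l : List G} (hl : ∀ s ∈ l, s ∈ S) : wlen S l.prod ≤ l.length :=
  Nat.sInf_le ⟨l, hl, rfl, rfl⟩

lemma exists_list_length_eq_wlen (hSsymm : ∀ s ∈ S, s⁻¹ ∈ S) (hSgen : Subgroup.closure S = ⊤)
    (g : G) : ∃ l : List G, (∀ s ∈ l, s ∈ S) ∧ l.length = wlen S g ∧ l.prod = g := by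
  have hne : {n : ℕ | ∃ l : List G, (∀ s ∈ l, s ∈ S) ∧ l.length = n ∧ l.prod = g}.Nonempty := by
    have hg : g ∈ Subgroup.closure S := by rw [hSgen]; trivial
    rw [← Subgroup.mem_toSubmonoid, Subgroup.closure_toSubmonoid] at hg
    obtain ⟨l, hl, rfl⟩ := Submonoid.exists_list_of_mem_closure hg
    refine ⟨l.length, l, fun s hs => ?_, rfl, rfl⟩
    rcases hl s hs with h | h
    · exact h
    · simpa using hSsymm _ h
  exact Nat.sInf_mem hne

lemma wlen_one : wlen S 1 = 0 := Nat.le_zero.1 (wlen_le_length (l := []) (by simp))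

lemma wlen_mul_le (hSsymm : ∀ s ∈ S, s⁻¹ ∈ S) (hSgen : Subgroup.closure S = ⊤) (g h : G) :
    wlen S (g * h) ≤ wlen S g + wlen S h := by
  obtain ⟨l, hl, hln, rfl⟩ := exists_list_length_eq_wlen hSsymm hSgen g
  obtain ⟨l', hl', hln', rfl⟩ := exists_list_length_eq_wlen hSsymm hSgen h
  rw [← hln, ← hln', ← List.prod_append, ← List.length_append]
  refine wlen_le_length fun s hs => ?_
  rcases List.mem_append.1 hs with h | h
  · exact hl s h
  · exact hl' s h

lemma wlen_inv (hSsymm : ∀ s ∈ S, s⁻¹ ∈ S) (hSgen : Subgroup.closure S = ⊤) (g : G) :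
    wlen S g⁻¹ = wlen S g := by
  have key : ∀ g : G, wlen S g⁻¹ ≤ wlen S g := by
    intro g
    obtain ⟨l, hl, hln, rfl⟩ := exists_list_length_eq_wlen hSsymm hSgen g
    rw [List.prod_inv_reverse, ← hln]
    refine (wlen_le_length fun s hs => ?_).trans (by simp)
    simp only [List.mem_reverse, List.mem_map] at hs
    obtain ⟨a, ha, rfl⟩ := hs
    exact hSsymm a (hl a ha)
  refine le_antisymm (key g) ?_
  simpa using key g⁻¹

/-- A subadditive function on a group is bounded by a multiple of the word length. -/
lemma le_mul_wlen (hSfin : S.Finite) (hSsymm : ∀ s ∈ S, s⁻¹ ∈ S)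
    (hSgen : Subgroup.closure S = ⊤) (K : G → ℝ) (hK1 : K 1 ≤ 0)
    (hKmul : ∀ g h, K (g * h) ≤ K g + K h) :
    ∃ C : ℝ, 0 ≤ C ∧ ∀ g, K g ≤ C * wlen S g := by
  obtain ⟨D, hD⟩ := (hSfin.image K).bddAbove
  refine ⟨|D|, abs_nonneg _, fun g => ?_⟩
  obtain ⟨l, hl, hln, rfl⟩ := exists_list_length_eq_wlen hSsymm hSgen g
  rw [← hln]
  clear hln
  induction l with
  | nil => simpa using hK1
  | cons a l ih =>
    have h1 := ih fun s hs => hl s (List.mem_cons_of_mem _ hs)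
    have h2 : K a ≤ |D| := (hD ⟨a, hl a List.mem_cons_self, rfl⟩).trans (le_abs_self D)
    rw [List.prod_cons, List.length_cons]
    push_cast
    linarith [hKmul a l.prod]

end WordLength

section MeanErgodic

open Filter Topology Function

variable {Z : Type*} [MeasurableSpace Z] {μ : Measure Z} {T : Z → Z}

theorem memLp_birkhoffAverage (hT : MeasurePreserving T μ μ) {p : ENNReal} {g : Z → ℝ}
    (hg : MemLp g p μ) (n : ℕ) : MemLp (birkhoffAverage ℝ T g n) p μ := by
  have h : birkhoffAverage ℝ T g n = (n : ℝ)⁻¹ • ∑ k ∈ Finset.range n, g ∘ T^[k] := by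
    ext z; simp [birkhoffAverage, birkhoffSum]
  rw [h]
  exact (memLp_finsetSum' _ fun k _ => hg.comp_measurePreserving (hT.iterate k)).const_smul _

theorem eLpNorm_birkhoffAverage_le (hT : MeasurePreserving T μ μ) {g : Z → ℝ}
    (hg : MemLp g 1 μ) (n : ℕ) : eLpNorm (birkhoffAverage ℝ T g n) 1 μ ≤ eLpNorm g 1 μ := by
  have h : birkhoffAverage ℝ T g n = (n : ℝ)⁻¹ • ∑ k ∈ Finset.range n, g ∘ T^[k] := by
    ext z; simp [birkhoffAverage, birkhoffSum]
  rw [h, eLpNorm_const_smul]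
  have h1 : eLpNorm (∑ k ∈ Finset.range n, g ∘ T^[k]) 1 μ ≤ n * eLpNorm g 1 μ := by
    refine (eLpNorm_sum_le (fun k _ =>
      (hg.comp_measurePreserving (hT.iterate k)).aestronglyMeasurable) le_rfl).trans ?_
    rw [Finset.sum_congr rfl fun k _ =>
      eLpNorm_comp_measurePreserving hg.aestronglyMeasurable (hT.iterate k)]
    simp
  refine (mul_le_mul_right h1 _).trans ?_
  rcases Nat.eq_zero_or_pos n with rfl | hn
  · simp
  · have : ‖(n : ℝ)⁻¹‖ₑ * (n : ENNReal) = 1 := by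
      have hn' : (n : ℝ) ≠ 0 := by positivity
      rw [enorm_inv hn']
      simp only [Real.enorm_natCast]
      exact ENNReal.inv_mul_cancel (by positivity) (by simp)
    rw [← mul_assoc, this, one_mul]

theorem exists_tendsto_eLpNorm_two_birkhoffAverage (hT : MeasurePreserving T μ μ) {g : Z → ℝ}
    (hg : MemLp g 2 μ) : ∃ gbar : Z → ℝ, MemLp gbar 2 μ ∧
      Tendsto (fun n => eLpNorm (birkhoffAverage ℝ T g n - gbar) 2 μ) atTop (𝓝 0) := by
  have : Fact ((1 : ENNReal) ≤ 2) := ⟨by norm_num⟩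
  let U : Lp ℝ 2 μ →L[ℝ] Lp ℝ 2 μ :=
    (Lp.compMeasurePreservingₗᵢ ℝ T hT).toContinuousLinearMap
  have hU : ‖U‖ ≤ 1 := LinearIsometry.norm_toContinuousLinearMap_le _
  obtain ⟨P, key⟩ : ∃ P, Tendsto (birkhoffAverage ℝ U _root_.id · (hg.toLp g)) atTop (𝓝 P) :=
    ⟨_, U.tendsto_birkhoffAverage_orthogonalProjection hU (hg.toLp g)⟩
  have hU' : (U : Lp ℝ 2 μ → Lp ℝ 2 μ) = Lp.compMeasurePreserving T hT := rfl
  have hn : ∀ n, birkhoffAverage ℝ U _root_.id n (hg.toLp g) =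
      (memLp_birkhoffAverage hT hg n).toLp _ := by
    intro n
    have h1 : ∀ k, U^[k] (hg.toLp g) = (hg.comp_measurePreserving (hT.iterate k)).toLp _ := by
      intro k
      rw [hU', Lp.compMeasurePreserving_iterate, Lp.toLp_compMeasurePreserving]
    simp only [birkhoffAverage, birkhoffSum, id, h1]
    refine Lp.ext ?_
    refine (Lp.coeFn_smul _ _).trans ?_
    refine EventuallyEq.trans ?_ (MemLp.coeFn_toLp _).symm
    have h2 : ((∑ k ∈ Finset.range n, (hg.comp_measurePreserving (hT.iterate k)).toLp _ :
        Lp ℝ 2 μ) : Z → ℝ) =ᵐ[μ] ∑ k ∈ Finset.range n, g ∘ T^[k] := by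
      have h3 : ∀ s : Finset ℕ, ((∑ k ∈ s, (hg.comp_measurePreserving (hT.iterate k)).toLp _ :
          Lp ℝ 2 μ) : Z → ℝ) =ᵐ[μ] ∑ k ∈ s, g ∘ T^[k] := by
        intro s
        induction s using Finset.induction_on with
        | empty => simpa using Lp.coeFn_zero ℝ 2 μ
        | insert a s ha ih =>
          rw [Finset.sum_insert ha, Finset.sum_insert ha]
          exact (Lp.coeFn_add _ _).trans ((MemLp.coeFn_toLp _).add ih)
      exact h3 _
    filter_upwards [h2] with z hz
    rw [Pi.smul_apply, hz]
    simp [birkhoffAverage, birkhoffSum]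
  simp only [hn] at key
  refine ⟨P, Lp.memLp P, ?_⟩
  rw [Lp.tendsto_Lp_iff_tendsto_eLpNorm'] at key
  refine key.congr fun n => eLpNorm_congr_ae ?_
  filter_upwards [(memLp_birkhoffAverage hT hg n).coeFn_toLp] with z hz
  simp [hz]

/-- The mean ergodic theorem in `L¹`. -/
theorem exists_tendsto_integral_abs_birkhoffAverage [IsFiniteMeasure μ]
    (hT : MeasurePreserving T μ μ) {u : Z → ℝ} (hu : Integrable u μ) :
    ∃ ubar : Z → ℝ, Integrable ubar μ ∧
      Tendsto (fun n => ∫ z, |birkhoffAverage ℝ T u n z - ubar z| ∂μ) atTop (𝓝 0) := by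
  have : Fact ((1 : ENNReal) ≤ 1) := ⟨le_rfl⟩
  have hu1 : MemLp u 1 μ := memLp_one_iff_integrable.2 hu
  let F : ℕ → Lp ℝ 1 μ := fun n => (memLp_birkhoffAverage hT hu1 n).toLp _
  have hd : ∀ n m, edist (F n) (F m) =
      eLpNorm (birkhoffAverage ℝ T u n - birkhoffAverage ℝ T u m) 1 μ := fun n m =>
    Lp.edist_toLp_toLp _ _ _ _
  have hC : CauchySeq F := by
    rw [EMetric.cauchySeq_iff]
    intro ε hε
    obtain ⟨δ, hδ, hδε⟩ : ∃ δ : ENNReal, 0 < δ ∧ δ + δ + (δ + δ) < ε := by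
      obtain ⟨δ, h1, h2⟩ := ENNReal.exists_nnreal_pos_mul_lt (a := 4) (by norm_num) hε.ne'
      refine ⟨δ, by positivity, ?_⟩
      calc (δ : ENNReal) + δ + (δ + δ) = δ * 4 := by ring
        _ < ε := h2
    obtain ⟨g, hgu, hg1⟩ := hu1.exists_simpleFunc_eLpNorm_sub_lt (by simp) hδ.ne'
    have hg2 : MemLp g 2 μ := g.memLp_of_isFiniteMeasure 2 μ
    obtain ⟨gbar, hgbar, hlim⟩ := exists_tendsto_eLpNorm_two_birkhoffAverage hT hg2
    have hlim1 : Tendsto (fun n => eLpNorm (birkhoffAverage ℝ T g n - gbar) 1 μ) atTop (𝓝 0) := by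
      refine tendsto_of_tendsto_of_tendsto_of_le_of_le tendsto_const_nhds
        (h := fun n => eLpNorm (birkhoffAverage ℝ T g n - gbar) 2 μ *
          μ Set.univ ^ (1 / (1 : ENNReal).toReal - 1 / (2 : ENNReal).toReal)) ?_
        (fun n => zero_le) fun n => eLpNorm_le_eLpNorm_mul_rpow_measure_univ (by norm_num)
          ((memLp_birkhoffAverage hT hg2 n).sub hgbar).aestronglyMeasurable
      have := ENNReal.Tendsto.mul_const (b := μ Set.univ ^
        (1 / (1 : ENNReal).toReal - 1 / (2 : ENNReal).toReal)) hlim (Or.inr ?_)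
      · simpa using this
      · refine ENNReal.rpow_ne_top_of_nonneg (by norm_num) (measure_ne_top _ _)
    obtain ⟨N, hN⟩ := (hlim1.eventually (gt_mem_nhds hδ)).exists_forall_of_atTop
    refine ⟨N, fun n hn m hm => ?_⟩
    rw [hd]
    have e : birkhoffAverage ℝ T u n - birkhoffAverage ℝ T u m =
        (birkhoffAverage ℝ T (u - ⇑g) n - birkhoffAverage ℝ T (u - ⇑g) m) +
        ((birkhoffAverage ℝ T g n - gbar) - (birkhoffAverage ℝ T g m - gbar)) := by
      rw [birkhoffAverage_sub]
      simp only [Pi.sub_apply]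
      abel
    have m1 : ∀ n, MemLp (birkhoffAverage ℝ T (u - ⇑g) n) 1 μ := fun n =>
      memLp_birkhoffAverage hT (hu1.sub hg1) n
    have m2 : ∀ n, MemLp (birkhoffAverage ℝ T g n - gbar) 1 μ := fun n =>
      ((memLp_birkhoffAverage hT hg2 n).sub hgbar).mono_exponent (by norm_num)
    rw [e]
    have b1 : ∀ n, eLpNorm (birkhoffAverage ℝ T (u - ⇑g) n) 1 μ ≤ δ := fun n =>
      (eLpNorm_birkhoffAverage_le hT (hu1.sub hg1) n).trans hgu.le
    calc _ ≤ _ := eLpNorm_add_le ((m1 n).sub (m1 m)).1 ((m2 n).sub (m2 m)).1 le_rfl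
      _ ≤ _ := add_le_add (eLpNorm_sub_le (m1 n).1 (m1 m).1 le_rfl)
          (eLpNorm_sub_le (m2 n).1 (m2 m).1 le_rfl)
      _ ≤ δ + δ + (δ + δ) := add_le_add (add_le_add (b1 n) (b1 m))
          (add_le_add (hN n hn).le (hN m hm).le)
      _ < ε := hδε
  obtain ⟨f, hf⟩ := cauchySeq_tendsto_of_complete hC
  refine ⟨f, L1.integrable_coeFn f, ?_⟩
  rw [Lp.tendsto_Lp_iff_tendsto_eLpNorm'] at hf
  have h0 := (ENNReal.tendsto_toReal (by simp)).comp hf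
  simp only [ENNReal.toReal_zero] at h0
  refine h0.congr fun n => ?_
  have e : eLpNorm (F n - f : Z → ℝ) 1 μ = eLpNorm (birkhoffAverage ℝ T u n - ⇑f) 1 μ := by
    refine eLpNorm_congr_ae ?_
    filter_upwards [(memLp_birkhoffAverage hT hu1 n).coeFn_toLp] with z hz
    simp [F, hz]
  have hi : Integrable (birkhoffAverage ℝ T u n - ⇑f : Z → ℝ) μ :=
    (memLp_one_iff_integrable.1 (memLp_birkhoffAverage hT hu1 n)).sub (L1.integrable_coeFn f)
  simp only [Function.comp, e, eLpNorm_one_eq_lintegral_enorm]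
  rw [← integral_norm_eq_lintegral_enorm hi.1]
  simp

end MeanErgodic

section ErgodicCocycle

open Filter Topology Function

/-- The coordinatewise inclusion of `ℤ^d` in `ℝ^d`. -/
def intVec {d : ℕ} : (Fin d → ℤ) →+ (Fin d → ℝ) where
  toFun v i := (v i : ℝ)
  map_zero' := by ext; simp
  map_add' v w := by ext; simp

theorem intVec_apply {d : ℕ} (v : Fin d → ℤ) (i : Fin d) : intVec v i = (v i : ℝ) := rfl

theorem norm_intVec {d : ℕ} (v : Fin d → ℤ) : ‖intVec v‖ = ‖v‖ := by
  apply le_antisymm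
  · refine (pi_norm_le_iff_of_nonneg (norm_nonneg _)).2 fun i => ?_
    exact (Int.norm_eq_abs (v i) ▸ norm_le_pi_norm v i :)
  · refine (pi_norm_le_iff_of_nonneg (norm_nonneg _)).2 fun i => ?_
    exact (Int.norm_eq_abs (v i) ▸ norm_le_pi_norm (intVec v) i :)

theorem exists_le_of_subadditive {d : ℕ} (q : (Fin d → ℤ) → ℝ)
    (hadd : ∀ v w, q (v + w) ≤ q v + q w) (hneg : ∀ v, q (-v) = q v)
    (hlim : ∀ i, Tendsto (fun n : ℕ => (n : ℝ)⁻¹ * q (n • Pi.single i 1)) atTop (𝓝 0))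
    {ε : ℝ} (hε : 0 < ε) : ∃ C, 0 ≤ C ∧ ∀ v, q v ≤ ε * ‖v‖ + C := by
  have h1 : ∀ i, ∃ C, 0 ≤ C ∧ ∀ n : ℕ, q (n • Pi.single i 1) ≤ ε / (d + 1) * n + C := by
    intro i
    have hε' : 0 < ε / (d + 1) := by positivity
    obtain ⟨N, hN⟩ := ((hlim i).eventually (gt_mem_nhds hε')).exists_forall_of_atTop
    refine ⟨∑ n ∈ Finset.range (N + 1), |q (n • Pi.single i 1)|,
      Finset.sum_nonneg fun _ _ => abs_nonneg _, fun n => ?_⟩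
    by_cases hn : n < N + 1
    · have := Finset.single_le_sum (f := fun n : ℕ => |q (n • Pi.single i 1)|)
        (fun _ _ => abs_nonneg _) (Finset.mem_range.2 hn)
      have h2 := le_abs_self (q (n • Pi.single i 1))
      have h3 : 0 ≤ ε / (d + 1) * n := by positivity
      linarith
    · have hn0 : (0 : ℝ) < n := by
        have : 0 < n := by omega
        exact_mod_cast this
      have := hN n (by omega)
      rw [inv_mul_lt_iff₀ hn0] at this
      have h3 : 0 ≤ ∑ n ∈ Finset.range (N + 1), |q (n • Pi.single i 1)| :=
        Finset.sum_nonneg fun _ _ => abs_nonneg _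
      linarith
  choose C hC0 hC using h1
  have h2 : ∀ i (a : ℤ), q (a • Pi.single i 1) ≤ ε / (d + 1) * |(a : ℝ)| + C i := by
    intro i a
    rcases Int.natAbs_eq a with h | h
    · have := hC i a.natAbs
      rw [← natCast_zsmul, ← h] at this
      rwa [Nat.cast_natAbs, Int.cast_abs] at this
    · have := hC i a.natAbs
      rw [← hneg, ← natCast_zsmul, ← neg_zsmul, ← h] at this
      rwa [Nat.cast_natAbs, Int.cast_abs] at this
  refine ⟨|q 0| + ∑ i, C i, add_nonneg (abs_nonneg _) (Finset.sum_nonneg fun i _ => hC0 i),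
    fun v => ?_⟩
  have h3 : ∀ s : Finset (Fin d), q (∑ i ∈ s, v i • Pi.single i 1) ≤
      q 0 + ∑ i ∈ s, (ε / (d + 1) * ‖v‖ + C i) := by
    intro s
    induction s using Finset.induction_on with
    | empty => simp
    | insert a s ha ih =>
      rw [Finset.sum_insert ha, Finset.sum_insert ha]
      have h4 := hadd (v a • Pi.single a 1) (∑ i ∈ s, v i • Pi.single i 1)
      have h5 := h2 a (v a)
      have h6 : |(v a : ℝ)| ≤ ‖v‖ := (Int.norm_eq_abs (v a) ▸ norm_le_pi_norm v a :)
      have h7 : ε / (d + 1) * |(v a : ℝ)| ≤ ε / (d + 1) * ‖v‖ :=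
        mul_le_mul_of_nonneg_left h6 (by positivity)
      linarith
  have h4 := h3 Finset.univ
  have h5 : ∑ i, v i • (Pi.single i 1 : Fin d → ℤ) = v := by
    ext j
    simp [Finset.sum_apply, Pi.single_apply]
  rw [h5, Finset.sum_add_distrib] at h4
  simp only [Finset.sum_const, Finset.card_univ, Fintype.card_fin, nsmul_eq_mul] at h4
  have h6 : (d : ℝ) * (ε / (d + 1) * ‖v‖) ≤ ε * ‖v‖ := by
    have : (d : ℝ) * (ε / (d + 1)) ≤ ε := by
      rw [← mul_div_assoc, div_le_iff₀ (by positivity)]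
      nlinarith
    calc _ = (d : ℝ) * (ε / (d + 1)) * ‖v‖ := by ring
      _ ≤ _ := mul_le_mul_of_nonneg_right this (norm_nonneg _)
  have := le_abs_self (q 0)
  linarith

variable {Z : Type*} [MeasurableSpace Z] {μ : Measure Z} {d : ℕ}

theorem integral_comp_of_measurePreserving {W E : Type*} [MeasurableSpace W] {ν : Measure W}
    [NormedAddCommGroup E] [NormedSpace ℝ E] {f : Z → W} (hf : MeasurePreserving f μ ν)
    {g : W → E} (hg : AEStronglyMeasurable g ν) : ∫ z, g (f z) ∂μ = ∫ w, g w ∂ν := by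
  rw [← hf.map_eq] at hg ⊢
  exact (integral_map hf.aemeasurable hg).symm

theorem ae_eq_smul_birkhoffAverage_of_cocycle {T : (Fin d → ℤ) → Z → Z}
    {V : Type*} [AddCommGroup V] [Module ℝ V]
    (hTadd : ∀ v w z, T (v + w) z = T v (T w z))
    (hT0 : ∀ᵐ z ∂μ, T 0 z = z) {γ : (Fin d → ℤ) → Z → V}
    (hγ : ∀ v w z, γ (v + w) z = γ v (T w z) + γ w z) (v : Fin d → ℤ) (n : ℕ) :
    ∀ᵐ z ∂μ, γ (n • v) z = (n : ℝ) • birkhoffAverage ℝ (T v) (γ v) n z := by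
  have h0 : ∀ᵐ z ∂μ, γ (n • v) z = birkhoffSum (T v) (γ v) n z ∧ T (n • v) z = (T v)^[n] z := by
    induction n with
    | zero =>
      filter_upwards [hT0] with z hz
      have := hγ 0 0 z
      rw [hz, add_zero] at this
      simpa [hz] using this
    | succ n ih =>
      filter_upwards [ih] with z hz
      rw [succ_nsmul', hγ, hTadd, hz.1, hz.2, birkhoffSum_succ, iterate_succ_apply', add_comm]
      exact ⟨rfl, rfl⟩
  filter_upwards [h0] with z hz
  rw [hz.1]
  rcases Nat.eq_zero_or_pos n with rfl | hn
  · simp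
  · rw [birkhoffAverage, smul_inv_smul₀ (by positivity)]

theorem exists_asymptotic_linearMap [IsFiniteMeasure μ] {T : (Fin d → ℤ) → Z → Z}
    (hT : ∀ v, MeasurePreserving (T v) μ μ) (hTadd : ∀ v w z, T (v + w) z = T v (T w z))
    (hT0 : ∀ᵐ z ∂μ, T 0 z = z) {γ : (Fin d → ℤ) → Z → (Fin d → ℝ)}
    (hγi : ∀ v, Integrable (γ v) μ)
    (hγ : ∀ v w z, γ (v + w) z = γ v (T w z) + γ w z) :
    ∃ ℓ : Z → (Fin d → ℝ) →L[ℝ] (Fin d → ℝ), StronglyMeasurable ℓ ∧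
      (∀ v, ∀ᵐ z ∂μ, ℓ (T v z) = ℓ z) ∧
      (∀ w, Integrable (fun z => ℓ z w) μ) ∧
      ∀ ε : ℝ, 0 < ε → ∃ C, 0 ≤ C ∧ ∀ v, ∫ z, ‖γ v z - ℓ z (intVec v)‖ ∂μ ≤ ε * ‖v‖ + C := by
  have hγ0 : ∀ᵐ z ∂μ, γ 0 z = 0 := by
    filter_upwards [hT0] with z hz
    have := hγ 0 0 z
    rw [hz, add_zero] at this
    simpa using this
  let e : Fin d → Fin d → ℤ := fun i => Pi.single i 1
  have h1 : ∀ i j, ∃ ub : Z → ℝ, StronglyMeasurable ub ∧ Integrable ub μ ∧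
      Tendsto (fun n => ∫ z, |birkhoffAverage ℝ (T (e i)) (fun z => γ (e i) z j) n z - ub z| ∂μ)
        atTop (𝓝 0) := by
    intro i j
    obtain ⟨ub, hub, hlim⟩ := exists_tendsto_integral_abs_birkhoffAverage (hT (e i))
      ((hγi (e i)).eval j)
    refine ⟨hub.1.mk ub, hub.1.stronglyMeasurable_mk, hub.congr hub.1.ae_eq_mk,
      hlim.congr fun n => integral_congr_ae ?_⟩
    filter_upwards [hub.1.ae_eq_mk] with z hz
    rw [hz]
  choose ub hubm hubi hlim using h1
  let U : Fin d → Z → (Fin d → ℝ) := fun i z j => ub i j z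
  have hUm : ∀ i, StronglyMeasurable (U i) := fun i =>
    (measurable_pi_lambda _ fun j => (hubm i j).measurable).stronglyMeasurable
  have hUi : ∀ i, Integrable (U i) μ := fun i => Integrable.of_eval fun j => hubi i j
  let ℓ : Z → (Fin d → ℝ) →L[ℝ] (Fin d → ℝ) := fun z =>
    ∑ i, ContinuousLinearMap.smulRightL ℝ (Fin d → ℝ) (Fin d → ℝ)
      (ContinuousLinearMap.proj i) (U i z)
  have hℓ : ∀ z w, ℓ z w = ∑ i, w i • U i z := by
    intro z w
    simp [ℓ]
  have hℓm : StronglyMeasurable ℓ := by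
    refine Finset.stronglyMeasurable_fun_sum _ fun i _ => ?_
    exact (ContinuousLinearMap.continuous _).comp_stronglyMeasurable (hUm i)
  have hℓi : ∀ w, Integrable (fun z => ℓ z w) μ := by
    intro w
    simp only [hℓ]
    exact integrable_finsetSum _ fun i _ => (hUi i).smul (w i)
  have hℓe : ∀ i z (n : ℕ), ℓ z (intVec (n • e i)) = (n : ℝ) • U i z := by
    intro i z n
    rw [hℓ, Finset.sum_eq_single i]
    · simp [intVec_apply, e]
    · intro b _ hb
      simp [intVec_apply, e, hb]
    · simp
  let q : (Fin d → ℤ) → ℝ := fun v => ∫ z, ‖γ v z - ℓ z (intVec v)‖ ∂μ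
  have hqi : ∀ v, Integrable (fun z => γ v z - ℓ z (intVec v)) μ := fun v =>
    (hγi v).sub (hℓi _)
  have hlimV : ∀ i, Tendsto (fun n : ℕ => ∫ z, ‖(n : ℝ)⁻¹ • γ (n • e i) z - U i z‖ ∂μ) atTop
      (𝓝 0) := by
    intro i
    have hs : Tendsto (fun n => ∑ j, ∫ z, |birkhoffAverage ℝ (T (e i))
        (fun z => γ (e i) z j) n z - ub i j z| ∂μ) atTop (𝓝 0) := by
      have := tendsto_finsetSum (Finset.univ : Finset (Fin d)) fun j _ => hlim i j
      simpa using this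
    refine squeeze_zero' (Eventually.of_forall fun n => integral_nonneg fun z => norm_nonneg _)
      ((eventually_gt_atTop 0).mono fun n hn => ?_) hs
    have hbi : ∀ j, Integrable (birkhoffAverage ℝ (T (e i)) (fun z => γ (e i) z j) n) μ :=
      fun j => memLp_one_iff_integrable.1 (memLp_birkhoffAverage (hT (e i))
        (memLp_one_iff_integrable.2 ((hγi (e i)).eval j)) n)
    have habs : ∀ j ∈ Finset.univ, Integrable (fun z => |birkhoffAverage ℝ (T (e i))
        (fun z => γ (e i) z j) n z - ub i j z|) μ := fun j _ => ((hbi j).sub (hubi i j)).abs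
    rw [← integral_finsetSum _ habs]
    refine integral_mono_ae ((((hγi (n • e i)).smul (n : ℝ)⁻¹).sub (hUi i)).norm)
      (integrable_finsetSum _ fun j _ => ((hbi j).sub (hubi i j)).abs) ?_
    filter_upwards [ae_eq_smul_birkhoffAverage_of_cocycle hTadd hT0 hγ (e i) n] with z hz
    rw [hz, inv_smul_smul₀ (by positivity)]
    refine (pi_norm_le_iff_of_nonneg (Finset.sum_nonneg fun _ _ => abs_nonneg _)).2 fun j => ?_
    have h2 : birkhoffAverage ℝ (T (e i)) (γ (e i)) n z j =
        birkhoffAverage ℝ (T (e i)) (fun z => γ (e i) z j) n z := by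
      simp [birkhoffAverage, birkhoffSum, Finset.sum_apply]
    rw [Pi.sub_apply, h2, Real.norm_eq_abs]
    exact Finset.single_le_sum (f := fun j => |birkhoffAverage ℝ (T (e i))
        (fun z => γ (e i) z j) n z - ub i j z|) (fun _ _ => abs_nonneg _) (Finset.mem_univ j)
  have hUinv : ∀ i v, ∀ᵐ z ∂μ, U i (T v z) = U i z := by
    intro i v
    have hUT : Integrable (fun z => U i (T v z)) μ := (hT v).integrable_comp_of_integrable (hUi i)
    have hγT : ∀ w, Integrable (fun z => γ w (T v z)) μ :=
      fun w => (hT v).integrable_comp_of_integrable (hγi w)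
    have hγT' : ∀ w, Integrable (fun z => γ v (T w z)) μ :=
      fun w => (hT w).integrable_comp_of_integrable (hγi v)
    have h0 : ∫ z, ‖U i (T v z) - U i z‖ ∂μ ≤ 0 := by
      have hb : ∀ n : ℕ, 0 < n → ∫ z, ‖U i (T v z) - U i z‖ ∂μ ≤
          (∫ z, ‖(n : ℝ)⁻¹ • γ (n • e i) z - U i z‖ ∂μ) +
          (∫ z, ‖(n : ℝ)⁻¹ • γ (n • e i) z - U i z‖ ∂μ) +
          (n : ℝ)⁻¹ * ((∫ z, ‖γ v z‖ ∂μ) + ∫ z, ‖γ v z‖ ∂μ) := by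
        intro n hn
        have i1 : Integrable (fun z => (n : ℝ)⁻¹ • γ (n • e i) z - U i z) μ :=
          ((hγi (n • e i)).smul (n : ℝ)⁻¹).sub (hUi i)
        have e1 : ∫ z, ‖(n : ℝ)⁻¹ • γ (n • e i) (T v z) - U i (T v z)‖ ∂μ =
            ∫ z, ‖(n : ℝ)⁻¹ • γ (n • e i) z - U i z‖ ∂μ :=
          integral_comp_of_measurePreserving (hT v) i1.norm.1
        have e2 : ∫ z, ‖γ v (T (n • e i) z)‖ ∂μ = ∫ z, ‖γ v z‖ ∂μ :=
          integral_comp_of_measurePreserving (hT (n • e i)) (hγi v).norm.1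
        have i2 : Integrable (fun z => (n : ℝ)⁻¹ • γ (n • e i) (T v z) - U i (T v z)) μ :=
          ((hγT (n • e i)).smul (n : ℝ)⁻¹).sub hUT
        nth_rewrite 1 [← e1]
        nth_rewrite 1 [← e2]
        have i3 : Integrable (fun z => ‖(n : ℝ)⁻¹ • γ (n • e i) (T v z) - U i (T v z)‖ +
            ‖(n : ℝ)⁻¹ • γ (n • e i) z - U i z‖) μ := i2.norm.add i1.norm
        have i4 : Integrable (fun z => (n : ℝ)⁻¹ * (‖γ v (T (n • e i) z)‖ + ‖γ v z‖)) μ :=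
          ((hγT' _).norm.add (hγi v).norm).const_mul _
        rw [← integral_add i2.norm i1.norm, ← integral_add (hγT' _).norm (hγi v).norm,
          ← integral_const_mul, ← integral_add i3 i4]
        refine integral_mono (hUT.sub (hUi i)).norm (i3.add i4) fun z => ?_
        have hc : γ (n • e i) (T v z) + γ v z = γ v (T (n • e i) z) + γ (n • e i) z := by
          rw [← hγ, ← hγ, add_comm]
        have hc' : U i (T v z) - U i z =
            -((n : ℝ)⁻¹ • γ (n • e i) (T v z) - U i (T v z)) +
            ((n : ℝ)⁻¹ • γ (n • e i) z - U i z) +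
            (n : ℝ)⁻¹ • (γ v (T (n • e i) z) - γ v z) := by
          have : γ (n • e i) (T v z) = γ v (T (n • e i) z) + γ (n • e i) z - γ v z :=
            eq_sub_of_add_eq hc
          rw [this]
          module
        simp only
        rw [hc']
        refine (norm_add_le _ _).trans (add_le_add ((norm_add_le _ _).trans ?_) ?_)
        · rw [norm_neg]
        · rw [norm_smul, Real.norm_eq_abs, abs_of_nonneg (by positivity)]
          exact mul_le_mul_of_nonneg_left (norm_sub_le _ _) (by positivity)
      have hl := ((hlimV i).add (hlimV i)).add
        ((tendsto_inv_atTop_nhds_zero_nat (𝕜 := ℝ)).mul_const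
          ((∫ z, ‖γ v z‖ ∂μ) + ∫ z, ‖γ v z‖ ∂μ))
      rw [zero_mul, add_zero, add_zero] at hl
      exact ge_of_tendsto hl ((eventually_gt_atTop 0).mono hb)
    have h1 : ∫ z, ‖U i (T v z) - U i z‖ ∂μ = 0 :=
      le_antisymm h0 (integral_nonneg fun _ => norm_nonneg _)
    have h2 : Integrable (fun z => ‖U i (T v z) - U i z‖) μ := (hUT.sub (hUi i)).norm
    rw [integral_eq_zero_iff_of_nonneg (fun _ => norm_nonneg _) h2] at h1
    filter_upwards [h1] with z hz
    exact sub_eq_zero.1 (norm_eq_zero.1 hz)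
  have hℓinv : ∀ v, ∀ᵐ z ∂μ, ℓ (T v z) = ℓ z := by
    intro v
    filter_upwards [ae_all_iff.2 fun i => hUinv i v] with z hz
    simp only [ℓ, hz]
  refine ⟨ℓ, hℓm, hℓinv, hℓi, fun ε hε => ?_⟩
  refine exists_le_of_subadditive q ?_ ?_ ?_ hε
  · intro v w
    have e1 : ∫ z, ‖γ v (T w z) - ℓ (T w z) (intVec v)‖ ∂μ = q v :=
      integral_comp_of_measurePreserving (hT w) (hqi v).norm.1
    have i1 : Integrable (fun z => γ v (T w z) - ℓ (T w z) (intVec v)) μ :=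
      (hT w).integrable_comp_of_integrable (hqi v)
    rw [← e1, ← integral_add i1.norm (hqi w).norm]
    refine integral_mono_ae (hqi _).norm (i1.norm.add (hqi w).norm) ?_
    filter_upwards [hℓinv w] with z hz
    rw [hγ, map_add, map_add, hz]
    calc _ = ‖(γ v (T w z) - ℓ z (intVec v)) + (γ w z - ℓ z (intVec w))‖ := by
          congr 1; abel
      _ ≤ _ := norm_add_le _ _
  · intro v
    have e1 : ∫ z, ‖γ v (T (-v) z) - ℓ (T (-v) z) (intVec v)‖ ∂μ = q v :=
      integral_comp_of_measurePreserving (hT (-v)) (hqi v).norm.1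
    rw [← e1]
    refine integral_congr_ae ?_
    filter_upwards [hℓinv (-v), hγ0] with z hz h0
    have := hγ v (-v) z
    rw [add_neg_cancel, h0] at this
    rw [hz, eq_neg_of_add_eq_zero_right this.symm, map_neg, map_neg, ← norm_neg]
    congr 1; abel
  · intro i
    refine (hlimV i).congr' ((eventually_gt_atTop 0).mono fun n hn => ?_)
    simp only [q]
    rw [← integral_const_mul]
    refine integral_congr_ae (Eventually.of_forall fun z => ?_)
    have hn' : (n : ℝ) ≠ 0 := by positivity
    simp only
    change _ = (n : ℝ)⁻¹ * ‖γ (n • e i) z - ℓ z (intVec (n • e i))‖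
    rw [hℓe, ← abs_of_nonneg (show 0 ≤ (n : ℝ)⁻¹ by positivity), ← Real.norm_eq_abs, ← norm_smul,
      Real.norm_eq_abs, abs_of_nonneg (show 0 ≤ (n : ℝ)⁻¹ by positivity), smul_sub,
      inv_smul_smul₀ hn']

end ErgodicCocycle

section Returns

open Filter Topology Function

/-- The set of integer vectors of sup norm at most `n`. -/
noncomputable def intBox (d n : ℕ) : Finset (Fin d → ℤ) :=
  Fintype.piFinset fun _ => Finset.Icc (-n : ℤ) n

theorem mem_intBox {d n : ℕ} {v : Fin d → ℤ} : v ∈ intBox d n ↔ ‖v‖ ≤ n := by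
  rw [intBox, Fintype.mem_piFinset, pi_norm_le_iff_of_nonneg (by positivity)]
  refine forall_congr' fun i => ?_
  rw [Finset.mem_Icc, ← abs_le, Int.norm_eq_abs]
  norm_cast

theorem card_intBox (d n : ℕ) : (intBox d n).card = (2 * n + 1) ^ d := by
  rw [intBox, Fintype.card_piFinset_const, Int.card_Icc]
  congr 1
  omega

theorem card_le_of_forall_sub_le (F : Finset ℤ) (L : ℝ) (hL : 0 ≤ L)
    (h : ∀ a ∈ F, ∀ b ∈ F, (a : ℝ) - b ≤ L) : (F.card : ℝ) ≤ L + 1 := by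
  rcases F.eq_empty_or_nonempty with rfl | hF
  · simp; linarith
  · have h1 : F ⊆ Finset.Icc (F.min' hF) (F.max' hF) := fun a ha =>
      Finset.mem_Icc.2 ⟨F.min'_le a ha, F.le_max' a ha⟩
    have h2 := Finset.card_le_card h1
    rw [Int.card_Icc] at h2
    have h3 := h _ (F.max'_mem hF) _ (F.min'_mem hF)
    have h4 : F.min' hF ≤ F.max' hF := F.min'_le _ (F.max'_mem hF)
    have h5 : (F.card : ℤ) ≤ F.max' hF + 1 - F.min' hF := by omega
    have h6 : (F.card : ℝ) ≤ F.max' hF + 1 - F.min' hF := by exact_mod_cast h5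
    linarith

theorem card_slab_le {d : ℕ} (n : ℕ) (t : Fin d → ℝ) {τ s : ℝ} (hτ : 0 < τ) (hs : 0 ≤ s)
    {j : Fin d} (hj : τ ≤ |t j|) (F : Finset (Fin d → ℤ)) (hF : F ⊆ intBox d n)
    (hFs : ∀ x ∈ F, |∑ i, t i * x i| ≤ s) :
    (F.card : ℝ) * (2 * n + 1) ≤ (2 * n + 1) ^ d * (2 * s / τ + 1) := by
  classical
  have h1 : ∀ y ∈ F.image (fun x => update x j 0),
      (F.filter fun x => update x j 0 = y).card ≤ ⌊2 * s / τ + 1⌋₊ := by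
    intro y _
    refine Nat.le_floor ?_
    rw [← Finset.card_image_of_injOn (f := fun x : Fin d → ℤ => x j)]
    · refine card_le_of_forall_sub_le _ _ (by positivity) ?_
      simp only [Finset.mem_image, Finset.mem_filter]
      rintro _ ⟨x, ⟨hx, hxy⟩, rfl⟩ _ ⟨x', ⟨hx', hxy'⟩, rfl⟩
      have hne : ∀ i, i ≠ j → x i = x' i := by
        intro i hi
        have := congrFun (hxy.trans hxy'.symm) i
        simpa [hi] using this
      have h2 : t j * ((x j : ℝ) - x' j) = ∑ i, t i * x i - ∑ i, t i * x' i := by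
        rw [← Finset.sum_sub_distrib, Finset.sum_eq_single j]
        · ring
        · intro i _ hi
          rw [hne i hi]; ring
        · simp
      have h3 : |t j| * |(x j : ℝ) - x' j| ≤ 2 * s := by
        rw [← abs_mul, h2]
        have := hFs x hx
        have := hFs x' hx'
        have := abs_sub (∑ i, t i * x i) (∑ i, t i * (x' i : ℝ))
        linarith
      rw [le_div_iff₀ hτ]
      have h4 := le_abs_self ((x j : ℝ) - x' j)
      have h5 := mul_le_mul_of_nonneg_right hj (abs_nonneg ((x j : ℝ) - x' j))
      nlinarith
    · intro x hx x' hx' hxx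
      simp only [Finset.coe_filter, Set.mem_ofPred_eq] at hx hx'
      ext i
      by_cases hi : i = j
      · subst hi; exact hxx
      · have := congrFun (hx.2.trans hx'.2.symm) i
        simpa [hi] using this
  have h2 := Finset.card_le_mul_card_image (f := fun x => update x j 0) F _ h1
  have h3 : (F.image (fun x => update x j 0)).card * (2 * n + 1) ≤ (2 * n + 1) ^ d := by
    have h4 : F.image (fun x => update x j 0) ⊆
        Fintype.piFinset fun i => if i = j then {0} else Finset.Icc (-n : ℤ) n := by
      intro y hy
      obtain ⟨x, hx, rfl⟩ := Finset.mem_image.1 hy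
      rw [Fintype.mem_piFinset]
      intro i
      have := Fintype.mem_piFinset.1 (hF hx) i
      by_cases hi : i = j
      · subst hi; simp
      · simpa [hi] using this
    refine (Nat.mul_le_mul_right _ (Finset.card_le_card h4)).trans ?_
    rw [Fintype.card_piFinset, ← Finset.mul_prod_erase Finset.univ _ (Finset.mem_univ j)]
    rw [Finset.prod_congr rfl (g := fun _ => 2 * n + 1)]
    · rw [Finset.prod_const, Finset.card_erase_of_mem (Finset.mem_univ j), Finset.card_univ,
        Fintype.card_fin, if_pos rfl, Finset.card_singleton, one_mul, ← pow_succ]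
      have : 0 < d := j.pos
      rw [Nat.sub_add_cancel this]
    · intro i hi
      rw [if_neg (Finset.ne_of_mem_erase hi), Int.card_Icc]
      omega
  have h4 : (F.card : ℝ) ≤ (2 * s / τ + 1) * (F.image (fun x => update x j 0)).card := by
    have h5 : (F.card : ℝ) ≤ (⌊2 * s / τ + 1⌋₊ : ℝ) * (F.image (fun x => update x j 0)).card := by
      exact_mod_cast h2
    exact h5.trans (mul_le_mul_of_nonneg_right (Nat.floor_le (by positivity)) (by positivity))
  have h3' : ((F.image (fun x => update x j 0)).card : ℝ) * (2 * n + 1) ≤ (2 * n + 1) ^ d := by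
    exact_mod_cast h3
  calc _ ≤ (2 * s / τ + 1) * (F.image (fun x => update x j 0)).card * (2 * n + 1) :=
        mul_le_mul_of_nonneg_right h4 (by positivity)
    _ = (2 * s / τ + 1) * ((F.image (fun x => update x j 0)).card * (2 * n + 1)) := by ring
    _ ≤ (2 * s / τ + 1) * (2 * n + 1) ^ d := mul_le_mul_of_nonneg_left h3' (by positivity)
    _ = _ := by ring

variable {Z : Type*} [MeasurableSpace Z] {μ : Measure Z} {d : ℕ}

theorem exists_mul_pow_le_sum_measureReal_returns [IsFiniteMeasure μ] {T : (Fin d → ℤ) → Z → Z}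
    (hT : ∀ v, MeasurePreserving (T v) μ μ) (hTadd : ∀ v w z, T (v + w) z = T v (T w z))
    {D : Set Z} (hD : MeasurableSet D) (hDpos : μ D ≠ 0) :
    ∃ c : ℝ, 0 < c ∧ ∀ n : ℕ,
      c * (n : ℝ) ^ d ≤ ∑ v ∈ intBox d n, μ.real (D ∩ T v ⁻¹' D) := by
  have hDr : 0 < μ.real D := by
    rw [measureReal_def]
    exact ENNReal.toReal_pos hDpos (measure_ne_top _ _)
  have hZr : 0 < μ.real Set.univ := hDr.trans_le (measureReal_mono (Set.subset_univ _))
  refine ⟨μ.real D ^ 2 / μ.real Set.univ, by positivity, fun n => ?_⟩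
  let Q : Finset (Fin d → ℤ) := Fintype.piFinset fun _ => Finset.Icc (0 : ℤ) n
  have hQcard : Q.card = (n + 1) ^ d := by
    simp only [Q]
    rw [Fintype.card_piFinset_const, Int.card_Icc]
    congr 1
  have hm : ∀ v, MeasurableSet (T v ⁻¹' D) := fun v => (hT v).measurable hD
  let f : Z → ℝ := fun z => ∑ v ∈ Q, (T v ⁻¹' D).indicator 1 z
  have hi : ∀ s : Set Z, MeasurableSet s → Integrable (s.indicator (1 : Z → ℝ)) μ := fun s hs =>
    (integrable_const (1 : ℝ)).indicator hs
  have hf1 : ∫ z, f z ∂μ = Q.card * μ.real D := by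
    simp only [f]
    rw [integral_finsetSum _ fun v _ => hi _ (hm v)]
    rw [Finset.sum_congr rfl (g := fun _ => μ.real D)]
    · simp
    · intro v _
      rw [integral_indicator_one (hm v)]
      rw [measureReal_def, (hT v).measure_preimage hD.nullMeasurableSet, measureReal_def]
  have hff : ∀ z, f z ^ 2 =
      ∑ v ∈ Q, ∑ v' ∈ Q, (T v ⁻¹' D ∩ T v' ⁻¹' D).indicator (1 : Z → ℝ) z := by
    intro z
    rw [sq, Finset.sum_mul_sum]
    refine Finset.sum_congr rfl fun v _ => Finset.sum_congr rfl fun v' _ => ?_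
    rw [Set.inter_indicator_one]
    rfl
  have hf2i : Integrable (fun z => f z ^ 2) μ := by
    simp only [hff]
    exact integrable_finsetSum _ fun v _ => integrable_finsetSum _ fun v' _ =>
      hi _ ((hm v).inter (hm v'))
  have hfi : Integrable f μ := integrable_finsetSum _ fun v _ => hi _ (hm v)
  have hf2 : ∫ z, f z ^ 2 ∂μ ≤ Q.card * ∑ v ∈ intBox d n, μ.real (D ∩ T v ⁻¹' D) := by
    simp only [hff]
    rw [integral_finsetSum _ fun v _ => integrable_finsetSum _ fun v' _ =>
      hi _ ((hm v).inter (hm v'))]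
    rw [← nsmul_eq_mul]
    refine Finset.sum_le_card_nsmul _ _ _ fun v hv => ?_
    rw [integral_finsetSum _ fun v' _ => hi _ ((hm v).inter (hm v'))]
    have h1 : ∀ v' ∈ Q, ∫ z, (T v ⁻¹' D ∩ T v' ⁻¹' D).indicator (1 : Z → ℝ) z ∂μ =
        μ.real (D ∩ T (v' - v) ⁻¹' D) := by
      intro v' _
      rw [integral_indicator_one ((hm v).inter (hm v')), measureReal_def, measureReal_def,
        ← (hT v).measure_preimage (hD.inter (hm (v' - v))).nullMeasurableSet]
      congr 2
      ext z
      simp only [Set.mem_inter_iff, Set.mem_preimage, ← hTadd, sub_add_cancel]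
    rw [Finset.sum_congr rfl h1]
    rw [← Finset.sum_image (s := Q) (g := fun v' => v' - v)
      (f := fun u => μ.real (D ∩ T u ⁻¹' D)) (fun a _ b _ h => sub_left_injective h)]
    refine Finset.sum_le_sum_of_subset_of_nonneg ?_ fun _ _ _ => measureReal_nonneg
    intro u hu
    obtain ⟨v', hv', rfl⟩ := Finset.mem_image.1 hu
    refine Fintype.mem_piFinset.2 fun i => ?_
    have h2 := Finset.mem_Icc.1 (Fintype.mem_piFinset.1 hv i)
    have h3 := Finset.mem_Icc.1 (Fintype.mem_piFinset.1 hv' i)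
    rw [Finset.mem_Icc, Pi.sub_apply]
    constructor <;> linarith [h2.1, h2.2, h3.1, h3.2]
  set S := ∑ v ∈ intBox d n, μ.real (D ∩ T v ⁻¹' D)
  have hQ0 : (0 : ℝ) < Q.card := by rw [hQcard]; positivity
  set a : ℝ := Q.card * μ.real D / μ.real Set.univ with ha
  have hCS : 0 ≤ ∫ z, (f z - a) ^ 2 ∂μ := integral_nonneg fun z => sq_nonneg _
  have e1 : ∫ z, (f z - a) ^ 2 ∂μ =
      ∫ z, f z ^ 2 ∂μ - 2 * a * ∫ z, f z ∂μ + a ^ 2 * μ.real Set.univ := by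
    have i1 : Integrable (fun z => 2 * a * f z) μ := hfi.const_mul _
    have i2 : Integrable (fun z => f z ^ 2 - 2 * a * f z) μ := hf2i.sub i1
    rw [← integral_const_mul, ← integral_sub hf2i i1]
    have e2 : a ^ 2 * μ.real Set.univ = ∫ _, a ^ 2 ∂μ := by simp [mul_comm]
    rw [e2, ← integral_add i2 (integrable_const _)]
    congr 1
    ext z
    ring
  rw [e1, hf1] at hCS
  have e3 : 2 * a * (Q.card * μ.real D) - a ^ 2 * μ.real Set.univ =
      Q.card * (Q.card * (μ.real D ^ 2 / μ.real Set.univ)) := by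
    rw [ha]; field_simp; ring
  have h4 : (Q.card : ℝ) * (Q.card * (μ.real D ^ 2 / μ.real Set.univ)) ≤ Q.card * S := by
    linarith
  have h5 := le_of_mul_le_mul_left h4 hQ0
  refine le_trans ?_ h5
  rw [mul_comm]
  refine mul_le_mul_of_nonneg_right ?_ (by positivity)
  rw [hQcard]
  push_cast
  gcongr
  linarith

set_option maxHeartbeats 1000000 in
/-- A set all of whose return times are, up to small errors, mapped injectively to slabs is
null. -/
theorem measure_eq_zero_of_slab_returns [IsFiniteMeasure μ] {T : (Fin d → ℤ) → Z → Z}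
    (hT : ∀ v, MeasurePreserving (T v) μ μ) (hTadd : ∀ v w z, T (v + w) z = T v (T w z))
    {D : Set Z} (hD : MeasurableSet D) (x w : (Fin d → ℤ) → Z → (Fin d → ℤ))
    (e₁ e₂ : (Fin d → ℤ) → Z → ℝ) (he₁0 : ∀ v z, 0 ≤ e₁ v z) (he₂0 : ∀ v z, 0 ≤ e₂ v z)
    (he₁i : ∀ v, IntegrableOn (e₁ v) D μ) (he₂i : ∀ v, IntegrableOn (e₂ v) D μ)
    (he₁ : ∀ ε : ℝ, 0 < ε → ∃ C, 0 ≤ C ∧ ∀ v, ∫ z in D, e₁ v z ∂μ ≤ ε * ‖v‖ + C)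
    (he₂ : ∀ ε : ℝ, 0 < ε → ∃ C, 0 ≤ C ∧ ∀ v, ∫ z in D, e₂ v z ∂μ ≤ ε * ‖v‖ + C)
    {R K τ : ℝ} (hR : 0 ≤ R) (hτ : 0 < τ)
    (h : ∀ᵐ z ∂μ, z ∈ D →
      (∀ v v', T v z ∈ D → T v' z ∈ D → x v z = x v' z → v = v') ∧
      (∀ v v', T v z ∈ D → T v' z ∈ D → w v z = w v' z → v = v') ∧
      ∃ t : Fin d → ℝ, (∃ j, τ ≤ |t j|) ∧ ∀ v, T v z ∈ D →
        ‖x v z‖ ≤ R * ‖v‖ + e₁ v z ∧ ‖w v z‖ ≤ R * ‖v‖ + e₁ v z ∧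
        |∑ j, t j * x v z j| ≤ e₁ v z + e₂ (w v z) z + K) : μ D = 0 := by
  classical
  by_contra hDpos
  obtain ⟨c, hc, hret⟩ := exists_mul_pow_le_sum_measureReal_returns hT hTadd hD hDpos
  obtain ⟨k, hk⟩ := exists_nat_ge (R + 1)
  have hk1 : 1 ≤ k := by
    have : (1 : ℝ) ≤ k := by linarith
    exact_mod_cast this
  have hk1' : (1 : ℝ) ≤ k := by exact_mod_cast hk1
  set P : ℝ := (3 * k) ^ d with hP
  have hP0 : 0 < P := by positivity
  set M : ℝ := μ.real D
  have hM : 0 ≤ M := measureReal_nonneg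
  set η : ℝ := min 1 (c * τ / (28 * P * (M + 1))) with hη
  have hη0 : 0 < η := lt_min one_pos (by positivity)
  have hη1 : η ≤ 1 := min_le_left _ _
  have hη2 : M * P * (7 * η / τ) ≤ c / 4 := by
    have h1 : η ≤ c * τ / (28 * P * (M + 1)) := min_le_right _ _
    rw [le_div_iff₀ (by positivity)] at h1
    rw [← mul_div_assoc, div_le_iff₀ hτ]
    nlinarith [mul_pos hP0 hη0]
  set ε : ℝ := c * η / (4 * P * (k + 3)) with hε
  have hε0 : 0 < ε := by positivity
  have hε1 : P * ((k + 3) * ε / η) = c / 4 := by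
    rw [hε]; field_simp
  obtain ⟨C₁, hC₁0, hC₁⟩ := he₁ ε hε0
  obtain ⟨C₂, hC₂0, hC₂⟩ := he₂ ε hε0
  obtain ⟨n, hn⟩ := exists_nat_ge (1 + C₁ / ε + C₂ / ε + |K| / η + τ / η)
  have hn1 : (1 : ℝ) ≤ n := by
    have : 0 ≤ C₁ / ε := by positivity
    have : 0 ≤ C₂ / ε := by positivity
    have : 0 ≤ |K| / η := by positivity
    have : 0 ≤ τ / η := by positivity
    linarith
  have hnpos : (0 : ℝ) < n := by linarith
  have hnC₁ : C₁ ≤ ε * n := by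
    have h1 : C₁ / ε ≤ n := by
      have : 0 ≤ C₂ / ε := by positivity
      have : 0 ≤ |K| / η := by positivity
      have : 0 ≤ τ / η := by positivity
      linarith
    rw [div_le_iff₀ hε0] at h1
    linarith
  have hnC₂ : C₂ ≤ ε * n := by
    have h1 : C₂ / ε ≤ n := by
      have : 0 ≤ C₁ / ε := by positivity
      have : 0 ≤ |K| / η := by positivity
      have : 0 ≤ τ / η := by positivity
      linarith
    rw [div_le_iff₀ hε0] at h1
    linarith
  have hnK : K ≤ η * n := by
    have h1 : |K| / η ≤ n := by
      have : 0 ≤ C₁ / ε := by positivity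
      have : 0 ≤ C₂ / ε := by positivity
      have : 0 ≤ τ / η := by positivity
      linarith
    rw [div_le_iff₀ hη0] at h1
    linarith [le_abs_self K]
  have hnτ : τ ≤ η * n := by
    have h1 : τ / η ≤ n := by
      have : 0 ≤ C₁ / ε := by positivity
      have : 0 ≤ C₂ / ε := by positivity
      have : 0 ≤ |K| / η := by positivity
      linarith
    rw [div_le_iff₀ hη0] at h1
    linarith
  set s : ℝ := 3 * (η * n) with hs
  have hs0 : 0 ≤ s := by positivity
  set N : ℝ := (2 * ((k * n : ℕ) : ℝ) + 1) with hN
  have hN0 : 0 < N := by positivity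
  have hkn : (n : ℝ) ≤ k * n := le_mul_of_one_le_left hnpos.le hk1'
  have hnN : (n : ℝ) ≤ N := by rw [hN]; push_cast; linarith
  set B : ℝ := N ^ d * (2 * s / τ + 1) / N with hB
  let Φ : Z → ℝ := fun z => (∑ v ∈ intBox d n, e₁ v z / (η * n)) +
    (∑ u ∈ intBox d (k * n), e₂ u z / (η * n)) + B
  have hpt : ∀ᵐ z ∂μ, z ∈ D → ∑ v ∈ intBox d n, (T v ⁻¹' D).indicator (1 : Z → ℝ) z ≤ Φ z := by
    filter_upwards [h] with z hz hzD
    obtain ⟨hx, hw, t, ⟨j, hj⟩, ht⟩ := hz hzD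
    let Rt := (intBox d n).filter fun v => T v z ∈ D
    let R1 := Rt.filter fun v => η * n < e₁ v z
    let R2 := Rt.filter fun v => e₁ v z ≤ η * n ∧ η * n < e₂ (w v z) z
    let R3 := Rt.filter fun v => e₁ v z ≤ η * n ∧ e₂ (w v z) z ≤ η * n
    have hcount : ∑ v ∈ intBox d n, (T v ⁻¹' D).indicator (1 : Z → ℝ) z = Rt.card := by
      simp only [Set.indicator_apply, Set.mem_preimage, Pi.one_apply, Rt]
      rw [Finset.sum_boole]
    have hsub : Rt ⊆ R1 ∪ R2 ∪ R3 := by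
      intro v hv
      simp only [R1, R2, R3, Finset.mem_union, Finset.mem_filter, hv, true_and]
      by_cases h1 : η * n < e₁ v z
      · simp [h1]
      · by_cases h2 : η * n < e₂ (w v z) z
        · simp [h2, not_lt.1 h1]
        · simp [not_lt.1 h2, not_lt.1 h1]
    have hcard : (Rt.card : ℝ) ≤ R1.card + R2.card + R3.card := by
      have h1 := Finset.card_le_card hsub
      have h2 := Finset.card_union_le (R1 ∪ R2) R3
      have h3 := Finset.card_union_le R1 R2
      exact_mod_cast h1.trans (h2.trans (Nat.add_le_add_right h3 _))
    have hηn : 0 < η * n := by positivity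
    have hmemD : ∀ v ∈ Rt, T v z ∈ D := fun v hv => (Finset.mem_filter.1 hv).2
    have hmemn : ∀ v ∈ Rt, ‖v‖ ≤ n := fun v hv => mem_intBox.1 (Finset.mem_filter.1 hv).1
    have hbox : ∀ v ∈ Rt, ∀ y : Fin d → ℤ, ‖y‖ ≤ R * ‖v‖ + e₁ v z → e₁ v z ≤ η * n →
        y ∈ intBox d (k * n) := by
      intro v hv y hy he
      refine mem_intBox.2 ?_
      push_cast
      have h1 := mul_le_mul_of_nonneg_left (hmemn v hv) hR
      have h2 : η * n ≤ 1 * n := mul_le_mul_of_nonneg_right hη1 hnpos.le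
      have h3 := mul_le_mul_of_nonneg_right hk hnpos.le
      linarith
    have c1 : (R1.card : ℝ) ≤ ∑ v ∈ intBox d n, e₁ v z / (η * n) := by
      calc (R1.card : ℝ) = ∑ v ∈ R1, (1 : ℝ) := by simp
        _ ≤ ∑ v ∈ R1, e₁ v z / (η * n) := Finset.sum_le_sum fun v hv => by
            rw [le_div_iff₀ hηn, one_mul]
            exact (Finset.mem_filter.1 hv).2.le
        _ ≤ _ := Finset.sum_le_sum_of_subset_of_nonneg
            ((Finset.filter_subset _ _).trans (Finset.filter_subset _ _))
            fun v _ _ => div_nonneg (he₁0 v z) hηn.le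
    have c2 : (R2.card : ℝ) ≤ ∑ u ∈ intBox d (k * n), e₂ u z / (η * n) := by
      have hinj : Set.InjOn (fun v => w v z) R2 := fun v hv v' hv' hvv =>
        hw v v' (hmemD v (Finset.mem_filter.1 hv).1) (hmemD v' (Finset.mem_filter.1 hv').1) hvv
      rw [← Finset.card_image_of_injOn hinj]
      calc ((R2.image fun v => w v z).card : ℝ) = ∑ u ∈ R2.image fun v => w v z, (1 : ℝ) := by simp
        _ ≤ ∑ u ∈ R2.image fun v => w v z, e₂ u z / (η * n) := Finset.sum_le_sum fun u hu => by
            obtain ⟨v, hv, rfl⟩ := Finset.mem_image.1 hu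
            rw [le_div_iff₀ hηn, one_mul]
            exact (Finset.mem_filter.1 hv).2.2.le
        _ ≤ _ := Finset.sum_le_sum_of_subset_of_nonneg (fun u hu => by
            obtain ⟨v, hv, rfl⟩ := Finset.mem_image.1 hu
            have hv1 := (Finset.mem_filter.1 hv)
            exact hbox v hv1.1 _ (ht v (hmemD v hv1.1)).2.1 hv1.2.1)
            fun v _ _ => div_nonneg (he₂0 v z) hηn.le
    have c3 : (R3.card : ℝ) ≤ B := by
      have hinj : Set.InjOn (fun v => x v z) R3 := fun v hv v' hv' hvv =>
        hx v v' (hmemD v (Finset.mem_filter.1 hv).1) (hmemD v' (Finset.mem_filter.1 hv').1) hvv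
      rw [← Finset.card_image_of_injOn hinj, hB, le_div_iff₀ hN0]
      refine card_slab_le (k * n) t hτ hs0 hj _ ?_ ?_
      · intro u hu
        obtain ⟨v, hv, rfl⟩ := Finset.mem_image.1 hu
        have hv1 := (Finset.mem_filter.1 hv)
        exact hbox v hv1.1 _ (ht v (hmemD v hv1.1)).1 hv1.2.1
      · intro u hu
        obtain ⟨v, hv, rfl⟩ := Finset.mem_image.1 hu
        have hv1 := (Finset.mem_filter.1 hv)
        have := (ht v (hmemD v hv1.1)).2.2
        have := hv1.2.1
        have := hv1.2.2
        rw [hs]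
        linarith
    rw [hcount]
    simp only [Φ]
    linarith
  have hind : ∀ v, IntegrableOn ((T v ⁻¹' D).indicator (1 : Z → ℝ)) D μ := fun v =>
    ((integrable_const (1 : ℝ)).indicator ((hT v).measurable hD)).integrableOn
  have hi₁ : Integrable (fun z => ∑ v ∈ intBox d n, e₁ v z / (η * n)) (μ.restrict D) :=
    integrable_finsetSum _ fun v _ => (he₁i v).div_const _
  have hi₂ : Integrable (fun z => ∑ v ∈ intBox d (k * n), e₂ v z / (η * n)) (μ.restrict D) :=
    integrable_finsetSum _ fun v _ => (he₂i v).div_const _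
  have hint : ∑ v ∈ intBox d n, μ.real (D ∩ T v ⁻¹' D) ≤ ∫ z in D, Φ z ∂μ := by
    have e : ∑ v ∈ intBox d n, μ.real (D ∩ T v ⁻¹' D) =
        ∫ z in D, ∑ v ∈ intBox d n, (T v ⁻¹' D).indicator (1 : Z → ℝ) z ∂μ := by
      rw [integral_finsetSum _ fun v _ => hind v]
      refine Finset.sum_congr rfl fun v _ => ?_
      rw [integral_indicator_one ((hT v).measurable hD),
        measureReal_restrict_apply ((hT v).measurable hD), Set.inter_comm]
    rw [e]
    refine setIntegral_mono_ae_restrict (integrable_finsetSum _ fun v _ => hind v)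
      ((hi₁.add hi₂).add (integrable_const _)) ?_
    exact (ae_restrict_iff' hD).2 hpt
  have hΦ : ∫ z in D, Φ z ∂μ = (∑ v ∈ intBox d n, (∫ z in D, e₁ v z ∂μ) / (η * n)) +
      (∑ u ∈ intBox d (k * n), (∫ z in D, e₂ u z ∂μ) / (η * n)) + M * B := by
    have hi₁₂ : Integrable (fun z => (∑ v ∈ intBox d n, e₁ v z / (η * n)) +
      ∑ v ∈ intBox d (k * n), e₂ v z / (η * n)) (μ.restrict D) := hi₁.add hi₂
    simp only [Φ]
    rw [integral_add hi₁₂ (integrable_const _), integral_add hi₁ hi₂,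
      integral_finsetSum _ fun v _ => (he₁i v).div_const _,
      integral_finsetSum _ fun v _ => (he₂i v).div_const _]
    simp only [integral_div, integral_const, smul_eq_mul, measureReal_restrict_apply_univ, M]
  have hb₁ : ∑ v ∈ intBox d n, (∫ z in D, e₁ v z ∂μ) / (η * n) ≤
      P * (n : ℝ) ^ d * (2 * ε / η) := by
    calc _ ≤ ∑ v ∈ intBox d n, 2 * ε / η := Finset.sum_le_sum fun v hv => by
          rw [div_le_div_iff₀ (by positivity) hη0]
          have h1 := hC₁ v
          have h2 := mul_le_mul_of_nonneg_left (mem_intBox.1 hv) hε0.le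
          have h3 : ∫ z in D, e₁ v z ∂μ ≤ 2 * ε * n := by linarith
          calc _ ≤ 2 * ε * n * η := mul_le_mul_of_nonneg_right h3 hη0.le
            _ = _ := by ring
      _ = (2 * n + 1) ^ d * (2 * ε / η) := by
          rw [Finset.sum_const, card_intBox, nsmul_eq_mul]; push_cast; ring
      _ ≤ _ := by
          refine mul_le_mul_of_nonneg_right ?_ (by positivity)
          rw [hP, ← mul_pow]
          refine pow_le_pow_left₀ (by positivity) ?_ _
          nlinarith
  have hNle : N ^ d ≤ P * (n : ℝ) ^ d := by
    rw [hP, ← mul_pow]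
    refine pow_le_pow_left₀ (by positivity) ?_ _
    rw [hN]; push_cast
    linarith
  have hb₂ : ∑ u ∈ intBox d (k * n), (∫ z in D, e₂ u z ∂μ) / (η * n) ≤
      P * (n : ℝ) ^ d * ((k + 1) * ε / η) := by
    calc _ ≤ ∑ v ∈ intBox d (k * n), (k + 1) * ε / η := Finset.sum_le_sum fun v hv => by
          rw [div_le_div_iff₀ (by positivity) hη0]
          have h1 := hC₂ v
          have h2 := mul_le_mul_of_nonneg_left (mem_intBox.1 hv) hε0.le
          push_cast at h2
          have h3 : ∫ z in D, e₂ v z ∂μ ≤ (k + 1) * ε * n := by linarith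
          calc _ ≤ (k + 1) * ε * n * η := mul_le_mul_of_nonneg_right h3 hη0.le
            _ = _ := by ring
      _ = N ^ d * ((k + 1) * ε / η) := by
          rw [Finset.sum_const, card_intBox, nsmul_eq_mul, hN]; push_cast; ring
      _ ≤ _ := mul_le_mul_of_nonneg_right hNle (by positivity)
  have hb₃ : M * B ≤ (n : ℝ) ^ d * (M * P * (7 * η / τ)) := by
    have h1 : B ≤ P * (n : ℝ) ^ d * (7 * η / τ) := by
      rw [hB, div_le_iff₀ hN0]
      have h2 : 2 * s / τ + 1 ≤ 7 * η / τ * N := by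
        have h3 : 2 * s / τ + 1 ≤ 7 * η / τ * n := by
          rw [div_add_one hτ.ne', div_mul_eq_mul_div, div_le_div_iff_of_pos_right hτ, hs]
          linarith
        exact h3.trans (mul_le_mul_of_nonneg_left hnN (by positivity))
      calc N ^ d * (2 * s / τ + 1) ≤ (P * (n : ℝ) ^ d) * (7 * η / τ * N) :=
            mul_le_mul hNle h2 (by positivity) (by positivity)
        _ = _ := by ring
    calc M * B ≤ M * (P * (n : ℝ) ^ d * (7 * η / τ)) := mul_le_mul_of_nonneg_left h1 hM
      _ = _ := by ring
  have htot := (hret n).trans hint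
  rw [hΦ] at htot
  have e1 : P * (n : ℝ) ^ d * (2 * ε / η) + P * (n : ℝ) ^ d * ((k + 1) * ε / η) =
      (n : ℝ) ^ d * (P * ((k + 3) * ε / η)) := by ring
  have h1 : c * (n : ℝ) ^ d ≤ (n : ℝ) ^ d * (c / 4) + (n : ℝ) ^ d * (c / 4) := by
    have h2 := mul_le_mul_of_nonneg_left hη2 (show 0 ≤ (n : ℝ) ^ d by positivity)
    rw [hε1] at e1
    linarith
  have h2 : 0 < c * (n : ℝ) ^ d := by positivity
  linarith

end Returns

section Coupling

open Filter Topology Function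

/-- If a map is given piecewise by measure preserving maps which exchange two countable measurable
partitions of a set, then it preserves the restricted measure. -/
theorem measurePreserving_restrict_of_pieces {Ω J : Type*} [MeasurableSpace Ω] {m : Measure Ω}
    [Countable J] [MeasurableSpace J] [DiscreteMeasurableSpace J] {D : Set Ω}
    (hD : MeasurableSet D) {i i' : Ω → J} (hi : Measurable i) (hi' : Measurable i')
    {φ : J → Ω → Ω} (hφ : ∀ j, MeasurePreserving (φ j) m m)
    (h : ∀ j ω, (ω ∈ D ∧ i ω = j) ↔ (φ j ω ∈ D ∧ i' (φ j ω) = j)) :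
    MeasurePreserving (fun ω => φ (i ω) ω) (m.restrict D) (m.restrict D) := by
  have hm : Measurable fun ω => φ (i ω) ω :=
    (measurable_from_prod_countable_right fun j => (hφ j).measurable :
      Measurable fun p : J × Ω => φ p.1 p.2).comp (hi.prodMk measurable_id)
  refine ⟨hm, Measure.ext fun s hs => ?_⟩
  rw [Measure.map_apply hm hs, Measure.restrict_apply (hm hs), Measure.restrict_apply hs]
  have e1 : (fun ω => φ (i ω) ω) ⁻¹' s ∩ D = ⋃ j, φ j ⁻¹' ((s ∩ D) ∩ i' ⁻¹' {j}) := by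
    ext ω
    simp only [Set.mem_inter_iff, Set.mem_preimage, Set.mem_iUnion, Set.mem_singleton_iff]
    constructor
    · rintro ⟨h1, h2⟩
      have := (h (i ω) ω).1 ⟨h2, rfl⟩
      exact ⟨i ω, ⟨h1, this.1⟩, this.2⟩
    · rintro ⟨j, ⟨h1, h2⟩, h3⟩
      obtain ⟨h4, rfl⟩ := (h j ω).2 ⟨h2, h3⟩
      exact ⟨h1, h4⟩
  have e2 : s ∩ D = ⋃ j, (s ∩ D) ∩ i' ⁻¹' {j} := by
    rw [← Set.inter_iUnion]
    ext ω
    simp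
  have hms : ∀ j, MeasurableSet ((s ∩ D) ∩ i' ⁻¹' {j}) := fun j =>
    (hs.inter hD).inter (hi' (measurableSet_singleton j))
  rw [e1]
  conv_rhs => rw [e2]
  rw [measure_iUnion _ fun j => (hφ j).measurable (hms j), measure_iUnion _ hms]
  · exact tsum_congr fun j => (hφ j).measure_preimage (hms j).nullMeasurableSet
  · intro j j' hj
    refine Set.disjoint_left.2 ?_
    rintro ω ⟨_, h1⟩ ⟨_, h2⟩
    exact hj (h1.symm.trans h2)
  · intro j j' hj
    refine Set.disjoint_left.2 ?_
    rintro ω ⟨⟨_, h1⟩, h2⟩ ⟨⟨_, h3⟩, h4⟩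
    exact hj (((h j ω).2 ⟨h1, h2⟩).2.symm.trans ((h j' ω).2 ⟨h3, h4⟩).2)

/-- A measure coupling of `G` and `ℤ^d` in which the defining identities hold everywhere. The maps
`a` and `b` send a point to the element moving it to the fundamental domain `{a = 1}`, respectively
`{b = 0}`. -/
structure StrictCoupling (G : Type*) [Group G] [MeasurableSpace G] (d : ℕ) {Ω : Type*}
    [MeasurableSpace Ω] (m : Measure Ω) where
  /-- the action of `G` -/
  A : G → Ω → Ω
  /-- the action of `ℤ^d` -/
  B : (Fin d → ℤ) → Ω → Ω
  /-- the element moving a point to the fundamental domain of `G` -/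
  a : Ω → G
  /-- the element moving a point to the fundamental domain of `ℤ^d` -/
  b : Ω → (Fin d → ℤ)
  A_one : ∀ ω, A 1 ω = ω
  A_mul : ∀ g h ω, A (g * h) ω = A g (A h ω)
  B_zero : ∀ ω, B 0 ω = ω
  B_add : ∀ v w ω, B (v + w) ω = B v (B w ω)
  comm : ∀ g v ω, A g (B v ω) = B v (A g ω)
  mpA : ∀ g, MeasurePreserving (A g) m m
  mpB : ∀ v, MeasurePreserving (B v) m m
  measurable_a : Measurable a
  measurable_b : Measurable b
  a_A : ∀ g ω, a (A g ω) = a ω * g⁻¹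
  b_B : ∀ v ω, b (B v ω) = b ω - v
  finite_Y : m (a ⁻¹' {1}) < ⊤
  finite_X : m (b ⁻¹' {0}) < ⊤

namespace StrictCoupling

variable {G : Type*} [Group G] [MeasurableSpace G] {d : ℕ} {Ω : Type*}
    [MeasurableSpace Ω] {m : Measure Ω} (Q : StrictCoupling G d m)

/-- the restriction of the measure to the fundamental domain of `ℤ^d` -/
noncomputable def mX : Measure Ω := m.restrict (Q.b ⁻¹' {0})

/-- the restriction of the measure to the fundamental domain of `G` -/
noncomputable def mY : Measure Ω := m.restrict (Q.a ⁻¹' {1})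

/-- the induced action of `G` on the fundamental domain of `ℤ^d` -/
def S (g : G) (ω : Ω) : Ω := Q.B (Q.b (Q.A g ω)) (Q.A g ω)

/-- the induced action of `ℤ^d` on the fundamental domain of `G` -/
def τ (v : Fin d → ℤ) (ω : Ω) : Ω := Q.A (Q.a (Q.B v ω)) (Q.B v ω)

/-- the cocycle of the skew product action -/
def γ (v : Fin d → ℤ) (z : Ω × Ω) : Fin d → ℤ := Q.b (Q.A (Q.a (Q.B v z.1)) z.2)

instance : IsFiniteMeasure Q.mX := ⟨by rw [mX, Measure.restrict_apply_univ]; exact Q.finite_X⟩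

instance : IsFiniteMeasure Q.mY := ⟨by rw [mY, Measure.restrict_apply_univ]; exact Q.finite_Y⟩

theorem a_B_add (v w : Fin d → ℤ) (ω : Ω) :
    Q.a (Q.B v (Q.τ w ω)) = Q.a (Q.B (v + w) ω) * (Q.a (Q.B w ω))⁻¹ := by
  rw [τ, ← Q.comm, ← Q.B_add, Q.a_A]

theorem τ_add (v w : Fin d → ℤ) (ω : Ω) : Q.τ (v + w) ω = Q.τ v (Q.τ w ω) := by
  rw [τ, τ, Q.a_B_add, Q.A_mul, τ, ← Q.comm, ← Q.B_add, ← Q.A_mul (Q.a (Q.B w ω))⁻¹,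
    inv_mul_cancel, Q.A_one]

theorem b_A_S (g h : G) (ω : Ω) :
    Q.b (Q.A g (Q.S h ω)) = Q.b (Q.A (g * h) ω) - Q.b (Q.A h ω) := by
  rw [S, Q.comm, ← Q.A_mul, Q.b_B]

theorem S_mul (g h : G) (ω : Ω) : Q.S (g * h) ω = Q.S g (Q.S h ω) := by
  rw [S, S, Q.b_A_S, S, Q.comm, ← Q.A_mul, ← Q.B_add, sub_add_cancel]

theorem ae_mX : ∀ᵐ x ∂Q.mX, Q.b x = 0 :=
  ae_restrict_mem (Q.measurable_b (measurableSet_singleton _))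

theorem γ_add (v w : Fin d → ℤ) (z : Ω × Ω) :
    Q.γ (v + w) z = Q.γ v (Q.τ w z.1, Q.S (Q.a (Q.B w z.1)) z.2) + Q.γ w z := by
  simp only [γ]
  rw [Q.a_B_add, Q.b_A_S, inv_mul_cancel_right, sub_add_cancel]

theorem S_one {x : Ω} (hx : Q.b x = 0) : Q.S 1 x = x := by
  rw [S, Q.A_one, hx, Q.B_zero]

theorem τ_zero {y : Ω} (hy : Q.a y = 1) : Q.τ 0 y = y := by
  rw [τ, Q.B_zero, hy, Q.A_one]

theorem measurePreserving_S (g : G) : MeasurePreserving (Q.S g) Q.mX Q.mX := by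
  refine measurePreserving_restrict_of_pieces (Q.measurable_b (measurableSet_singleton _))
    (i := fun ω => Q.b (Q.A g ω)) (i' := fun ω => -Q.b (Q.A g⁻¹ ω))
    (φ := fun w ω => Q.B w (Q.A g ω)) (Q.measurable_b.comp (Q.mpA g).measurable)
    (Q.measurable_b.comp (Q.mpA g⁻¹).measurable).neg
    (fun w => (Q.mpB w).comp (Q.mpA g)) fun w ω => ?_
  simp only [Set.mem_preimage, Set.mem_singleton_iff, Q.b_B, Q.comm, ← Q.A_mul, inv_mul_cancel,
    Q.A_one, neg_sub, sub_eq_self, sub_eq_zero]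
  tauto

/-- the skew product action of `ℤ^d` associated with an action of `G` -/
def skew {P : Type*} (U : G → P → P) (v : Fin d → ℤ) (z : Ω × P) : Ω × P :=
  (Q.τ v z.1, U (Q.a (Q.B v z.1)) z.2)


theorem skew_add {P : Type*} {U : G → P → P} (hU : ∀ g h p, U (g * h) p = U g (U h p))
    (v w : Fin d → ℤ) (z : Ω × P) : Q.skew U (v + w) z = Q.skew U v (Q.skew U w z) := by
  simp only [skew]
  rw [Q.τ_add, Q.a_B_add, ← hU, inv_mul_cancel_right]

theorem measurable_a_B (v : Fin d → ℤ) : Measurable fun ω => Q.a (Q.B v ω) :=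
  Q.measurable_a.comp (Q.mpB v).measurable

theorem mX_ne_zero (hm : m ≠ 0) : Q.mX ≠ 0 := by
  intro h
  rw [mX, Measure.restrict_eq_zero] at h
  refine hm (Measure.measure_univ_eq_zero.1 (measure_mono_null (t := ⋃ v, Q.B v ⁻¹' (Q.b ⁻¹' {0}))
    (fun ω _ => Set.mem_iUnion.2 ⟨Q.b ω, ?_⟩) (measure_iUnion_null fun v => ?_)))
  · simp [Q.b_B]
  · rw [(Q.mpB v).measure_preimage (Q.measurable_b (measurableSet_singleton _)).nullMeasurableSet,
      h]

theorem integral_norm_b_mul (hb : ∀ g, Integrable (fun x => intVec (Q.b (Q.A g x))) Q.mX)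
    (g h : G) :
    ∫ x, ‖intVec (Q.b (Q.A (g * h) x))‖ ∂Q.mX ≤
      ∫ x, ‖intVec (Q.b (Q.A g x))‖ ∂Q.mX + ∫ x, ‖intVec (Q.b (Q.A h x))‖ ∂Q.mX := by
  have e1 := integral_comp_of_measurePreserving (Q.measurePreserving_S h)
    (hb g).norm.aestronglyMeasurable
  have i1 : Integrable (fun x => ‖intVec (Q.b (Q.A g (Q.S h x)))‖) Q.mX :=
    (Q.measurePreserving_S h).integrable_comp_of_integrable (hb g).norm
  rw [← e1, ← integral_add i1 (hb h).norm]
  refine integral_mono (hb (g * h)).norm (i1.add (hb h).norm) fun x => ?_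
  have : intVec (Q.b (Q.A (g * h) x)) =
      intVec (Q.b (Q.A g (Q.S h x))) + intVec (Q.b (Q.A h x)) := by
    rw [Q.b_A_S, map_sub, sub_add_cancel]
  simp only [this]
  exact norm_add_le _ _

variable {SG : Set G}

theorem exists_integral_norm_b_le (hSfin : SG.Finite) (hSsymm : ∀ s ∈ SG, s⁻¹ ∈ SG)
    (hSgen : Subgroup.closure SG = ⊤)
    (hb : ∀ g, Integrable (fun x => intVec (Q.b (Q.A g x))) Q.mX) :
    ∃ C, 0 ≤ C ∧ ∀ g, ∫ x, ‖intVec (Q.b (Q.A g x))‖ ∂Q.mX ≤ C * wlen SG g := by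
  refine le_mul_wlen hSfin hSsymm hSgen _ ?_ (Q.integral_norm_b_mul hb)
  refine (integral_eq_zero_of_ae ?_).le
  filter_upwards [Q.ae_mX] with x hx
  simp [Q.A_one, hx]

variable [DiscreteMeasurableSpace G]

theorem ae_mY : ∀ᵐ x ∂Q.mY, Q.a x = 1 :=
  ae_restrict_mem (Q.measurable_a (measurableSet_singleton _))

theorem ae_skew_zero {P : Type*} [MeasurableSpace P] {ν : Measure P} [SFinite ν]
    {U : G → P → P} (hU : ∀ᵐ p ∂ν, U 1 p = p) : ∀ᵐ z ∂Q.mY.prod ν, Q.skew U 0 z = z := by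
  have h1 : ∀ᵐ z ∂Q.mY.prod ν, Q.a z.1 = 1 := Measure.quasiMeasurePreserving_fst.ae Q.ae_mY
  have h2 : ∀ᵐ z ∂Q.mY.prod ν, U 1 z.2 = z.2 := Measure.quasiMeasurePreserving_snd.ae hU
  filter_upwards [h1, h2] with z h1 h2
  rw [skew, Q.τ_zero h1, Q.B_zero, h1, h2]

variable [Countable G]

theorem measurePreserving_τ (v : Fin d → ℤ) : MeasurePreserving (Q.τ v) Q.mY Q.mY := by
  refine measurePreserving_restrict_of_pieces (Q.measurable_a (measurableSet_singleton _))
    (i := fun ω => Q.a (Q.B v ω)) (i' := fun ω => (Q.a (Q.B (-v) ω))⁻¹)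
    (φ := fun g ω => Q.A g (Q.B v ω)) (Q.measurable_a.comp (Q.mpB v).measurable)
    ((measurable_of_countable (fun g : G => g⁻¹)).comp
      (Q.measurable_a.comp (Q.mpB (-v)).measurable))
    (fun w => (Q.mpA w).comp (Q.mpB v)) fun g ω => ?_
  simp only [Set.mem_preimage, Set.mem_singleton_iff, Q.a_A, ← Q.comm, ← Q.B_add, neg_add_cancel,
    Q.B_zero, mul_inv_rev, inv_inv, mul_eq_left, inv_eq_one, mul_inv_eq_one]
  tauto

theorem measurable_uncurry_of_countable {P P' : Type*} [MeasurableSpace P] [MeasurableSpace P']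
    {U : G → P → P'} (hU : ∀ g, Measurable (U g)) (v : Fin d → ℤ) :
    Measurable (uncurry fun ω => U (Q.a (Q.B v ω))) :=
  (measurable_from_prod_countable_right hU : Measurable fun p : G × P => U p.1 p.2).comp
    (((Q.measurable_a_B v).comp measurable_fst).prodMk measurable_snd)

theorem measurePreserving_skew {P : Type*} [MeasurableSpace P] {ν : Measure P} [SFinite ν]
    {U : G → P → P} (hU : ∀ g, MeasurePreserving (U g) ν ν) (v : Fin d → ℤ) :
    MeasurePreserving (Q.skew U v) (Q.mY.prod ν) (Q.mY.prod ν) :=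
  (Q.measurePreserving_τ v).skew_product
    (Q.measurable_uncurry_of_countable (fun g => (hU g).measurable) v)
    (Eventually.of_forall fun _ => (hU _).map_eq)

theorem measurable_γ (v : Fin d → ℤ) : Measurable (Q.γ v) :=
  Q.measurable_uncurry_of_countable (U := fun g x => Q.b (Q.A g x))
    (fun g => Q.measurable_b.comp (Q.mpA g).measurable) v

theorem integrable_γ (hSfin : SG.Finite) (hSsymm : ∀ s ∈ SG, s⁻¹ ∈ SG)
    (hSgen : Subgroup.closure SG = ⊤)
    (hb : ∀ g, Integrable (fun x => intVec (Q.b (Q.A g x))) Q.mX)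
    (ha : ∀ v, Integrable (fun y => (wlen SG (Q.a (Q.B v y)) : ℝ)) Q.mY) (v : Fin d → ℤ) :
    Integrable (fun z => intVec (Q.γ v z)) (Q.mY.prod Q.mX) := by
  obtain ⟨C, hC0, hC⟩ := Q.exists_integral_norm_b_le hSfin hSsymm hSgen hb
  have hm : Measurable fun z => intVec (Q.γ v z) :=
    (measurable_of_countable (intVec (d := d))).comp (Q.measurable_γ v)
  rw [integrable_prod_iff hm.aestronglyMeasurable]
  refine ⟨Eventually.of_forall fun y => hb (Q.a (Q.B v y)), ((ha v).const_mul C).mono'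
    hm.norm.stronglyMeasurable.integral_prod_right.aestronglyMeasurable
    (Eventually.of_forall fun y => ?_)⟩
  rw [Real.norm_of_nonneg (integral_nonneg fun _ => norm_nonneg _)]
  exact hC (Q.a (Q.B v y))

theorem mY_ne_zero (hm : m ≠ 0) : Q.mY ≠ 0 := by
  intro h
  rw [mY, Measure.restrict_eq_zero] at h
  refine hm (Measure.measure_univ_eq_zero.1 (measure_mono_null (t := ⋃ g, Q.A g ⁻¹' (Q.a ⁻¹' {1}))
    (fun ω _ => Set.mem_iUnion.2 ⟨Q.a ω, ?_⟩) (measure_iUnion_null fun v => ?_)))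
  · simp [Q.a_A]
  · rw [(Q.mpA v).measure_preimage (Q.measurable_a (measurableSet_singleton _)).nullMeasurableSet,
      h]

theorem exists_card_le (hm : m ≠ 0) (hSfin : SG.Finite) (hSsymm : ∀ s ∈ SG, s⁻¹ ∈ SG)
    (hSgen : Subgroup.closure SG = ⊤)
    (hb : ∀ g, Integrable (fun x => intVec (Q.b (Q.A g x))) Q.mX) :
    ∃ C : ℝ, ∀ (n : ℕ) (F : Finset G), (∀ g ∈ F, wlen SG g ≤ n) →
      (F.card : ℝ) ≤ C * (n + 1) ^ d := by
  classical
  obtain ⟨C, hC0, hC⟩ := Q.exists_integral_norm_b_le hSfin hSsymm hSgen hb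
  obtain ⟨h, hh⟩ : ∃ h, Q.mX (Q.a ⁻¹' {h}) ≠ 0 := by
    by_contra! hcon
    refine Q.mX_ne_zero hm (Measure.measure_univ_eq_zero.1 (measure_mono_null
      (t := ⋃ h, Q.a ⁻¹' {h}) (fun ω _ => ?_) (measure_iUnion_null hcon)))
    simp
  set E := Q.a ⁻¹' {h} with hE
  have hEm : MeasurableSet E := Q.measurable_a (measurableSet_singleton _)
  set δ := Q.mX.real E with hδ
  have hδ0 : 0 < δ := ENNReal.toReal_pos hh (measure_ne_top _ _)
  obtain ⟨k, hk⟩ := exists_nat_ge (2 * (C + 1) / δ)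
  set M := Q.mX.real Set.univ with hM
  refine ⟨2 * M / δ * (2 * k + 1) ^ d, fun n F hF => ?_⟩
  set L : ℕ := k * (n + 1) with hL
  have hk0 : 0 < (k : ℝ) := lt_of_lt_of_le (by positivity) hk
  have hL0 : 0 < (L : ℝ) := by rw [hL]; push_cast; positivity
  let W : G → Set Ω := fun g => {x | Q.S g x ∈ E ∧ ‖intVec (Q.b (Q.A g x))‖ ≤ L}
  have hnm : ∀ g, Measurable fun x => ‖intVec (Q.b (Q.A g x))‖ := fun g =>
    (((measurable_of_countable (intVec (d := d))).comp
      (Q.measurable_b.comp (Q.mpA g).measurable))).norm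
  have hWm : ∀ g, MeasurableSet (W g) := fun g =>
    ((Q.measurePreserving_S g).measurable hEm).inter (measurableSet_le (hnm g) measurable_const)
  have hW : ∀ g ∈ F, δ / 2 ≤ Q.mX.real (W g) := by
    intro g hg
    have h1 : Q.mX.real (Q.S g ⁻¹' E) = δ := by
      rw [measureReal_def, (Q.measurePreserving_S g).measure_preimage hEm.nullMeasurableSet, hδ,
        measureReal_def]
    have h2 := mul_meas_ge_le_integral_of_nonneg (μ := Q.mX)
      (Eventually.of_forall fun x => norm_nonneg (intVec (Q.b (Q.A g x)))) (hb g).norm L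
    have h3 : Q.mX.real (Q.S g ⁻¹' E) ≤
        Q.mX.real (W g) + Q.mX.real {x | (L : ℝ) ≤ ‖intVec (Q.b (Q.A g x))‖} := by
      refine (measureReal_mono fun x hx => ?_).trans (measureReal_union_le _ _)
      by_cases hx' : ‖intVec (Q.b (Q.A g x))‖ ≤ L
      · exact Or.inl ⟨hx, hx'⟩
      · exact Or.inr (not_le.1 hx').le
    have h4 := hC g
    have h5 : (wlen SG g : ℝ) ≤ n := by exact_mod_cast hF g hg
    have h6 : Q.mX.real {x | (L : ℝ) ≤ ‖intVec (Q.b (Q.A g x))‖} ≤ δ / 2 := by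
      have h7 : C * wlen SG g ≤ C * n := mul_le_mul_of_nonneg_left h5 hC0
      have h8 : C * n ≤ (C + 1) * (n + 1) := by
        have : (0 : ℝ) ≤ n := by positivity
        nlinarith
      have h9 : (C + 1) * (n + 1) ≤ L * (δ / 2) := by
        rw [div_le_iff₀ hδ0] at hk
        rw [hL]; push_cast
        have := mul_le_mul_of_nonneg_right hk (show (0 : ℝ) ≤ n + 1 by positivity)
        linarith
      refine le_of_mul_le_mul_left ?_ hL0
      linarith
    linarith
  have hWi : ∀ g, Integrable ((W g).indicator (1 : Ω → ℝ)) Q.mX := fun g =>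
    (integrable_const (1 : ℝ)).indicator (hWm g)
  have hint : ∑ g ∈ F, Q.mX.real (W g) ≤ M * (2 * L + 1) ^ d := by
    have e : ∑ g ∈ F, Q.mX.real (W g) = ∫ x, ∑ g ∈ F, (W g).indicator (1 : Ω → ℝ) x ∂Q.mX := by
      rw [integral_finsetSum _ fun g _ => hWi g]
      exact Finset.sum_congr rfl fun g _ => (integral_indicator_one (hWm g)).symm
    have e2 : M * (2 * L + 1) ^ d = ∫ _, ((2 * L + 1) ^ d : ℝ) ∂Q.mX := by
      rw [integral_const, smul_eq_mul]
    rw [e, e2]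
    refine integral_mono (integrable_finsetSum _ fun g _ => hWi g) (integrable_const _) fun x => ?_
    have h1 : ∑ g ∈ F, (W g).indicator (1 : Ω → ℝ) x = (F.filter fun g => x ∈ W g).card := by
      simp only [Set.indicator_apply, Pi.one_apply]
      rw [Finset.sum_boole]
    simp only [h1]
    have h2 : (F.filter fun g => x ∈ W g).card ≤ (intBox d L).card := by
      refine Finset.card_le_card_of_injOn (fun g => Q.b (Q.A g x)) (fun g hg => ?_) ?_
      · have := (Finset.mem_filter.1 hg).2.2
        rw [norm_intVec] at this
        exact mem_intBox.2 this
      · intro g hg g' hg' hgg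
        have h3 : ∀ g, x ∈ W g → g = h⁻¹ * Q.a (Q.B (Q.b (Q.A g x)) x) := by
          intro g hg
          have h4 : Q.a (Q.S g x) = h := hg.1
          rw [S, ← Q.comm, Q.a_A] at h4
          rw [← h4]
          group
        rw [h3 g (Finset.mem_filter.1 hg).2, h3 g' (Finset.mem_filter.1 hg').2]
        simp only at hgg
        rw [hgg]
    rw [card_intBox] at h2
    exact_mod_cast h2
  have h1 : (F.card : ℝ) * (δ / 2) ≤ ∑ g ∈ F, Q.mX.real (W g) := by
    rw [← nsmul_eq_mul]
    exact Finset.card_nsmul_le_sum _ _ _ hW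
  have h2 : (2 * L + 1 : ℝ) ^ d ≤ ((2 * k + 1) * (n + 1)) ^ d := by
    refine pow_le_pow_left₀ (by positivity) ?_ _
    rw [hL]; push_cast
    have : (0 : ℝ) ≤ n := by positivity
    nlinarith
  have hM0 : 0 ≤ M := measureReal_nonneg
  have h3 := (h1.trans hint).trans (mul_le_mul_of_nonneg_left h2 hM0)
  rw [mul_pow] at h3
  have h4 : 2 * M / δ * (2 * k + 1) ^ d * (n + 1) ^ d =
      (M * ((2 * k + 1) ^ d * (n + 1) ^ d)) / (δ / 2) := by
    field_simp
  rw [h4, le_div_iff₀ (by positivity)]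
  exact h3

end StrictCoupling
end Coupling

section BoundedMap

open Filter Topology Function ENNReal Matrix

/-- A measurable map which pushes a measure forward to at most a multiple of another one. -/
structure BoundedMap {P P' : Type*} [MeasurableSpace P] [MeasurableSpace P'] (φ : P → P')
    (μ : Measure P) (μ' : Measure P') : Prop where
  measurable : Measurable φ
  le : ∃ c : ℝ≥0∞, c ≠ ⊤ ∧ μ.map φ ≤ c • μ'

namespace BoundedMap

variable {P P' : Type*} [MeasurableSpace P] [MeasurableSpace P']
  {φ : P → P'} {μ : Measure P} {μ' : Measure P'}

theorem _root_.MeasureTheory.MeasurePreserving.boundedMap (h : MeasurePreserving φ μ μ') :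
    BoundedMap φ μ μ' :=
  ⟨h.measurable, 1, one_ne_top, by rw [h.map_eq, one_smul]⟩

theorem ae (hφ : BoundedMap φ μ μ') {p : P' → Prop} (hp : ∀ᵐ z ∂μ', p z) : ∀ᵐ z ∂μ, p (φ z) := by
  obtain ⟨c, hc, h⟩ := hφ.le
  exact ae_of_ae_map hφ.measurable.aemeasurable
    ((h.absolutelyContinuous.trans Measure.smul_absolutelyContinuous).ae_le hp)

theorem integrable_comp (hφ : BoundedMap φ μ μ') {E : Type*} [NormedAddCommGroup E] {f : P' → E}
    (hf : Integrable f μ') : Integrable (fun z => f (φ z)) μ := by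
  obtain ⟨c, hc, h⟩ := hφ.le
  exact ((hf.smul_measure hc).mono_measure h).comp_measurable hφ.measurable

theorem integral_comp_le (hφ : BoundedMap φ μ μ') : ∃ C : ℝ, 0 ≤ C ∧ ∀ f : P' → ℝ, 0 ≤ f →
    Integrable f μ' → ∫ z, f (φ z) ∂μ ≤ C * ∫ z, f z ∂μ' := by
  obtain ⟨c, hc, h⟩ := hφ.le
  refine ⟨c.toReal, toReal_nonneg, fun f hf0 hf => ?_⟩
  have hf' := hf.smul_measure hc
  rw [← integral_map hφ.measurable.aemeasurable (hf'.mono_measure h).aestronglyMeasurable]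
  refine (integral_mono_measure h (Eventually.of_forall hf0) hf').trans ?_
  rw [integral_smul_measure, smul_eq_mul]

theorem restrict_left (hφ : BoundedMap φ μ μ') (D : Set P) : BoundedMap φ (μ.restrict D) μ' := by
  obtain ⟨c, hc, h⟩ := hφ.le
  exact ⟨hφ.measurable, c, hc, (Measure.map_mono Measure.restrict_le_self hφ.measurable).trans h⟩

theorem restrict (hφ : BoundedMap φ μ μ') {D : Set P} {s : Set P'} (hs : MeasurableSet s)
    (hD : D ⊆ φ ⁻¹' s) : BoundedMap φ (μ.restrict D) (μ'.restrict s) := by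
  obtain ⟨c, hc, h⟩ := hφ.le
  refine ⟨hφ.measurable, c, hc, ?_⟩
  refine (Measure.map_mono (Measure.restrict_mono hD le_rfl) hφ.measurable).trans ?_
  rw [← Measure.restrict_map hφ.measurable hs, ← Measure.restrict_smul]
  exact Measure.restrict_mono subset_rfl h

theorem id (μ : Measure P) : BoundedMap id μ μ := (MeasurePreserving.id μ).boundedMap

theorem fst [SFinite μ] [IsFiniteMeasure μ'] : BoundedMap Prod.fst (μ.prod μ') μ :=
  ⟨measurable_fst, μ' Set.univ, measure_ne_top _ _, by rw [Measure.map_fst_prod]⟩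

theorem snd [IsFiniteMeasure μ] [SFinite μ'] : BoundedMap Prod.snd (μ.prod μ') μ' :=
  ⟨measurable_snd, μ Set.univ, measure_ne_top _ _, by rw [Measure.map_snd_prod]⟩

theorem prodMap {Q Q' : Type*} [MeasurableSpace Q] [MeasurableSpace Q'] {ν : Measure Q}
    {ν' : Measure Q'} [SFinite μ] [SFinite μ'] [SFinite ν] [SFinite ν'] {ψ : Q → Q'}
    (hφ : BoundedMap φ μ μ') (hψ : BoundedMap ψ ν ν') :
    BoundedMap (Prod.map φ ψ) (μ.prod ν) (μ'.prod ν') := by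
  obtain ⟨c, hc, h⟩ := hφ.le
  obtain ⟨c', hc', h'⟩ := hψ.le
  refine ⟨hφ.measurable.prodMap hψ.measurable, c * c', mul_ne_top hc hc', ?_⟩
  rw [← Measure.map_prod_map _ _ hφ.measurable hψ.measurable]
  refine (Measure.prod_mono h h').trans ?_
  rw [Measure.prod_smul_left, Measure.prod_smul_right, mul_smul]

end BoundedMap

/-- A family of nonnegative functions indexed by integer vectors with integrals of sublinear
growth. -/
structure Sublinear {d : ℕ} {P : Type*} [MeasurableSpace P] (e : (Fin d → ℤ) → P → ℝ)
    (μ : Measure P) : Prop where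
  nonneg : ∀ v z, 0 ≤ e v z
  integrable : ∀ v, Integrable (e v) μ
  le : ∀ ε : ℝ, 0 < ε → ∃ C : ℝ, 0 ≤ C ∧ ∀ v, ∫ z, e v z ∂μ ≤ ε * ‖v‖ + C

namespace Sublinear

variable {d : ℕ} {P P' : Type*} [MeasurableSpace P] [MeasurableSpace P']
  {μ : Measure P} {μ' : Measure P'}

theorem comp {e : (Fin d → ℤ) → P' → ℝ} (he : Sublinear e μ') {φ : P → P'}
    (hφ : BoundedMap φ μ μ') : Sublinear (fun v z => e v (φ z)) μ := by
  refine ⟨fun v z => he.nonneg _ _, fun v => hφ.integrable_comp (he.integrable v),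
    fun ε hε => ?_⟩
  obtain ⟨c, hc0, hc⟩ := hφ.integral_comp_le
  obtain ⟨C, hC0, hC⟩ := he.le (ε / (c + 1)) (by positivity)
  refine ⟨c * C, by positivity, fun v => (hc _ (he.nonneg v) (he.integrable v)).trans ?_⟩
  refine (mul_le_mul_of_nonneg_left (hC v) hc0).trans ?_
  have h1 : c * (ε / (c + 1)) ≤ ε := by
    rw [← mul_div_assoc, div_le_iff₀ (by positivity)]
    linarith
  rw [mul_add, ← mul_assoc]
  gcongr

theorem add {e e' : (Fin d → ℤ) → P → ℝ} (he : Sublinear e μ) (he' : Sublinear e' μ) :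
    Sublinear (fun v z => e v z + e' v z) μ := by
  refine ⟨fun v z => add_nonneg (he.nonneg _ _) (he'.nonneg _ _),
    fun v => (he.integrable v).add (he'.integrable v), fun ε hε => ?_⟩
  obtain ⟨C, hC0, hC⟩ := he.le (ε / 2) (by positivity)
  obtain ⟨C', hC0', hC'⟩ := he'.le (ε / 2) (by positivity)
  refine ⟨C + C', by positivity, fun v => ?_⟩
  rw [integral_add (he.integrable v) (he'.integrable v)]
  linarith [hC v, hC' v]

theorem const_mul {e : (Fin d → ℤ) → P → ℝ} (he : Sublinear e μ) {c : ℝ} (hc : 0 ≤ c) :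
    Sublinear (fun v z => c * e v z) μ := by
  refine ⟨fun v z => mul_nonneg hc (he.nonneg _ _), fun v => (he.integrable v).const_mul c,
    fun ε hε => ?_⟩
  obtain ⟨C, hC0, hC⟩ := he.le (ε / (c + 1)) (by positivity)
  refine ⟨c * C, by positivity, fun v => ?_⟩
  rw [integral_const_mul]
  refine (mul_le_mul_of_nonneg_left (hC v) hc).trans ?_
  have h1 : c * (ε / (c + 1)) ≤ ε := by
    rw [← mul_div_assoc, div_le_iff₀ (by positivity)]
    linarith
  rw [mul_add, ← mul_assoc]
  gcongr

theorem restrict {e : (Fin d → ℤ) → P → ℝ} (he : Sublinear e μ) (D : Set P) :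
    Sublinear e (μ.restrict D) :=
  he.comp ((BoundedMap.id μ).restrict_left D)

theorem zero : Sublinear (fun (_ : Fin d → ℤ) (_ : P) => (0 : ℝ)) μ :=
  ⟨fun _ _ => le_rfl, fun _ => integrable_zero _ _ _, fun ε hε => ⟨0, le_rfl, fun v => by
    rw [integral_zero, add_zero]; positivity⟩⟩

end Sublinear

theorem exists_forall_sum_mul_eq_zero {d : ℕ} (f : (Fin d → ℝ) →L[ℝ] (Fin d → ℝ))
    (hf : f.det = 0) : ∃ t : Fin d → ℝ, (∃ j, 1 ≤ |t j|) ∧ (∀ j, |t j| ≤ 1) ∧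
      ∀ y, ∑ j, t j * f y j = 0 := by
  have hdet : (LinearMap.toMatrix' (f : (Fin d → ℝ) →ₗ[ℝ] (Fin d → ℝ))).det = 0 := by
    rw [LinearMap.det_toMatrix']; exact hf
  obtain ⟨t, ht0, ht⟩ := Matrix.exists_vecMul_eq_zero_iff.2 hdet
  obtain ⟨j₀, hj₀⟩ := Function.ne_iff.1 ht0
  obtain ⟨j, -, hj⟩ := Finset.exists_max_image Finset.univ (fun j => |t j|) ⟨j₀, Finset.mem_univ _⟩
  have hj0 : 0 < |t j| := (abs_pos.2 hj₀).trans_le (hj j₀ (Finset.mem_univ _))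
  have hj0' : t j ≠ 0 := abs_pos.1 hj0
  refine ⟨fun i => t i / t j, ⟨j, by simp [hj0']⟩, fun i => ?_, fun y => ?_⟩
  · rw [abs_div, div_le_one hj0]
    exact hj i (Finset.mem_univ _)
  · have h1 : f y = LinearMap.toMatrix' (f : (Fin d → ℝ) →ₗ[ℝ] (Fin d → ℝ)) *ᵥ y := by
      rw [LinearMap.toMatrix'_mulVec]; rfl
    have h2 : ∑ j, t j * f y j = 0 := by
      change t ⬝ᵥ f y = 0
      rw [h1, Matrix.dotProduct_mulVec, ht, zero_dotProduct]
    simp only [div_mul_eq_mul_div, ← Finset.sum_div, h2, zero_div]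

end BoundedMap

section Asymptotic

open Filter Topology Function

namespace StrictCoupling

variable {G : Type*} [Group G] [MeasurableSpace G] {d : ℕ} {Ω : Type*}
    [MeasurableSpace Ω] {m : Measure Ω} (Q : StrictCoupling G d m)

/-- The field of linear maps `ℓ` is invariant and describes the asymptotic behaviour of the
cocycle `γ`. -/
structure IsAsymptotic (ℓ : Ω × Ω → (Fin d → ℝ) →L[ℝ] (Fin d → ℝ)) : Prop where
  stronglyMeasurable : StronglyMeasurable ℓ
  skew_eq : ∀ v, ∀ᵐ z ∂Q.mY.prod Q.mX, ℓ (Q.skew Q.S v z) = ℓ z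
  sublinear : Sublinear (fun v z => ‖intVec (Q.γ v z) - ℓ z (intVec v)‖) (Q.mY.prod Q.mX)

theorem eq_of_γ_eq {v v' : Fin d → ℤ} {z : Ω × Ω}
    (hb : Q.b (Q.skew Q.S v z).1 = Q.b (Q.skew Q.S v' z).1)
    (ha : Q.a (Q.skew Q.S v z).2 = Q.a (Q.skew Q.S v' z).2) (hγ : Q.γ v z = Q.γ v' z) :
    v = v' := by
  have h1 : ∀ v, Q.a (Q.skew Q.S v z).2 = Q.a (Q.B (Q.γ v z) z.2) * (Q.a (Q.B v z.1))⁻¹ := by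
    intro v
    rw [skew, S, ← Q.comm, Q.a_A, γ]
  have h2 : ∀ v, Q.b (Q.skew Q.S v z).1 = Q.b (Q.A (Q.a (Q.B v z.1)) z.1) - v := by
    intro v
    rw [skew, τ, Q.comm, Q.b_B]
  rw [h1, h1, hγ, mul_right_inj, inv_inj] at ha
  rw [h2, h2, ha, sub_right_inj] at hb
  exact hb

/-- the diagonal action on pairs -/
def SS (g : G) (p : Ω × Ω) : Ω × Ω := (Q.S g p.1, Q.S g p.2)

/-- the map moving a pair of points of the fundamental domain of `ℤ^d` by the element which brings
the first one to the fundamental domain of `G` -/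
def θ (p : Ω × Ω) : Ω × Ω := (Q.A (Q.a p.1) p.1, Q.S (Q.a p.1) p.2)

theorem SS_mul (g h : G) (p : Ω × Ω) : Q.SS (g * h) p = Q.SS g (Q.SS h p) := by
  simp only [SS, Q.S_mul]

theorem measurePreserving_SS (g : G) :
    MeasurePreserving (Q.SS g) (Q.mX.prod Q.mX) (Q.mX.prod Q.mX) :=
  (Q.measurePreserving_S g).prod (Q.measurePreserving_S g)

theorem θ_SS (g : G) (p : Ω × Ω) :
    Q.θ (Q.SS g p) = Q.skew Q.S (Q.b (Q.A g p.1)) (Q.θ p) := by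
  have h1 : Q.a (Q.S g p.1) = Q.a (Q.B (Q.b (Q.A g p.1)) p.1) * g⁻¹ := by
    rw [S, ← Q.comm, Q.a_A]
  have h2 : Q.a (Q.B (Q.b (Q.A g p.1)) (Q.A (Q.a p.1) p.1)) =
      Q.a (Q.B (Q.b (Q.A g p.1)) p.1) * (Q.a p.1)⁻¹ := by
    rw [← Q.comm, Q.a_A]
  simp only [SS, θ, skew, τ]
  rw [h1, h2, S, ← Q.comm g, ← Q.comm (Q.a p.1), ← Q.A_mul, ← Q.A_mul, ← Q.S_mul, ← Q.S_mul,
    inv_mul_cancel_right, inv_mul_cancel_right]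

theorem γ_θ {h : G} {v : Fin d → ℤ} {y x₁ x₂ : Ω}
    (hh : Q.a (Q.S (Q.a (Q.B v y)) x₁) = h) :
    Q.γ (Q.γ v (y, x₁)) (Q.A h x₁, Q.S h x₂) =
      Q.b (Q.A h (Q.S (Q.a (Q.B v y)) x₂)) + Q.γ v (y, x₂) - Q.b (Q.A h x₂) := by
  set g := Q.a (Q.B v y) with hg
  have h3 : Q.a (Q.B (Q.γ v (y, x₁)) x₁) = h * g := by
    rw [S, ← Q.comm, Q.a_A, mul_inv_eq_iff_eq_mul] at hh
    exact hh
  have h4 : Q.γ (Q.γ v (y, x₁)) (Q.A h x₁, Q.S h x₂) = Q.b (Q.A (h * g * h⁻¹) (Q.S h x₂)) := by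
    rw [← h3, γ, ← Q.comm, Q.a_A]
  have h5 : Q.γ v (y, x₂) = Q.b (Q.A g x₂) := rfl
  rw [h4, h5, Q.b_A_S, Q.b_A_S, inv_mul_cancel_right]
  abel

variable [DiscreteMeasurableSpace G]

theorem boundedMap_A (h : G) : BoundedMap (Q.A h) (Q.mX.restrict (Q.a ⁻¹' {h})) Q.mY := by
  refine ⟨(Q.mpA h).measurable, 1, ENNReal.one_ne_top, ?_⟩
  rw [one_smul]
  refine Measure.le_iff.2 fun s hs => ?_
  have hm := Q.measurable_a (measurableSet_singleton (1 : G))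
  rw [Measure.map_apply (Q.mpA h).measurable hs, mX, mY,
    Measure.restrict_apply ((Q.mpA h).measurable hs), Measure.restrict_apply hs,
    ← (Q.mpA h).measure_preimage (hs.inter hm).nullMeasurableSet]
  refine (Measure.restrict_apply_le _ _).trans (measure_mono ?_)
  rintro ω ⟨h1, h2⟩
  refine ⟨h1, ?_⟩
  simp only [Set.mem_preimage, Set.mem_singleton_iff] at h2 ⊢
  rw [Q.a_A, h2, mul_inv_cancel]

theorem boundedMap_prodMap_A_S (h : G) : BoundedMap (Prod.map (Q.A h) (Q.S h))
    ((Q.mX.prod Q.mX).restrict {p | Q.a p.1 = h}) (Q.mY.prod Q.mX) := by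
  have h1 : {p : Ω × Ω | Q.a p.1 = h} = (Q.a ⁻¹' {h}) ×ˢ Set.univ := by
    ext p; simp
  rw [h1, ← Measure.prod_restrict, Measure.restrict_univ]
  exact (Q.boundedMap_A h).prodMap (Q.measurePreserving_S h).boundedMap

variable [Countable G]

theorem ae_θ {p : Ω × Ω → Prop} (hp : ∀ᵐ z ∂Q.mY.prod Q.mX, p z) :
    ∀ᵐ z ∂Q.mX.prod Q.mX, p (Q.θ z) := by
  have h1 : ∀ h : G, ∀ᵐ z ∂Q.mX.prod Q.mX, Q.a z.1 = h → p (Q.θ z) := by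
    intro h
    have hm : MeasurableSet {p : Ω × Ω | Q.a p.1 = h} :=
      (Q.measurable_a.comp measurable_fst) (measurableSet_singleton h)
    have h2 := (ae_restrict_iff' hm).1 ((Q.boundedMap_prodMap_A_S h).ae hp)
    filter_upwards [h2] with z hz hzh
    have h3 := hz hzh
    rw [θ, hzh]
    exact h3
  filter_upwards [ae_all_iff.2 h1] with z hz
  exact hz _ rfl

theorem measurable_θ : Measurable Q.θ := by
  refine Measurable.prodMk ?_ ?_
  · exact (measurable_from_prod_countable_right fun g => (Q.mpA g).measurable :
      Measurable fun p : G × Ω => Q.A p.1 p.2).comp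
      ((Q.measurable_a.comp measurable_fst).prodMk measurable_fst)
  · exact (measurable_from_prod_countable_right fun g => (Q.measurePreserving_S g).measurable :
      Measurable fun p : G × Ω => Q.S p.1 p.2).comp
      ((Q.measurable_a.comp measurable_fst).prodMk measurable_snd)

namespace IsAsymptotic

variable {Q} {ℓ : Ω × Ω → (Fin d → ℝ) →L[ℝ] (Fin d → ℝ)}

theorem ae_θ_SS (hℓ : Q.IsAsymptotic ℓ) (g : G) :
    ∀ᵐ p ∂Q.mX.prod Q.mX, ℓ (Q.θ (Q.SS g p)) = ℓ (Q.θ p) := by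
  filter_upwards [Q.ae_θ (ae_all_iff.2 hℓ.skew_eq)] with p hp
  rw [Q.θ_SS]
  exact hp _

theorem ae_det_ne_zero (hℓ : Q.IsAsymptotic ℓ) : ∀ᵐ z ∂Q.mY.prod Q.mX, (ℓ z).det ≠ 0 := by
  have key : ∀ (u : Fin d → ℤ) (h : G) (R : ℕ), (Q.mY.prod Q.mX)
      {z | Q.b z.1 = u ∧ Q.a z.2 = h ∧ ‖ℓ z‖ ≤ R ∧ (ℓ z).det = 0} = 0 := by
    intro u h R
    set D : Set (Ω × Ω) := {z | Q.b z.1 = u ∧ Q.a z.2 = h ∧ ‖ℓ z‖ ≤ R ∧ (ℓ z).det = 0} with hD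
    have hDm : MeasurableSet D :=
      ((Q.measurable_b.comp measurable_fst) (measurableSet_singleton u)).inter
        (((Q.measurable_a.comp measurable_snd) (measurableSet_singleton h)).inter
        ((measurableSet_le hℓ.stronglyMeasurable.norm.measurable measurable_const).inter
        ((ContinuousLinearMap.continuous_det.comp_stronglyMeasurable
          hℓ.stronglyMeasurable).measurable (measurableSet_singleton 0))))
    have he := (hℓ.sublinear.const_mul (c := d + 1) (by positivity)).restrict D
    have he0 := (Sublinear.zero (d := d) (μ := Q.mY.prod Q.mX)).restrict D
    refine measure_eq_zero_of_slab_returns (fun v => Q.measurePreserving_skew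
      Q.measurePreserving_S v) (Q.skew_add Q.S_mul) hDm Q.γ Q.γ _ _ he.nonneg he0.nonneg
      he.integrable he0.integrable he.le he0.le (R := R) (K := 0) (τ := 1) (by positivity) one_pos
      (Eventually.of_forall fun z hz => ?_)
    obtain ⟨t, ht1, ht2, ht3⟩ := exists_forall_sum_mul_eq_zero (ℓ z) hz.2.2.2
    have hinj : ∀ v v', Q.skew Q.S v z ∈ D → Q.skew Q.S v' z ∈ D → Q.γ v z = Q.γ v' z → v = v' :=
      fun v v' hv hv' => Q.eq_of_γ_eq (hv.1.trans hv'.1.symm) (hv.2.1.trans hv'.2.1.symm)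
    refine ⟨hinj, hinj, t, ht1, fun v hv => ?_⟩
    set E := intVec (Q.γ v z) - ℓ z (intVec v) with hE
    have hγ : ‖Q.γ v z‖ ≤ R * ‖v‖ + (d + 1) * ‖E‖ := by
      rw [← norm_intVec, ← norm_intVec v]
      have h1 : intVec (Q.γ v z) = ℓ z (intVec v) + E := by rw [hE]; abel
      have h2 := (ℓ z).le_opNorm (intVec v)
      have h3 := mul_le_mul_of_nonneg_right hz.2.2.1 (norm_nonneg (intVec v))
      have h4 : 0 ≤ d * ‖E‖ := by positivity
      rw [h1]
      linarith [norm_add_le (ℓ z (intVec v)) E]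
    refine ⟨hγ, hγ, ?_⟩
    have h1 : ∑ j, t j * (Q.γ v z j : ℝ) = ∑ j, t j * E j := by
      have : ∀ j, t j * (Q.γ v z j : ℝ) = t j * E j + t j * ℓ z (intVec v) j := by
        intro j
        rw [hE, Pi.sub_apply, intVec_apply]; ring
      rw [Finset.sum_congr rfl fun j _ => this j, Finset.sum_add_distrib, ht3, add_zero]
    have h2 : |∑ j, t j * E j| ≤ d * ‖E‖ := by
      refine (Finset.abs_sum_le_sum_abs _ _).trans ?_
      have : ∀ j ∈ Finset.univ, |t j * E j| ≤ ‖E‖ := by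
        intro j _
        rw [abs_mul]
        exact (mul_le_of_le_one_left (abs_nonneg _) (ht2 j)).trans (norm_le_pi_norm E j)
      refine (Finset.sum_le_card_nsmul _ _ _ this).trans ?_
      simp
    rw [h1]
    have := norm_nonneg E
    linarith
  have h1 : ∀ᵐ z ∂Q.mY.prod Q.mX, ∀ (u : Fin d → ℤ) (h : G) (R : ℕ),
      ¬(Q.b z.1 = u ∧ Q.a z.2 = h ∧ ‖ℓ z‖ ≤ R ∧ (ℓ z).det = 0) :=
    ae_all_iff.2 fun u => ae_all_iff.2 fun h => ae_all_iff.2 fun R => by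
      rw [ae_iff]
      simpa only [not_not] using key u h R
  filter_upwards [h1] with z hz hdet
  obtain ⟨R, hR⟩ := exists_nat_ge ‖ℓ z‖
  exact hz _ _ R ⟨rfl, rfl, hR, hdet⟩

theorem ae_cocycle (hℓ : Q.IsAsymptotic ℓ) : ∀ᵐ z ∂Q.mY.prod (Q.mX.prod Q.mX),
    ℓ (z.1, z.2.2) = (ℓ (Q.θ z.2)).comp (ℓ (z.1, z.2.1)) := by
  set μ := Q.mY.prod (Q.mX.prod Q.mX)
  have hp₁ : BoundedMap (fun z : Ω × Ω × Ω => (z.1, z.2.1)) μ (Q.mY.prod Q.mX) :=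
    (BoundedMap.id Q.mY).prodMap BoundedMap.fst
  have hp₂ : BoundedMap (fun z : Ω × Ω × Ω => (z.1, z.2.2)) μ (Q.mY.prod Q.mX) :=
    (BoundedMap.id Q.mY).prodMap BoundedMap.snd
  have hℓm := hℓ.stronglyMeasurable
  have hm₁ := hℓm.comp_measurable hp₁.measurable
  have hm₂ := hℓm.comp_measurable hp₂.measurable
  have hm₃ := hℓm.comp_measurable (Q.measurable_θ.comp
    (measurable_snd : Measurable fun z : Ω × Ω × Ω => z.2))
  set N : Ω × Ω × Ω → (Fin d → ℝ) →L[ℝ] (Fin d → ℝ) := fun z =>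
    ℓ (z.1, z.2.2) - (ℓ (Q.θ z.2)).comp (ℓ (z.1, z.2.1)) with hN
  have hNm : StronglyMeasurable N := hm₂.sub
    (((continuous_fst.clm_comp continuous_snd : Continuous fun p : ((Fin d → ℝ) →L[ℝ] (Fin d → ℝ)) ×
      ((Fin d → ℝ) →L[ℝ] (Fin d → ℝ)) => p.1.comp p.2)).comp_stronglyMeasurable (hm₃.prodMk hm₁))
  have key : ∀ (u : Fin d → ℤ) (h : G) (R : ℕ) (i j : Fin d) (n : ℕ), μ
      {z | Q.b z.1 = u ∧ Q.a z.2.1 = h ∧ ‖ℓ (z.1, z.2.1)‖ ≤ R ∧ ‖ℓ (Q.θ z.2)‖ ≤ R ∧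
        ‖intVec (Q.b (Q.A h z.2.2))‖ ≤ R ∧ 1 / ((n : ℝ) + 1) ≤ |N z (Pi.single j 1) i|} = 0 := by
    intro u h R i j n
    set D : Set (Ω × Ω × Ω) := {z | Q.b z.1 = u ∧ Q.a z.2.1 = h ∧ ‖ℓ (z.1, z.2.1)‖ ≤ R ∧
      ‖ℓ (Q.θ z.2)‖ ≤ R ∧ ‖intVec (Q.b (Q.A h z.2.2))‖ ≤ R ∧
      1 / ((n : ℝ) + 1) ≤ |N z (Pi.single j 1) i|} with hD
    have hDm : MeasurableSet D := by
      have hc : Continuous fun f : (Fin d → ℝ) →L[ℝ] (Fin d → ℝ) => |f (Pi.single j 1) i| :=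
        ((continuous_apply i).comp (continuous_eval_const _)).abs
      have hs₅ : MeasurableSet {z : Ω × Ω × Ω | ‖intVec (Q.b (Q.A h z.2.2))‖ ≤ R} :=
        measurableSet_le ((measurable_of_countable (intVec (d := d))).comp (Q.measurable_b.comp
          ((Q.mpA h).measurable.comp (measurable_snd.comp measurable_snd)))).norm measurable_const
      have hs₆ : MeasurableSet {z | 1 / ((n : ℝ) + 1) ≤ |N z (Pi.single j 1) i|} :=
        measurableSet_le measurable_const (hc.comp_stronglyMeasurable hNm).measurable
      exact ((Q.measurable_b.comp measurable_fst) (measurableSet_singleton u)).inter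
        (((Q.measurable_a.comp (measurable_fst.comp measurable_snd))
          (measurableSet_singleton h)).inter
        ((measurableSet_le hm₁.norm.measurable measurable_const).inter
        ((measurableSet_le hm₃.norm.measurable measurable_const).inter (hs₅.inter hs₆))))
    have he₁ := ((hℓ.sublinear.comp hp₂).add
      ((hℓ.sublinear.comp hp₁).const_mul (c := R + 1) (by positivity))).restrict D
    have he₂ : Sublinear (fun w (z : Ω × Ω × Ω) => ‖intVec (Q.γ w (Q.A h z.2.1, Q.S h z.2.2)) -
        ℓ (Q.A h z.2.1, Q.S h z.2.2) (intVec w)‖) (μ.restrict D) :=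
      (hℓ.sublinear.comp (Q.boundedMap_prodMap_A_S h)).comp
        ((BoundedMap.snd (μ := Q.mY) (μ' := Q.mX.prod Q.mX)).restrict
          ((Q.measurable_a.comp measurable_fst) (measurableSet_singleton h)) fun z hz => hz.2.1)
    refine measure_eq_zero_of_slab_returns (fun v => Q.measurePreserving_skew
      Q.measurePreserving_SS v) (Q.skew_add Q.SS_mul) hDm (fun v _ => v)
      (fun v z => Q.γ v (z.1, z.2.1)) _ _ he₁.nonneg he₂.nonneg
      he₁.integrable he₂.integrable he₁.le he₂.le (R := R + 1) (K := 2 * R)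
      (τ := 1 / ((n : ℝ) + 1)) (by positivity) (by positivity) (Eventually.of_forall fun z hz => ?_)
    refine ⟨fun _ _ _ _ h => h, fun v v' hv hv' => Q.eq_of_γ_eq (z := (z.1, z.2.1))
      (hv.1.trans hv'.1.symm) (hv.2.1.trans hv'.2.1.symm),
      fun j => N z (Pi.single j 1) i, ⟨j, hz.2.2.2.2.2⟩, fun v hv => ?_⟩
    set L₁ := ℓ (z.1, z.2.1) with hL₁
    set L₂ := ℓ (z.1, z.2.2) with hL₂
    set M := ℓ (Q.θ z.2) with hM
    have hMh : ℓ (Q.A h z.2.1, Q.S h z.2.2) = M := by rw [hM, θ, hz.2.1]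
    set w := Q.γ v (z.1, z.2.1) with hw
    set E₁ := intVec w - L₁ (intVec v) with hE₁
    set E₂ := intVec (Q.γ v (z.1, z.2.2)) - L₂ (intVec v) with hE₂
    set E₃ := intVec (Q.γ w (Q.A h z.2.1, Q.S h z.2.2)) -
      ℓ (Q.A h z.2.1, Q.S h z.2.2) (intVec w) with hE₃
    have hn₁ := norm_nonneg E₁
    have hn₂ := norm_nonneg E₂
    have hn₃ := norm_nonneg E₃
    have hv0 := norm_nonneg v
    have hR0 : (0 : ℝ) ≤ R := by positivity
    have hRE : 0 ≤ R * ‖E₁‖ := by positivity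
    have hRv : 0 ≤ R * ‖v‖ := by positivity
    have hw' : ‖w‖ ≤ R * ‖v‖ + ‖E₁‖ := by
      rw [← norm_intVec, ← norm_intVec v]
      have h1 : intVec w = L₁ (intVec v) + E₁ := by rw [hE₁]; abel
      have h2 := L₁.le_opNorm (intVec v)
      have h3 := mul_le_mul_of_nonneg_right hz.2.2.1 (norm_nonneg (intVec v))
      rw [h1]
      linarith [norm_add_le (L₁ (intVec v)) E₁]
    refine ⟨by linarith, by linarith, ?_⟩
    have hsum : ∑ j, N z (Pi.single j 1) i * (v j : ℝ) = N z (intVec v) i := by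
      have h1 : intVec v = ∑ j, (v j : ℝ) • (Pi.single j 1 : Fin d → ℝ) := by
        ext k
        simp [intVec_apply, Pi.single_apply, Finset.sum_apply]
      rw [h1, map_sum, Finset.sum_apply]
      exact Finset.sum_congr rfl fun j _ => by rw [map_smul, Pi.smul_apply, smul_eq_mul, mul_comm]
    rw [hsum]
    have hγ := Q.γ_θ (v := v) (y := z.1) (x₂ := z.2.2) hv.2.1
    set H' := intVec (Q.b (Q.A h (Q.S (Q.a (Q.B v z.1)) z.2.2))) with hH'
    set H := intVec (Q.b (Q.A h z.2.2)) with hH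
    have hHn : ‖H‖ ≤ R := hz.2.2.2.2.1
    have hHn' : ‖H'‖ ≤ R := hv.2.2.2.2.1
    have hγ' : intVec (Q.γ w (Q.A h z.2.1, Q.S h z.2.2)) =
        H' + intVec (Q.γ v (z.1, z.2.2)) - H := by
      rw [hw, hγ, map_sub, map_add]
    have hNv : N z (intVec v) = M E₁ - E₂ + E₃ + H - H' := by
      rw [hE₃, hγ', hMh, hE₁, hE₂, map_sub]
      simp only [hN, sub_apply, ContinuousLinearMap.comp_apply]
      abel
    have h1 : |N z (intVec v) i| ≤ ‖N z (intVec v)‖ := norm_le_pi_norm (N z (intVec v)) i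
    have h2 := M.le_opNorm E₁
    have h3 := mul_le_mul_of_nonneg_right hz.2.2.2.1 hn₁
    rw [hNv] at h1
    have h4 := norm_sub_le (M E₁ - E₂ + E₃ + H) H'
    have h5 := norm_add_le (M E₁ - E₂ + E₃) H
    have h6 := norm_add_le (M E₁ - E₂) E₃
    have h7 := norm_sub_le (M E₁) E₂
    rw [hNv]
    linarith
  have h1 : ∀ᵐ z ∂μ, ∀ (u : Fin d → ℤ) (h : G) (R : ℕ) (i j : Fin d) (n : ℕ),
      ¬(Q.b z.1 = u ∧ Q.a z.2.1 = h ∧ ‖ℓ (z.1, z.2.1)‖ ≤ R ∧ ‖ℓ (Q.θ z.2)‖ ≤ R ∧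
        ‖intVec (Q.b (Q.A h z.2.2))‖ ≤ R ∧ 1 / ((n : ℝ) + 1) ≤ |N z (Pi.single j 1) i|) :=
    ae_all_iff.2 fun u => ae_all_iff.2 fun h => ae_all_iff.2 fun R => ae_all_iff.2 fun i =>
      ae_all_iff.2 fun j => ae_all_iff.2 fun n => by
        rw [ae_iff]
        simpa only [not_not] using key u h R i j n
  filter_upwards [h1] with z hz
  have hNz : N z = 0 := by
    refine ContinuousLinearMap.coe_injective (LinearMap.pi_ext' fun j => LinearMap.ext_ring ?_)
    ext i
    by_contra hne
    have hne' : 0 < |N z (Pi.single j 1) i| := abs_pos.2 hne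
    obtain ⟨n, hn⟩ := exists_nat_one_div_lt hne'
    obtain ⟨R, hR⟩ := exists_nat_ge (‖ℓ (z.1, z.2.1)‖ + ‖ℓ (Q.θ z.2)‖ +
      ‖intVec (Q.b (Q.A (Q.a z.2.1) z.2.2))‖)
    have p₁ := norm_nonneg (ℓ (z.1, z.2.1))
    have p₂ := norm_nonneg (ℓ (Q.θ z.2))
    have p₃ := norm_nonneg (intVec (Q.b (Q.A (Q.a z.2.1) z.2.2)))
    exact hz _ _ R i j n ⟨rfl, rfl, by linarith, by linarith, by linarith, hn.le⟩
  exact sub_eq_zero.1 hNz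

end IsAsymptotic

end StrictCoupling

end Asymptotic

section Equivariant

open Filter Topology Function

/-- A measurable family of invertible elements whose ratios are invariant under an action with
finite invariant measure is equivariant with respect to a bounded representation. -/
theorem exists_bounded_representation {X G W : Type*} [MeasurableSpace X] {μ : Measure X}
    [IsFiniteMeasure μ] (hμ : μ ≠ 0) [Group G] [Countable G] [NormedRing W] [CompleteSpace W]
    [SecondCountableTopology W] [MeasurableSpace W] [BorelSpace W] {S : G → X → X}
    (hS : ∀ g, MeasurePreserving (S g) μ μ) (hSmul : ∀ g h x, S (g * h) x = S g (S h x))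
    (hS1 : ∀ᵐ x ∂μ, S 1 x = x) {φ : X → W} (hφ : Measurable φ) (hφu : ∀ᵐ x ∂μ, IsUnit (φ x))
    (hφS : ∀ g, ∀ᵐ p ∂μ.prod μ, φ (S g p.2) * Ring.inverse (φ (S g p.1)) =
      φ p.2 * Ring.inverse (φ p.1)) :
    ∃ (ρ : G →* W) (R : ℝ) (P : Set X), (∀ g, ‖ρ g‖ ≤ R) ∧ MeasurableSet P ∧ μ P ≠ 0 ∧
      (∀ g, ∀ᵐ x ∂μ, S g x ∈ P ↔ x ∈ P) ∧
      (∀ g, ∀ᵐ x ∂μ, Ring.inverse (φ (S g x)) = ρ g * Ring.inverse (φ x)) ∧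
      (∀ x ∈ P, ‖Ring.inverse (φ x)‖ ≤ R) ∧ Measurable (fun x => Ring.inverse (φ x)) := by
  have hinv : Measurable (Ring.inverse : W → W) := by
    classical
    have h1 : (Ring.inverse : W → W) = {x : W | IsUnit x}.piecewise Ring.inverse 0 := by
      funext x
      by_cases hx : IsUnit x
      · rw [Set.piecewise_eq_of_mem _ _ _ (show x ∈ {x : W | IsUnit x} from hx)]
      · rw [Set.piecewise_eq_of_notMem _ _ _ (show x ∉ {x : W | IsUnit x} from hx),
          Ring.inverse_non_unit _ hx, Pi.zero_apply]
    rw [h1]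
    refine ContinuousOn.measurable_piecewise (fun x hx => ?_) continuousOn_const
      Units.isOpen.measurableSet
    obtain ⟨u, rfl⟩ := hx
    exact (NormedRing.inverse_continuousAt u).continuousWithinAt
  set f : X → W := fun x => Ring.inverse (φ x) with hf
  have hfm : Measurable f := hinv.comp hφ
  have : (ae μ).NeBot := ae_neBot.2 hμ
  have hρ : ∀ g, ∃ r : W, ∀ᵐ x ∂μ, f (S g x) = r * f x := by
    intro g
    obtain ⟨x₁, h1, h2, h3⟩ := ((Measure.ae_ae_of_ae_prod (hφS g)).and
      (hφu.and ((hS g).quasiMeasurePreserving.ae hφu))).exists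
    refine ⟨Ring.inverse (φ (S g x₁)) * φ x₁, ?_⟩
    filter_upwards [h1, hφu, (hS g).quasiMeasurePreserving.ae hφu] with x h4 h5 h6
    obtain ⟨e, he⟩ := h2
    obtain ⟨b, hb⟩ := h3
    obtain ⟨c, hc⟩ := h5
    obtain ⟨a, ha⟩ := h6
    simp only [hf]
    simp only [← he, ← hb, ← hc, ← ha, Ring.inverse_unit] at h4 ⊢
    have h4' : a * b⁻¹ = c * e⁻¹ := Units.ext (by simpa using h4)
    have : a⁻¹ = b⁻¹ * e * c⁻¹ := by
      rw [mul_inv_eq_iff_eq_mul] at h4'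
      rw [h4']; group
    rw [this]; simp
  choose r hr using hρ
  have cancel : ∀ {s t : W} {x : X}, IsUnit (φ x) → s * f x = t * f x → s = t := by
    intro s t x hx h
    obtain ⟨u, hu⟩ := hx
    simp only [hf, ← hu, Ring.inverse_unit] at h
    exact (Units.mul_left_inj _).1 h
  set ρ : G →* W :=
    { toFun := r
      map_one' := by
        obtain ⟨x, h1, h2, h3⟩ := ((hr 1).and (hS1.and hφu)).exists
        rw [h2] at h1
        exact cancel h3 (by rw [one_mul, ← h1])
      map_mul' := fun g h => by
        obtain ⟨x, h1, h2, h3, h4⟩ := ((hr (g * h)).and (hφu.and ((hr h).and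
          ((hS h).quasiMeasurePreserving.ae (hr g))))).exists
        refine cancel h2 ?_
        rw [← h1, hSmul, h4, h3, mul_assoc] }
  have hρ : ∀ g, ∀ᵐ x ∂μ, f (S g x) = ρ g * f x := hr
  obtain ⟨n, hn⟩ : ∃ n : ℕ, μ Set.univ < μ {x | ‖f x‖ ≤ n ∧ ‖φ x‖ ≤ n} +
      μ {x | ‖f x‖ ≤ n ∧ ‖φ x‖ ≤ n} := by
    have hmono : Monotone fun n : ℕ => {x | ‖f x‖ ≤ n ∧ ‖φ x‖ ≤ n} := by
      intro n n' h x hx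
      have : (n : ℝ) ≤ n' := by exact_mod_cast h
      exact ⟨hx.1.trans this, hx.2.trans this⟩
    have hU : (⋃ n : ℕ, {x | ‖f x‖ ≤ n ∧ ‖φ x‖ ≤ n}) = Set.univ := by
      refine Set.eq_univ_of_forall fun x => Set.mem_iUnion.2 ?_
      obtain ⟨n, hn⟩ := exists_nat_ge (max ‖f x‖ ‖φ x‖)
      exact ⟨n, (le_max_left _ _).trans hn, (le_max_right _ _).trans hn⟩
    have hlim := tendsto_measure_iUnion_atTop (μ := μ) hmono
    rw [hU] at hlim
    have h0 : μ Set.univ ≠ 0 := fun h => hμ (Measure.measure_univ_eq_zero.1 h)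
    exact ((hlim.add hlim).eventually_const_lt
      (ENNReal.lt_add_right (measure_ne_top _ _) h0)).exists
  set E := {x | ‖f x‖ ≤ n ∧ ‖φ x‖ ≤ n} with hE
  have hEm : MeasurableSet E := (measurableSet_le hfm.norm measurable_const).inter
    (measurableSet_le hφ.norm measurable_const)
  have hρn : ∀ g, ‖ρ g‖ ≤ n * n := by
    intro g
    set D : Set X := {x | IsUnit (φ x) ∧ f (S g x) = ρ g * f x}
    have hD : ∀ᵐ x ∂μ, x ∈ D := hφu.and (hρ g)
    have h1 : μ (E ∩ D) = μ E := measure_inter_conull hD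
    have h2 : μ (S g ⁻¹' E) = μ E := (hS g).measure_preimage hEm.nullMeasurableSet
    obtain ⟨x, hx1, hx2⟩ := nonempty_inter_of_measure_lt_add (s := E ∩ D) (t := S g ⁻¹' E)
      (u := Set.univ) μ ((hS g).measurable hEm) (Set.subset_univ _) (Set.subset_univ _)
      (by rw [h1, h2]; exact hn)
    obtain ⟨⟨hxE, hxu, hx⟩, hxS⟩ := And.intro hx1 hx2
    have h3 : ρ g = f (S g x) * φ x := by
      rw [hx, mul_assoc]
      simp only [hf]
      rw [Ring.inverse_mul_cancel _ hxu, mul_one]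
    rw [h3]
    exact (norm_mul_le _ _).trans (mul_le_mul hxS.1 hxE.2 (norm_nonneg _) (Nat.cast_nonneg _))
  refine ⟨ρ, n * n + n * n * n, {x | ∀ g, ‖ρ g * f x‖ ≤ n * n * n}, fun g => (hρn g).trans
    (le_add_of_nonneg_right (by positivity)), ?_, ?_, fun g => ?_, hρ, fun x hx => ?_, hfm⟩
  · rw [Set.ofPred_forall]
    exact MeasurableSet.iInter fun g => measurableSet_le
      (((continuous_const_mul (ρ g)).measurable.comp hfm).norm) measurable_const
  · intro h0
    have h1 : μ E = 0 := measure_mono_null (fun x hx g => (norm_mul_le _ _).trans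
      (mul_le_mul (hρn g) hx.1 (norm_nonneg _) (by positivity))) h0
    rw [h1, add_zero] at hn
    exact not_lt_zero hn
  · filter_upwards [hρ g] with x hx
    simp only [hx, ← mul_assoc, ← map_mul]
    refine ⟨fun h g' => ?_, fun h g' => h _⟩
    simpa using h (g' * g⁻¹)
  · have h1 := hx 1
    rw [map_one, one_mul] at h1
    exact h1.trans (le_add_of_nonneg_left (by positivity))

end Equivariant

section Conclusion

open Filter Topology Function

theorem exists_seq_tendsto_ae_of_tendsto_integral {Y : Type*} [MeasurableSpace Y] {μ : Measure Y}
    {f : ℕ → Y → ℝ} (hf : ∀ n, Integrable (f n) μ) (hf0 : ∀ n y, 0 ≤ f n y)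
    (h : Tendsto (fun n => ∫ y, f n y ∂μ) atTop (𝓝 0)) :
    ∃ ns : ℕ → ℕ, StrictMono ns ∧ ∀ᵐ y ∂μ, Tendsto (fun k => f (ns k) y) atTop (𝓝 0) := by
  refine (tendstoInMeasure_of_tendsto_eLpNorm (p := 1) (g := 0) one_ne_zero
    (fun n => (hf n).aestronglyMeasurable) aestronglyMeasurable_zero ?_).exists_seq_tendsto_ae
  have h1 : ∀ n, eLpNorm (f n - 0) 1 μ = ENNReal.ofReal (∫ y, f n y ∂μ) := by
    intro n
    rw [sub_zero, eLpNorm_one_eq_lintegral_enorm, ← ofReal_integral_norm_eq_lintegral_enorm (hf n)]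
    simp only [Real.norm_of_nonneg (hf0 n _)]
  simp only [h1]
  simpa using ENNReal.tendsto_ofReal h

theorem isUnit_of_det_ne_zero {d : ℕ} {f : (Fin d → ℝ) →L[ℝ] (Fin d → ℝ)} (hf : f.det ≠ 0) :
    IsUnit f := by
  rw [ContinuousLinearMap.isUnit_iff_bijective]
  exact (Module.End.isUnit_iff _).1 ((LinearMap.isUnit_iff_isUnit_det _).2
    (isUnit_iff_ne_zero.2 hf))

namespace Sublinear

variable {d : ℕ} {P : Type*} [MeasurableSpace P] {μ : Measure P} {e : (Fin d → ℤ) → P → ℝ}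

theorem tendsto_integral (he : Sublinear e μ) (i : Fin d) :
    Tendsto (fun n : ℕ => ∫ z, (n : ℝ)⁻¹ * e (n • Pi.single i 1 : Fin d → ℤ) z ∂μ) atTop (𝓝 0) := by
  have hnorm : ∀ n : ℕ, ‖(n • Pi.single i 1 : Fin d → ℤ)‖ ≤ n := by
    intro n
    refine (norm_nsmul_le).trans ?_
    rw [Pi.norm_single, norm_one, mul_one]
  rw [Metric.tendsto_atTop]
  intro ε hε
  obtain ⟨C, hC0, hC⟩ := he.le (ε / 2) (by positivity)
  obtain ⟨N, hN⟩ := exists_nat_gt (C / (ε / 2))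
  refine ⟨N + 1, fun n hn => ?_⟩
  have hn0 : (0 : ℝ) < n := by exact_mod_cast (by omega : 0 < n)
  have hnN : (N : ℝ) < n := by exact_mod_cast hn
  have h0 : 0 ≤ ∫ z, e (n • Pi.single i 1) z ∂μ := integral_nonneg fun z => he.nonneg _ z
  rw [integral_const_mul, Real.dist_eq, sub_zero, abs_of_nonneg (by positivity),
    inv_mul_lt_iff₀ hn0]
  have h1 := hC (n • Pi.single i 1)
  have h2 : ε / 2 * ‖(n • Pi.single i 1 : Fin d → ℤ)‖ ≤ ε / 2 * n := by
    have := hnorm n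
    gcongr
  have h3 : C < n * (ε / 2) := by
    rw [div_lt_iff₀ (by positivity)] at hN
    nlinarith
  linarith

theorem exists_seq_tendsto_ae (he : Sublinear e μ) (i : Fin d) : ∃ ns : ℕ → ℕ, StrictMono ns ∧
    ∀ᵐ z ∂μ, Tendsto (fun k => (ns k : ℝ)⁻¹ * e (ns k • Pi.single i 1 : Fin d → ℤ) z)
      atTop (𝓝 0) := by
  have h1 : ∀ n : ℕ, Integrable (fun z => (n : ℝ)⁻¹ * e (n • Pi.single i 1 : Fin d → ℤ) z) μ :=
    fun n => (he.integrable (n • Pi.single i 1)).const_mul _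
  have h2 : ∀ (n : ℕ) z, 0 ≤ (n : ℝ)⁻¹ * e (n • Pi.single i 1 : Fin d → ℤ) z :=
    fun n _ => mul_nonneg (inv_nonneg.2 n.cast_nonneg) (he.nonneg _ _)
  obtain ⟨ns, h3, h4⟩ := exists_seq_tendsto_ae_of_tendsto_integral h1 h2 (he.tendsto_integral i)
  exact ⟨ns, h3, h4⟩

theorem integral_prod_left {P' : Type*} [MeasurableSpace P'] {μ' : Measure P'} [SFinite μ]
    [SFinite μ'] {e : (Fin d → ℤ) → P × P' → ℝ} (he : Sublinear e (μ.prod μ')) :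
    Sublinear (fun v y => ∫ x, e v (y, x) ∂μ') μ := by
  refine ⟨fun v y => integral_nonneg fun x => he.nonneg _ _,
    fun v => (he.integrable v).integral_prod_left, fun ε hε => ?_⟩
  obtain ⟨C, hC0, hC⟩ := he.le ε hε
  exact ⟨C, hC0, fun v => by rw [← integral_prod _ (he.integrable v)]; exact hC v⟩

end Sublinear

namespace StrictCoupling

variable {G : Type*} [Group G] [MeasurableSpace G] {d : ℕ} {Ω : Type*}
    [MeasurableSpace Ω] {m : Measure Ω} (Q : StrictCoupling G d m)

section Cocycle

variable {ρ : G →* ((Fin d → ℝ) →L[ℝ] (Fin d → ℝ))} {R : ℝ}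
  {F : Ω → (Fin d → ℝ) →L[ℝ] (Fin d → ℝ)}

theorem integrable_clm_apply {X E : Type*} [MeasurableSpace X] [NormedAddCommGroup E]
    [NormedSpace ℝ E] {μ : Measure X} {F : X → E →L[ℝ] E} (hF : AEStronglyMeasurable F μ)
    (hFR : ∀ x, ‖F x‖ ≤ R) {w : X → E} (hw : Integrable w μ) :
    Integrable (fun x => F x (w x)) μ := by
  refine Integrable.mono' (hw.norm.const_mul R) ?_ (Eventually.of_forall fun x =>
    ((F x).le_opNorm _).trans (mul_le_mul_of_nonneg_right (hFR x) (norm_nonneg _)))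
  exact (isBoundedBilinearMap_apply (𝕜 := ℝ)).continuous.comp_aestronglyMeasurable
    (hF.prodMk hw.aestronglyMeasurable)

/-- the average of the cocycle `g ↦ b (g x)` in the coordinates `F x` -/
noncomputable def averagedCocycle (F : Ω → (Fin d → ℝ) →L[ℝ] (Fin d → ℝ)) (g : G) : Fin d → ℝ :=
  ∫ x, F x (intVec (Q.b (Q.A g⁻¹ x))) ∂Q.mX

theorem averagedCocycle_mul (hF : StronglyMeasurable F) (hFR : ∀ x, ‖F x‖ ≤ R)
    (hFρ : ∀ g, ∀ᵐ x ∂Q.mX, F (Q.S g x) = ρ g * F x)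
    (hb : ∀ g, Integrable (fun x => intVec (Q.b (Q.A g x))) Q.mX) (g h : G) :
    Q.averagedCocycle F (g * h) = Q.averagedCocycle F g + ρ g (Q.averagedCocycle F h) := by
  have hi : ∀ g, Integrable (fun x => F x (intVec (Q.b (Q.A g x)))) Q.mX := fun g =>
    integrable_clm_apply hF.aestronglyMeasurable hFR (hb g)
  have h1 := integral_comp_of_measurePreserving (Q.measurePreserving_S g⁻¹)
    (hi h⁻¹).aestronglyMeasurable
  have h2 : Integrable (fun x => F (Q.S g⁻¹ x) (intVec (Q.b (Q.A h⁻¹ (Q.S g⁻¹ x))))) Q.mX :=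
    (Q.measurePreserving_S g⁻¹).integrable_comp_of_integrable (hi h⁻¹)
  rw [averagedCocycle, averagedCocycle, averagedCocycle, ← h1,
    ← ContinuousLinearMap.integral_comp_comm _ h2,
    ← integral_add (hi g⁻¹) ((ρ g).integrable_comp h2)]
  refine integral_congr_ae ?_
  filter_upwards [hFρ g⁻¹] with x hx
  have h3 : F x = ρ g * F (Q.S g⁻¹ x) := by
    rw [hx, ← mul_assoc, ← map_mul, mul_inv_cancel, map_one, one_mul]
  have h4 : ∀ w, ρ g (F (Q.S g⁻¹ x) w) = F x w := fun w => by rw [h3]; rfl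
  rw [h4, ← map_add, Q.b_A_S, mul_inv_rev, map_sub, add_sub_cancel]

end Cocycle

variable [DiscreteMeasurableSpace G] [Countable G] {SG : Set G}

theorem exists_isAsymptotic (hSfin : SG.Finite) (hSsymm : ∀ s ∈ SG, s⁻¹ ∈ SG)
    (hSgen : Subgroup.closure SG = ⊤)
    (hb : ∀ g, Integrable (fun x => intVec (Q.b (Q.A g x))) Q.mX)
    (ha : ∀ v, Integrable (fun y => (wlen SG (Q.a (Q.B v y)) : ℝ)) Q.mY) :
    ∃ ℓ, Q.IsAsymptotic ℓ := by
  have hγ := Q.integrable_γ hSfin hSsymm hSgen hb ha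
  obtain ⟨ℓ, h1, h2, h3, h4⟩ := exists_asymptotic_linearMap
    (fun v => Q.measurePreserving_skew Q.measurePreserving_S v) (Q.skew_add Q.S_mul)
    (Q.ae_skew_zero (Q.ae_mX.mono fun x hx => Q.S_one hx)) hγ
    (fun v w z => by rw [Q.γ_add, map_add]; rfl)
  exact ⟨ℓ, h1, h2, fun v z => norm_nonneg _, fun v => ((hγ v).sub (h3 _)).norm, h4⟩

/-- Any section of the asymptotic field of linear maps is equivariant up to a bounded
representation and conjugates the whole field to constants. -/
theorem IsAsymptotic.exists_trivialization {ℓ : Ω × Ω → (Fin d → ℝ) →L[ℝ] (Fin d → ℝ)}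
    {Q : StrictCoupling G d m} (hℓ : Q.IsAsymptotic ℓ) (hm : m ≠ 0) :
    ∃ (ρ : G →* ((Fin d → ℝ) →L[ℝ] (Fin d → ℝ))) (R : ℝ)
      (F : Ω → (Fin d → ℝ) →L[ℝ] (Fin d → ℝ)) (P : Set Ω), (∀ g, ‖ρ g‖ ≤ R) ∧
      StronglyMeasurable F ∧ (∀ x, ‖F x‖ ≤ R) ∧ (∀ g, ∀ᵐ x ∂Q.mX, F (Q.S g x) = ρ g * F x) ∧
      MeasurableSet P ∧ Q.mX P ≠ 0 ∧ ∀ᵐ y ∂Q.mY, ∃ k : (Fin d → ℝ) →L[ℝ] (Fin d → ℝ), IsUnit k ∧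
        ∀ᵐ x ∂Q.mX, F x * ℓ (y, x) = P.indicator (fun _ => k) x := by
  have hY : (ae Q.mY).NeBot := ae_neBot.2 (Q.mY_ne_zero hm)
  have hX : (ae Q.mX).NeBot := ae_neBot.2 (Q.mX_ne_zero hm)
  have hdet := Measure.ae_ae_of_ae_prod hℓ.ae_det_ne_zero
  have hcoc := Measure.ae_ae_of_ae_prod hℓ.ae_cocycle
  obtain ⟨y₀, hdet₀, hcoc₀⟩ := (hdet.and hcoc).exists
  set φ : Ω → (Fin d → ℝ) →L[ℝ] (Fin d → ℝ) := fun x => ℓ (y₀, x) with hφ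
  have hφm : Measurable φ := hℓ.stronglyMeasurable.measurable.comp measurable_prodMk_left
  have hφu : ∀ᵐ x ∂Q.mX, IsUnit (φ x) := hdet₀.mono fun x hx => isUnit_of_det_ne_zero hx
  have hθ : ∀ᵐ p ∂Q.mX.prod Q.mX, φ p.2 * Ring.inverse (φ p.1) = ℓ (Q.θ p) := by
    have h1 : ∀ᵐ p ∂Q.mX.prod Q.mX, IsUnit (φ p.1) := BoundedMap.fst.ae hφu
    filter_upwards [hcoc₀, h1] with p h1 h2
    have h3 : φ p.2 = ℓ (Q.θ p) * φ p.1 := h1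
    rw [h3, mul_assoc, Ring.mul_inverse_cancel _ h2, mul_one]
  obtain ⟨ρ, R, P, hρR, hPm, hP0, hPS, hρ, hPR, hfm⟩ := exists_bounded_representation
    (Q.mX_ne_zero hm) Q.measurePreserving_S Q.S_mul (Q.ae_mX.mono fun x hx => Q.S_one hx)
    hφm hφu (fun g => by
      filter_upwards [hθ, (Q.measurePreserving_SS g).quasiMeasurePreserving.ae hθ,
        hℓ.ae_θ_SS g] with p h1 h2 h3
      rw [h1, ← h3, ← h2]
      rfl)
  refine ⟨ρ, R, P.indicator fun x => Ring.inverse (φ x), P, hρR,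
    (hfm.indicator hPm).stronglyMeasurable, fun x => ?_, fun g => ?_, hPm, hP0, ?_⟩
  · by_cases hx : x ∈ P
    · rw [Set.indicator_of_mem hx]
      exact hPR x hx
    · rw [Set.indicator_of_notMem hx, norm_zero]
      exact (norm_nonneg _).trans (hρR 1)
  · filter_upwards [hPS g, hρ g] with x h1 h2
    by_cases hx : x ∈ P
    · rw [Set.indicator_of_mem hx, Set.indicator_of_mem (h1.2 hx), h2]
    · rw [Set.indicator_of_notMem hx, Set.indicator_of_notMem fun h => hx (h1.1 h), mul_zero]
  · filter_upwards [hdet, hcoc] with y h1 h2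
    have h3 : ∀ᵐ p ∂Q.mX.prod Q.mX, ℓ (y, p.2) = φ p.2 * Ring.inverse (φ p.1) * ℓ (y, p.1) := by
      filter_upwards [hθ, h2] with p h3 h4
      rw [h3, h4]
      rfl
    obtain ⟨x₁, h4, h5, h6⟩ := ((Measure.ae_ae_of_ae_prod h3).and (h1.and hφu)).exists
    refine ⟨Ring.inverse (φ x₁) * ℓ (y, x₁),
      h6.ringInverse.mul (isUnit_of_det_ne_zero h5), ?_⟩
    filter_upwards [h4, hφu] with x h7 h8
    by_cases hx : x ∈ P
    · rw [Set.indicator_of_mem hx, Set.indicator_of_mem hx, h7, mul_assoc,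
        Ring.inverse_mul_cancel_left _ _ h8]
    · rw [Set.indicator_of_notMem hx, Set.indicator_of_notMem hx, zero_mul]

set_option maxHeartbeats 1000000 in
/-- A group with an integrable strict coupling with `ℤ^d` is virtually `ℤ^d`. -/
theorem exists_finiteIndex (hm : m ≠ 0) (hSfin : SG.Finite) (hSsymm : ∀ s ∈ SG, s⁻¹ ∈ SG)
    (hSgen : Subgroup.closure SG = ⊤)
    (hb : ∀ g, Integrable (fun x => intVec (Q.b (Q.A g x))) Q.mX)
    (ha : ∀ v, Integrable (fun y => (wlen SG (Q.a (Q.B v y)) : ℝ)) Q.mY) :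
    ∃ K : Subgroup G, K.FiniteIndex ∧ Nonempty (K ≃* Multiplicative (Fin d → ℤ)) := by
  obtain ⟨ℓ, hℓ⟩ := Q.exists_isAsymptotic hSfin hSsymm hSgen hb ha
  obtain ⟨ρ, R, F, P, hρR, hFm, hFR, hFρ, hPm, hP0, hk⟩ := hℓ.exists_trivialization hm
  obtain ⟨C, hC⟩ := Q.exists_card_le hm hSfin hSsymm hSgen hb
  have hγ := Q.integrable_γ hSfin hSsymm hSgen hb ha
  have hR0 : 0 ≤ R := (norm_nonneg _).trans (hρR 1)
  have hY : (ae Q.mY).NeBot := ae_neBot.2 (Q.mY_ne_zero hm)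
  set e : (Fin d → ℤ) → Ω × Ω → ℝ := fun v z => ‖intVec (Q.γ v z) - ℓ z (intVec v)‖ with he
  have hes : Sublinear e (Q.mY.prod Q.mX) := hℓ.sublinear
  set q : (Fin d → ℤ) → Ω → ℝ := fun v y => ∫ x, e v (y, x) ∂Q.mX with hq
  have hqs : Sublinear q Q.mY := hes.integral_prod_left
  choose ns hmono hlim using hqs.exists_seq_tendsto_ae
  obtain ⟨y, ⟨k, hku, hky⟩, hlim, hγy, hey⟩ := (hk.and ((ae_all_iff.2 hlim).and
    ((ae_all_iff.2 fun v => (hγ v).prod_right_ae).and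
      (ae_all_iff.2 fun v => (hes.integrable v).prod_right_ae)))).exists
  set p : ℝ := Q.mX.real P with hp
  have hp0 : p ≠ 0 := by
    rw [hp, Measure.real, ENNReal.toReal_ne_zero]
    exact ⟨hP0, measure_ne_top _ _⟩
  have hbound : ∀ v, ‖Q.averagedCocycle F (Q.a (Q.B v y))⁻¹ - p • k (intVec v)‖ ≤ R * q v y := by
    intro v
    have i1 : Integrable (fun x => F x (intVec (Q.γ v (y, x)))) Q.mX :=
      integrable_clm_apply hFm.aestronglyMeasurable hFR (hγy v)
    have i2 : Integrable (P.indicator fun _ => k (intVec v)) Q.mX :=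
      (integrable_const _).indicator hPm
    have h1 : ∫ x, P.indicator (fun _ => k (intVec v)) x ∂Q.mX = p • k (intVec v) := by
      rw [integral_indicator hPm, setIntegral_const]
    rw [averagedCocycle, inv_inv, ← h1]
    change ‖∫ x, F x (intVec (Q.γ v (y, x))) ∂Q.mX - _‖ ≤ _
    rw [← integral_sub i1 i2, hq, ← integral_const_mul]
    refine norm_integral_le_of_norm_le ((hey v).const_mul R) ?_
    filter_upwards [hky] with x hx
    have h2 : P.indicator (fun _ => k (intVec v)) x = F x (ℓ (y, x) (intVec v)) := by
      have : F x (ℓ (y, x) (intVec v)) = (F x * ℓ (y, x)) (intVec v) := rfl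
      rw [this, hx]
      by_cases hxP : x ∈ P
      · rw [Set.indicator_of_mem hxP, Set.indicator_of_mem hxP]
      · rw [Set.indicator_of_notMem hxP, Set.indicator_of_notMem hxP]; rfl
    rw [h2, ← map_sub]
    exact ((F x).le_opNorm _).trans (mul_le_mul_of_nonneg_right (hFR x) (norm_nonneg _))
  obtain ⟨κ, rfl⟩ := hku
  set u : Module.Basis (Fin d) ℝ (Fin d → ℝ) := (Pi.basisFun ℝ (Fin d)).map
    ((ContinuousLinearEquiv.unitsEquiv ℝ (Fin d → ℝ) κ).toLinearEquiv.trans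
      (LinearEquiv.smulOfNeZero ℝ _ p hp0)) with hu
  have hui : ∀ i, u i = p • (κ : (Fin d → ℝ) →L[ℝ] (Fin d → ℝ)) (Pi.single i 1) := by
    intro i
    rw [hu, Module.Basis.map_apply, Pi.basisFun_apply]
    rfl
  refine exists_finiteIndex_of_cocycle hSfin hSsymm hSgen (wlen SG) wlen_one
    (wlen_mul_le hSsymm hSgen) (wlen_inv hSsymm hSgen) d C hC ρ R hρR (Q.averagedCocycle F)
    (Q.averagedCocycle_mul hFm hFR hFρ hb) u fun i =>
      ⟨fun n => (Q.a (Q.B (ns i n • Pi.single i 1) y))⁻¹, fun n => (ns i n : ℝ),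
        tendsto_natCast_atTop_atTop.comp (hmono i).tendsto_atTop, ?_⟩
  rw [tendsto_iff_norm_sub_tendsto_zero]
  refine squeeze_zero' (Eventually.of_forall fun n => norm_nonneg _) ?_
    (by rw [← mul_zero R]; exact (hlim i).const_mul R)
  filter_upwards [(hmono i).tendsto_atTop.eventually_gt_atTop 0] with n hn
  have hn0 : (0 : ℝ) < ns i n := by exact_mod_cast hn
  have h1 : intVec (ns i n • Pi.single i 1 : Fin d → ℤ) =
      (ns i n : ℝ) • (Pi.single i 1 : Fin d → ℝ) := by
    ext j
    simp [intVec_apply, Pi.single_apply]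
  have h2 := hbound (ns i n • Pi.single i 1)
  rw [h1, map_smul, smul_comm, ← hui] at h2
  have h3 : ∀ w : Fin d → ℝ,
      (ns i n : ℝ)⁻¹ • w - u i = (ns i n : ℝ)⁻¹ • (w - (ns i n : ℝ) • u i) := by
    intro w
    rw [smul_sub, inv_smul_smul₀ hn0.ne']
  rw [h3, norm_smul, norm_inv, Real.norm_of_nonneg hn0.le]
  calc _ ≤ (ns i n : ℝ)⁻¹ * (R * q (ns i n • Pi.single i 1) y) := by gcongr
    _ = _ := by ring

end StrictCoupling

end Conclusion

section Reduction

open Filter Topology Function Multiplicative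

theorem countable_of_closure_eq_top {G : Type*} [Group G] {S : Set G} (hS : S.Finite)
    (hgen : Subgroup.closure S = ⊤) : Countable G := by
  have : Group.FG G := Group.fg_iff.2 ⟨S, hgen, hS⟩
  obtain ⟨ι, _, φ, hφ⟩ := Group.fg_iff_exists_freeGroup_hom_surjective_finite.1 this
  have : Countable (FreeGroup ι) := Quot.mk_surjective.countable
  exact hφ.countable

/-- A measure preserving map restricts to a measure preserving map of an invariant subset. -/
theorem MeasureTheory.MeasurePreserving.comap_subtype_val {Ω : Type*} [MeasurableSpace Ω]
    {m : Measure Ω} {s : Set Ω} (hs : MeasurableSet s) {f : Ω → Ω} (hf : MeasurePreserving f m m)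
    (hfs : ∀ ω, f ω ∈ s ↔ ω ∈ s) :
    MeasurePreserving (fun ω : s => (⟨f ω, (hfs ω).2 ω.2⟩ : s)) (m.comap Subtype.val)
      (m.comap Subtype.val) := by
  have hm : Measurable (fun ω : s => (⟨f ω, (hfs ω).2 ω.2⟩ : s)) :=
    (hf.measurable.comp measurable_subtype_coe).subtype_mk
  refine ⟨hm, Measure.ext fun t ht => ?_⟩
  have he := MeasurableEmbedding.subtype_coe hs
  rw [Measure.map_apply hm ht, he.comap_apply, he.comap_apply, ← hf.measure_preimage
    (he.measurableSet_image.2 ht).nullMeasurableSet]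
  congr 1
  ext ω
  constructor
  · rintro ⟨x, hx, rfl⟩
    exact ⟨_, hx, rfl⟩
  · rintro ⟨x, hx, hxω⟩
    have hω : ω ∈ s := (hfs ω).1 (hxω ▸ x.2)
    refine ⟨⟨ω, hω⟩, ?_, rfl⟩
    have : x = ⟨f ω, (hfs ω).2 hω⟩ := Subtype.ext hxω
    rw [this] at hx
    exact hx

/-- Every measure coupling of `G` and `ℤ^d` becomes strict on a conull invariant subset. -/
theorem exists_strictCoupling {G : Type*} [Group G] [Countable G] [MeasurableSpace G]
    [DiscreteMeasurableSpace G] {d : ℕ} {Ω : Type*} [MeasurableSpace Ω] {m : Measure Ω}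
    {A : G → Ω → Ω} {B : Multiplicative (Fin d → ℤ) → Ω → Ω}
    (hA1 : ∀ ω, A 1 ω = ω) (hAmul : ∀ g g' ω, A (g * g') ω = A g (A g' ω))
    (hB1 : ∀ ω, B 1 ω = ω) (hBmul : ∀ v v' ω, B (v * v') ω = B v (B v' ω))
    (hApres : ∀ g, MeasurePreserving (A g) m m) (hBpres : ∀ v, MeasurePreserving (B v) m m)
    (hcomm : ∀ g v ω, A g (B v ω) = B v (A g ω))
    {X Y : Set Ω} (hXmeas : MeasurableSet X) (hYmeas : MeasurableSet Y)
    (hXfin : m X < ⊤) (hYfin : m Y < ⊤)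
    (hXfund : ∀ᵐ ω ∂m, ∃! v : Multiplicative (Fin d → ℤ), B v ω ∈ X)
    (hYfund : ∀ᵐ ω ∂m, ∃! g : G, A g ω ∈ Y) :
    ∃ (s : Set Ω) (Q : StrictCoupling G d (m.comap (Subtype.val : s → Ω))), MeasurableSet s ∧
      m sᶜ = 0 ∧ (∀ g ω, (Q.A g ω : Ω) = A g ω) ∧ (∀ v ω, (Q.B v ω : Ω) = B (ofAdd v) ω) ∧
      (∀ ω v, Q.b ω = v ↔ B (ofAdd v) ω ∈ X) ∧ ∀ ω g, Q.a ω = g ↔ A g ω ∈ Y := by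
  have : Countable (Multiplicative (Fin d → ℤ)) := inferInstanceAs (Countable (Fin d → ℤ))
  set N : Set Ω := toMeasurable m {ω | ¬((∃! v : Multiplicative (Fin d → ℤ), B v ω ∈ X) ∧
    ∃! g : G, A g ω ∈ Y)} with hN
  have hN0 : m N = 0 := by
    rw [hN, measure_toMeasurable]
    exact ae_iff.1 (hXfund.and hYfund)
  have hNm : MeasurableSet N := measurableSet_toMeasurable _ _
  have hNsub := subset_toMeasurable m {ω | ¬((∃! v : Multiplicative (Fin d → ℤ), B v ω ∈ X) ∧
    ∃! g : G, A g ω ∈ Y)}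
  set s : Set Ω := {ω | ∀ g v, A g (B v ω) ∉ N} with hs
  have hscompl : sᶜ = ⋃ g, ⋃ v, (A g ∘ B v) ⁻¹' N := by
    ext ω; simp [hs]
  have hp : ∀ g v, MeasurePreserving (A g ∘ B v) m m := fun g v => (hApres g).comp (hBpres v)
  have hsm : MeasurableSet s := by
    rw [← MeasurableSet.compl_iff, hscompl]
    exact MeasurableSet.iUnion fun g => MeasurableSet.iUnion fun v => (hp g v).measurable hNm
  have hs0 : m sᶜ = 0 := by
    rw [hscompl]
    refine measure_iUnion_null fun g => measure_iUnion_null fun v => ?_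
    rw [(hp g v).measure_preimage hNm.nullMeasurableSet, hN0]
  have hfund : ∀ ω ∈ s, (∃! v : Multiplicative (Fin d → ℤ), B v ω ∈ X) ∧ ∃! g : G, A g ω ∈ Y := by
    intro ω hω
    have h1 := hω 1 1
    rw [hA1, hB1] at h1
    by_contra h
    exact h1 (hNsub h)
  have hAs' : ∀ g ω, ω ∈ s → A g ω ∈ s := fun g ω hω g' v' => by
    rw [← hcomm, ← hAmul]; exact hω _ _
  have hBs' : ∀ v ω, ω ∈ s → B v ω ∈ s := fun v ω hω g' v' => by
    rw [← hBmul]; exact hω _ _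
  have hAs : ∀ g ω, A g ω ∈ s ↔ ω ∈ s := fun g ω => ⟨fun h => by
    have := hAs' g⁻¹ _ h
    rwa [← hAmul, inv_mul_cancel, hA1] at this, hAs' g ω⟩
  have hBs : ∀ v ω, B v ω ∈ s ↔ ω ∈ s := fun v ω => ⟨fun h => by
    have := hBs' v⁻¹ _ h
    rwa [← hBmul, inv_mul_cancel, hB1] at this, hBs' v ω⟩
  choose b hbX hbu using fun ω : s => (hfund ω ω.2).1
  choose a haY hau using fun ω : s => (hfund ω ω.2).2
  have hb : ∀ (ω : s) (v : Multiplicative (Fin d → ℤ)), b ω = v ↔ B v ω ∈ X := fun ω v =>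
    ⟨fun h => h ▸ hbX ω, fun h => (hbu ω v h).symm⟩
  have ha : ∀ (ω : s) (g : G), a ω = g ↔ A g ω ∈ Y := fun ω g =>
    ⟨fun h => h ▸ haY ω, fun h => (hau ω g h).symm⟩
  have hb' : ∀ (ω : s) (v : Fin d → ℤ), toAdd (b ω) = v ↔ B (ofAdd v) ω ∈ X := fun ω v =>
    (hb ω (ofAdd v))
  have hbs : (fun ω => toAdd (b ω)) ⁻¹' {0} = Subtype.val ⁻¹' X := by
    ext ω
    rw [Set.mem_preimage, Set.mem_singleton_iff, hb', ofAdd_zero, hB1]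
    rfl
  have has : a ⁻¹' {1} = Subtype.val ⁻¹' Y := by
    ext ω
    rw [Set.mem_preimage, Set.mem_singleton_iff, ha, hA1]
    rfl
  have hfin : ∀ Z : Set Ω, m Z < ⊤ → m.comap (Subtype.val : s → Ω) (Subtype.val ⁻¹' Z) < ⊤ := by
    intro Z hZ
    rw [(MeasurableEmbedding.subtype_coe hsm).comap_apply]
    exact (measure_mono (Set.image_preimage_subset _ _)).trans_lt hZ
  refine ⟨s,
    { A := fun g ω => ⟨A g ω, (hAs g ω).2 ω.2⟩
      B := fun v ω => ⟨B (ofAdd v) ω, (hBs (ofAdd v) ω).2 ω.2⟩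
      a := a
      b := fun ω => toAdd (b ω)
      A_one := fun ω => Subtype.ext (hA1 ω)
      A_mul := fun g h ω => Subtype.ext (hAmul g h ω)
      B_zero := fun ω => Subtype.ext (hB1 ω)
      B_add := fun v w ω => Subtype.ext (hBmul (ofAdd v) (ofAdd w) ω)
      comm := fun g v ω => Subtype.ext (hcomm g (ofAdd v) ω)
      mpA := fun g => (hApres g).comap_subtype_val hsm (hAs g)
      mpB := fun v => (hBpres (ofAdd v)).comap_subtype_val hsm (hBs (ofAdd v))
      measurable_a := measurable_to_countable' fun g => ?_
      measurable_b := measurable_to_countable' fun v => ?_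
      a_A := fun g ω => (ha _ _).2 ?_
      b_B := fun v ω => (hb' _ _).2 ?_
      finite_Y := by rw [has]; exact hfin Y hYfin
      finite_X := by rw [hbs]; exact hfin X hXfin }, hsm, hs0, fun _ _ => rfl, fun _ _ => rfl,
      hb', ha⟩
  · have h1 : a ⁻¹' {g} = (fun ω : s => A g ω) ⁻¹' Y := Set.ext fun ω => ha ω g
    rw [h1]
    exact ((hApres g).measurable.comp measurable_subtype_coe) hYmeas
  · have h1 : (fun ω => toAdd (b ω)) ⁻¹' {v} = (fun ω : s => B (ofAdd v) ω) ⁻¹' X :=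
      Set.ext fun ω => hb' ω v
    rw [h1]
    exact ((hBpres _).measurable.comp measurable_subtype_coe) hXmeas
  · rw [← hAmul, inv_mul_cancel_right]
    exact haY ω
  · rw [← hBmul, ← ofAdd_add, sub_add_cancel]
    exact hbX ω

end Reduction

theorem stmt17 {G : Type*} [Group G] (d : ℕ) (hd : 1 ≤ d)
    (SG : Set G) (hSGfin : SG.Finite) (hSGsymm : ∀ s ∈ SG, s⁻¹ ∈ SG)
    (hSGgen : Subgroup.closure SG = ⊤)
    -- a word length on `ℤ^d`, given by a finite symmetric generating set
    (SH : Set (Multiplicative (Fin d → ℤ))) (hSHfin : SH.Finite)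
    (hSHsymm : ∀ s ∈ SH, s⁻¹ ∈ SH)
    (hSHgen : Subgroup.closure SH = ⊤)
    -- the coupling space
    {Ω : Type*} [MeasurableSpace Ω] (m : Measure Ω) [SigmaFinite m] (hm : m ≠ 0)
    -- commuting measure-preserving actions of `G` and `ℤ^d`
    (A : G → Ω → Ω) (B : Multiplicative (Fin d → ℤ) → Ω → Ω)
    (hA1 : ∀ ω, A 1 ω = ω) (hAmul : ∀ g g' ω, A (g * g') ω = A g (A g' ω))
    (hB1 : ∀ ω, B 1 ω = ω) (hBmul : ∀ v v' ω, B (v * v') ω = B v (B v' ω))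
    (hAmeas : ∀ g, Measurable (A g)) (hBmeas : ∀ v, Measurable (B v))
    (hApres : ∀ g, MeasurePreserving (A g) m m)
    (hBpres : ∀ v, MeasurePreserving (B v) m m)
    (hcomm : ∀ g v ω, A g (B v ω) = B v (A g ω))
    -- essential freeness
    (hAfree : ∀ᵐ ω ∂m, ∀ g : G, A g ω = ω → g = 1)
    (hBfree : ∀ᵐ ω ∂m, ∀ v : Multiplicative (Fin d → ℤ), B v ω = ω → v = 1)
    -- finite-measure fundamental domains: `Y` for `G`, `X` for `ℤ^d`
    (X Y : Set Ω) (hXmeas : MeasurableSet X) (hYmeas : MeasurableSet Y)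
    (hXfin : m X < ⊤) (hYfin : m Y < ⊤)
    (hXfund : ∀ᵐ ω ∂m, ∃! v : Multiplicative (Fin d → ℤ), B v ω ∈ X)
    (hYfund : ∀ᵐ ω ∂m, ∃! g : G, A g ω ∈ Y)
    -- the associated cocycles, determined by `g·x ∈ α(g,x)⁻¹·X` and `v·y ∈ β(v,y)⁻¹·Y`
    (α : G → Ω → Multiplicative (Fin d → ℤ))
    (hαmeas : ∀ (g : G) (v : Multiplicative (Fin d → ℤ)), MeasurableSet {ω | α g ω = v})
    (hαdef : ∀ g : G, ∀ᵐ ω ∂m, ω ∈ X → B (α g ω) (A g ω) ∈ X)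
    (β : Multiplicative (Fin d → ℤ) → Ω → G)
    (hβmeas : ∀ (v : Multiplicative (Fin d → ℤ)) (g : G), MeasurableSet {ω | β v ω = g})
    (hβdef : ∀ v : Multiplicative (Fin d → ℤ), ∀ᵐ ω ∂m, ω ∈ Y → A (β v ω) (B v ω) ∈ Y)
    -- integrability of the coupling
    (hαint : ∀ g : G, IntegrableOn (fun ω => (wlen SH (α g ω) : ℝ)) X m)
    (hβint : ∀ v : Multiplicative (Fin d → ℤ),
      IntegrableOn (fun ω => (wlen SG (β v ω) : ℝ)) Y m) :
    ∃ K : Subgroup G, K.FiniteIndex ∧ Nonempty (K ≃* Multiplicative (Fin d → ℤ)) := by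
  have hG : Countable G := countable_of_closure_eq_top hSGfin hSGgen
  let _ : MeasurableSpace G := ⊤
  have : DiscreteMeasurableSpace G := ⟨fun _ => trivial⟩
  obtain ⟨s, Q, hsm, hs0, hQA, hQB, hb, ha⟩ := exists_strictCoupling hA1 hAmul hB1 hBmul hApres
    hBpres hcomm hXmeas hYmeas hXfin hYfin hXfund hYfund
  have hval : MeasurePreserving (Subtype.val : s → Ω) (m.comap Subtype.val) (m.restrict s) :=
    measurePreserving_subtype_coe hsm
  have hbs : Q.b ⁻¹' {0} = Subtype.val ⁻¹' X := by
    ext ω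
    rw [Set.mem_preimage, Set.mem_singleton_iff, hb, ofAdd_zero, hB1]
    rfl
  have has : Q.a ⁻¹' {1} = Subtype.val ⁻¹' Y := by
    ext ω
    rw [Set.mem_preimage, Set.mem_singleton_iff, ha, hA1]
    rfl
  have hX : MeasurePreserving (Subtype.val : s → Ω) Q.mX ((m.restrict s).restrict X) := by
    rw [StrictCoupling.mX, hbs]
    exact hval.restrict_preimage hXmeas
  have hY : MeasurePreserving (Subtype.val : s → Ω) Q.mY ((m.restrict s).restrict Y) := by
    rw [StrictCoupling.mY, has]
    exact hval.restrict_preimage hYmeas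
  have hle : ∀ Z, (m.restrict s).restrict Z ≤ m.restrict Z := fun Z =>
    Measure.restrict_mono subset_rfl Measure.restrict_le_self
  have hm' : m.comap (Subtype.val : s → Ω) ≠ 0 := by
    intro h
    refine hm (Measure.measure_univ_eq_zero.1 ?_)
    rw [← Set.union_compl_self s]
    refine measure_union_null ?_ hs0
    rw [← Measure.restrict_apply_self, ← hval.map_eq, h, Measure.map_zero, Measure.coe_zero,
      Pi.zero_apply]
  obtain ⟨C, hC0, hC⟩ := le_mul_wlen hSHfin hSHsymm hSHgen (fun v => ‖v.toAdd‖)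
    (by simp) (fun v w => by rw [toAdd_mul]; exact norm_add_le _ _)
  refine Q.exists_finiteIndex hm' hSGfin hSGsymm hSGgen (fun g => ?_) fun v => ?_
  · have h1 : Integrable (fun x : s => C * (wlen SH (α g x) : ℝ)) Q.mX :=
      (hX.integrable_comp_of_integrable (Integrable.mono_measure (hαint g) (hle X))).const_mul C
    refine h1.mono' ((measurable_of_countable intVec).comp
      (Q.measurable_b.comp (Q.mpA g).measurable)).aestronglyMeasurable ?_
    have h2 : ∀ᵐ x : s ∂Q.mX, (x : Ω) ∈ X → B (α g x) (A g x) ∈ X :=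
      hX.quasiMeasurePreserving.ae ((hle X).absolutelyContinuous.ae_le
        (ae_restrict_of_ae (hαdef g)))
    filter_upwards [h2, Q.ae_mX] with x h3 h4
    have h5 : (x : Ω) ∈ X := by
      have : x ∈ Q.b ⁻¹' {0} := h4
      rwa [hbs] at this
    have h6 : Q.b (Q.A g x) = (α g x).toAdd := by
      rw [hb, hQA, ofAdd_toAdd]
      exact h3 h5
    rw [h6, norm_intVec]
    exact hC _
  · have h1 : Integrable (fun y : s => (wlen SG (β (Multiplicative.ofAdd v) y) : ℝ)) Q.mY :=
      hY.integrable_comp_of_integrable (Integrable.mono_measure (hβint _) (hle Y))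
    refine h1.congr ?_
    have h2 : ∀ᵐ y : s ∂Q.mY, (y : Ω) ∈ Y →
        A (β (Multiplicative.ofAdd v) y) (B (Multiplicative.ofAdd v) y) ∈ Y :=
      hY.quasiMeasurePreserving.ae ((hle Y).absolutelyContinuous.ae_le
        (ae_restrict_of_ae (hβdef _)))
    filter_upwards [h2, Q.ae_mY] with y h3 h4
    have h5 : (y : Ω) ∈ Y := by
      have : y ∈ Q.a ⁻¹' {1} := h4
      rwa [has] at this
    have h6 : Q.a (Q.B v y) = β (Multiplicative.ofAdd v) y := by
      rw [ha, hQB]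
      exact h3 h5
    rw [h6]
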